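/- arXiv:2202.04923 — 3 statements merged into one kernel-verified Lean document; each statement's English description precedes it below -/
import Mathlib

section
/- For every integer n ≥ 4, the number of triple points of the Böröczky arrangement B_n of n lines equals ⌊n(n−3)/6⌋ + 1; that is, the set T_n of points of the real affine plane lying on at least three of the n arrangement lines has cardinality ⌊n(n−3)/6⌋ + 1. -/
/-- The point on the unit circle at angle `α`. -/
noncomputable def Qpt (α : ℝ) : ℝ × ℝ := (Real.cos α, Real.sin α)

/-- The `k`-th line of the Böröczky arrangement of `n` lines: the line through
`Q_{α_k}` and `Q_{π - 2α_k}` (with `α_k = 2kπ/n`) if these points are distinct, and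
the tangent line to the unit circle at `Q_{α_k}` if they coincide. -/
noncomputable def boLine (n k : ℕ) : Set (ℝ × ℝ) :=
  if Qpt (2 * k * Real.pi / n) = Qpt (Real.pi - 2 * (2 * k * Real.pi / n)) then
    {p : ℝ × ℝ | p.1 * Real.cos (2 * k * Real.pi / n)
        + p.2 * Real.sin (2 * k * Real.pi / n) = 1}
  else
    (affineSpan ℝ {Qpt (2 * k * Real.pi / n),
        Qpt (Real.pi - 2 * (2 * k * Real.pi / n))} : Set (ℝ × ℝ))

/-- The set of triple points of the Böröczky arrangement of `n` lines: points of the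
real affine plane lying on at least three of the lines `ℓ_0, …, ℓ_{n-1}`. -/
noncomputable def tripleSet (n : ℕ) : Set (ℝ × ℝ) :=
  {p | 3 ≤ {k : ℕ | k < n ∧ p ∈ boLine n k}.ncard}

/-- The angle `kπ/n` attached to the residue class of `k` modulo `n`. -/
noncomputable def boAngle {n : ℕ} (i : ZMod n) : ℝ := i.val * Real.pi / n

/-- The line with equation `x sin θ + y cos θ = sin 3θ`. -/
def OnBoLine (θ : ℝ) (p : ℝ × ℝ) : Prop :=
  p.1 * Real.sin θ + p.2 * Real.cos θ = Real.sin (3 * θ)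

theorem Qpt_two_mul (θ : ℝ) :
    Qpt (2 * θ) =
      (Real.sin (3 * θ) * Real.sin θ + Real.cos (3 * θ) * Real.cos θ,
        Real.sin (3 * θ) * Real.cos θ - Real.cos (3 * θ) * Real.sin θ) := by
  have h : 2 * θ = 3 * θ - θ := by ring
  rw [Qpt, h, Real.cos_sub, Real.sin_sub]
  ext <;> ring

theorem Qpt_pi_sub (θ : ℝ) :
    Qpt (Real.pi - 2 * (2 * θ)) =
      (Real.sin (3 * θ) * Real.sin θ - Real.cos (3 * θ) * Real.cos θ,
        Real.sin (3 * θ) * Real.cos θ + Real.cos (3 * θ) * Real.sin θ) := by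
  have h : 2 * (2 * θ) = 3 * θ + θ := by ring
  rw [Qpt, Real.cos_pi_sub, Real.sin_pi_sub, h, Real.cos_add, Real.sin_add]
  ext <;> ring

theorem Qpt_two_mul_eq_iff (θ : ℝ) :
    Qpt (2 * θ) = Qpt (Real.pi - 2 * (2 * θ)) ↔ Real.cos (3 * θ) = 0 := by
  rw [Qpt_two_mul, Qpt_pi_sub, Prod.mk.injEq]
  constructor
  · rintro ⟨h₁, h₂⟩
    linear_combination (Real.cos θ / 2) * h₁ - (Real.sin θ / 2) * h₂ -
      Real.cos (3 * θ) * Real.sin_sq_add_cos_sq θ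
  · intro h
    simp [h]

theorem mem_tangent_iff (θ : ℝ) (h : Real.cos (3 * θ) = 0) (p : ℝ × ℝ) :
    p.1 * Real.cos (2 * θ) + p.2 * Real.sin (2 * θ) = 1 ↔ OnBoLine θ p := by
  have hQ := Qpt_two_mul θ
  rw [Qpt, Prod.mk.injEq, h] at hQ
  have hs : Real.sin (3 * θ) ^ 2 = 1 := by
    have := Real.sin_sq_add_cos_sq (3 * θ)
    rwa [h, zero_pow two_ne_zero, add_zero] at this
  rw [hQ.1, hQ.2, OnBoLine]
  constructor
  · intro hp
    linear_combination Real.sin (3 * θ) * hp -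
      (p.1 * Real.sin θ + p.2 * Real.cos θ) * hs
  · intro hp
    linear_combination Real.sin (3 * θ) * hp + hs

theorem mem_chord_iff (θ : ℝ) (h : Real.cos (3 * θ) ≠ 0) (p : ℝ × ℝ) :
    p ∈ (affineSpan ℝ {Qpt (2 * θ), Qpt (Real.pi - 2 * (2 * θ))} : Set (ℝ × ℝ)) ↔
      OnBoLine θ p := by
  have hsq := Real.sin_sq_add_cos_sq θ
  rw [SetLike.mem_coe, mem_affineSpan_pair_iff_exists_lineMap_eq, Qpt_two_mul, Qpt_pi_sub, OnBoLine]
  constructor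
  · rintro ⟨r, rfl⟩
    simp only [AffineMap.lineMap_apply, vsub_eq_sub, vadd_eq_add, Prod.mk_sub_mk, Prod.smul_mk,
      smul_eq_mul, Prod.mk_add_mk]
    linear_combination Real.sin (3 * θ) * hsq
  · intro hp
    refine ⟨(Real.cos (3 * θ) - (p.1 * Real.cos θ - p.2 * Real.sin θ)) /
      (2 * Real.cos (3 * θ)), ?_⟩
    simp only [AffineMap.lineMap_apply, vsub_eq_sub, vadd_eq_add, Prod.mk_sub_mk, Prod.smul_mk,
      smul_eq_mul, Prod.mk_add_mk]
    ext
    · simp only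
      field_simp
      linear_combination 2 * Real.cos (3 * θ) * (p.1 * hsq - Real.sin θ * hp)
    · simp only
      field_simp
      linear_combination 2 * Real.cos (3 * θ) * (p.2 * hsq - Real.cos θ * hp)

theorem mem_boLine_iff (n k : ℕ) (p : ℝ × ℝ) :
    p ∈ boLine n k ↔ OnBoLine (k * Real.pi / n) p := by
  have h : 2 * (k : ℝ) * Real.pi / n = 2 * (k * Real.pi / n) := by ring
  rw [boLine, h]
  split_ifs with hc
  · exact mem_tangent_iff _ ((Qpt_two_mul_eq_iff _).1 hc) p
  · exact mem_chord_iff _ (fun h₀ => hc ((Qpt_two_mul_eq_iff _).2 h₀)) p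

theorem sin_three_mul_cyclic_sum (a b c : ℝ) :
    Real.sin (3 * a) * Real.sin (b - c) + Real.sin (3 * b) * Real.sin (c - a) +
      Real.sin (3 * c) * Real.sin (a - b) =
    4 * Real.sin (a - b) * Real.sin (b - c) * Real.sin (c - a) * Real.sin (a + b + c) := by
  have ha := Real.sin_sq_add_cos_sq a
  have hb := Real.sin_sq_add_cos_sq b
  have hc := Real.sin_sq_add_cos_sq c
  have key : ∀ sa ca sb cb sc cc : ℝ,
      -4 * (sa ^ 3 * (sb * cc - cb * sc) * (sb ^ 2 + cb ^ 2) * (sc ^ 2 + cc ^ 2) +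
        sb ^ 3 * (sc * ca - cc * sa) * (sa ^ 2 + ca ^ 2) * (sc ^ 2 + cc ^ 2) +
        sc ^ 3 * (sa * cb - ca * sb) * (sa ^ 2 + ca ^ 2) * (sb ^ 2 + cb ^ 2)) =
      4 * (sa * cb - ca * sb) * (sb * cc - cb * sc) * (sc * ca - cc * sa) *
        ((sa * cb + ca * sb) * cc + (ca * cb - sa * sb) * sc) := by
    intros; ring
  have h := key (Real.sin a) (Real.cos a) (Real.sin b) (Real.cos b) (Real.sin c) (Real.cos c)
  rw [ha, hb, hc] at h
  simp only [Real.sin_three_mul, Real.sin_sub, Real.sin_add, Real.cos_add]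
  linear_combination h

theorem sin_boLine_combination {a b c : ℝ} {p : ℝ × ℝ} (ha : OnBoLine a p) (hb : OnBoLine b p) :
    (Real.sin (3 * c) - (p.1 * Real.sin c + p.2 * Real.cos c)) * Real.sin (a - b) =
    4 * Real.sin (a - b) * Real.sin (b - c) * Real.sin (c - a) * Real.sin (a + b + c) := by
  rw [← sin_three_mul_cyclic_sum, ← ha, ← hb]
  simp only [Real.sin_sub]
  ring

theorem existsUnique_onBoLine {a b : ℝ} (h : Real.sin (a - b) ≠ 0) :
    ∃! p, OnBoLine a p ∧ OnBoLine b p := by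
  have hd : Real.sin a * Real.cos b - Real.cos a * Real.sin b ≠ 0 := by rwa [← Real.sin_sub]
  refine ⟨((Real.sin (3 * a) * Real.cos b - Real.sin (3 * b) * Real.cos a) /
      (Real.sin a * Real.cos b - Real.cos a * Real.sin b),
    (Real.sin (3 * b) * Real.sin a - Real.sin (3 * a) * Real.sin b) /
      (Real.sin a * Real.cos b - Real.cos a * Real.sin b)), ⟨?_, ?_⟩, ?_⟩
  · rw [OnBoLine, div_mul_eq_mul_div, div_mul_eq_mul_div, ← add_div, div_eq_iff hd]
    ring
  · rw [OnBoLine, div_mul_eq_mul_div, div_mul_eq_mul_div, ← add_div, div_eq_iff hd]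
    ring
  · rintro ⟨x, y⟩ ⟨h₁, h₂⟩
    simp only [OnBoLine] at h₁ h₂
    ext
    · rw [eq_div_iff hd]
      linear_combination Real.cos b * h₁ - Real.cos a * h₂
    · rw [eq_div_iff hd]
      linear_combination Real.sin a * h₂ - Real.sin b * h₁

theorem sin_int_mul_pi_div_eq_zero_iff {n : ℕ} [NeZero n] (z : ℤ) :
    Real.sin (z * Real.pi / n) = 0 ↔ (z : ZMod n) = 0 := by
  have hn : (n : ℝ) ≠ 0 := NeZero.ne _
  rw [Real.sin_eq_zero_iff, ZMod.intCast_zmod_eq_zero_iff_dvd]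
  constructor
  · rintro ⟨m, hm⟩
    refine ⟨m, ?_⟩
    rw [eq_div_iff hn] at hm
    have : (z : ℝ) = n * m := mul_right_cancel₀ Real.pi_ne_zero (by linear_combination -hm)
    exact_mod_cast this
  · rintro ⟨m, rfl⟩
    refine ⟨m, ?_⟩
    push_cast
    field_simp

theorem sin_boAngle_sub_eq_zero_iff {n : ℕ} [NeZero n] (i j : ZMod n) :
    Real.sin (boAngle i - boAngle j) = 0 ↔ i = j := by
  have h := sin_int_mul_pi_div_eq_zero_iff (n := n) ((i.val : ℤ) - j.val)
  push_cast [ZMod.natCast_zmod_val] at h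
  rw [sub_eq_zero] at h
  rw [← h, boAngle, boAngle]
  ring_nf

theorem sin_boAngle_add_eq_zero_iff {n : ℕ} [NeZero n] (i j k : ZMod n) :
    Real.sin (boAngle i + boAngle j + boAngle k) = 0 ↔ i + j + k = 0 := by
  have h := sin_int_mul_pi_div_eq_zero_iff (n := n) ((i.val : ℤ) + j.val + k.val)
  push_cast [ZMod.natCast_zmod_val] at h
  rw [← h, boAngle, boAngle, boAngle]
  ring_nf

theorem onBoLine_third_iff {n : ℕ} [NeZero n] {i j k : ZMod n} {p : ℝ × ℝ} (hij : i ≠ j)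
    (hi : OnBoLine (boAngle i) p) (hj : OnBoLine (boAngle j) p) :
    OnBoLine (boAngle k) p ↔ j = k ∨ k = i ∨ i + j + k = 0 := by
  have h := sin_boLine_combination (c := boAngle k) hi hj
  have hs : Real.sin (boAngle i - boAngle j) ≠ 0 :=
    fun h₀ => hij ((sin_boAngle_sub_eq_zero_iff i j).1 h₀)
  rw [← sin_boAngle_sub_eq_zero_iff j k, ← sin_boAngle_sub_eq_zero_iff k i,
    ← sin_boAngle_add_eq_zero_iff i j k]
  calc OnBoLine (boAngle k) p
      ↔ (Real.sin (3 * boAngle k) - (p.1 * Real.sin (boAngle k) + p.2 * Real.cos (boAngle k))) *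
          Real.sin (boAngle i - boAngle j) = 0 := by
        rw [mul_eq_zero, or_iff_left hs, sub_eq_zero, OnBoLine, eq_comm]
    _ ↔ _ := by
        rw [h]
        simp [hs, or_assoc]

open Classical in
/-- The indices of the lines of the arrangement passing through a point. -/
noncomputable def linesThrough (n : ℕ) [NeZero n] (p : ℝ × ℝ) : Finset (ZMod n) :=
  Finset.univ.filter fun i => OnBoLine (boAngle i) p

theorem mem_linesThrough {n : ℕ} [NeZero n] {p : ℝ × ℝ} {i : ZMod n} :
    i ∈ linesThrough n p ↔ OnBoLine (boAngle i) p := by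
  simp [linesThrough]

theorem mem_tripleSet_iff {n : ℕ} [NeZero n] (p : ℝ × ℝ) :
    p ∈ tripleSet n ↔ 3 ≤ (linesThrough n p).card := by
  have h : {k : ℕ | k < n ∧ p ∈ boLine n k} =
      (ZMod.val : ZMod n → ℕ) '' (linesThrough n p : Set (ZMod n)) := by
    ext k
    simp only [Set.mem_ofPred_eq, Set.mem_image, SetLike.mem_coe, mem_linesThrough, mem_boLine_iff]
    constructor
    · rintro ⟨hk, hp⟩
      refine ⟨k, ?_, ZMod.val_cast_of_lt hk⟩
      rwa [boAngle, ZMod.val_cast_of_lt hk]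
    · rintro ⟨i, hi, rfl⟩
      exact ⟨i.val_lt, hi⟩
  rw [tripleSet, Set.mem_ofPred_eq, h, Set.ncard_image_of_injective _ (ZMod.val_injective n),
    Set.ncard_coe_finset]

/-- The three-element subsets of `ZMod n` with zero sum. -/
def zeroSumTriples (n : ℕ) [NeZero n] : Finset (Finset (ZMod n)) :=
  Finset.univ.filter fun s => s.card = 3 ∧ ∑ i ∈ s, i = 0

theorem eq_of_mem_zeroSumTriples {n : ℕ} [NeZero n] {s : Finset (ZMod n)}
    (hs : s ∈ zeroSumTriples n) {i j : ZMod n} (hi : i ∈ s) (hj : j ∈ s) (hij : i ≠ j) :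
    s = {i, j, -i - j} ∧ i ≠ -i - j ∧ j ≠ -i - j := by
  obtain ⟨hc, hsum⟩ := (Finset.mem_filter.1 hs).2
  have hsub : ({i, j} : Finset (ZMod n)) ⊆ s := by
    simp [Finset.insert_subset_iff, hi, hj]
  have hd : (s \ {i, j}).card = 1 := by
    rw [Finset.card_sdiff_of_subset hsub, hc, Finset.card_pair hij]
  obtain ⟨k, hk⟩ := Finset.card_eq_one.1 hd
  have hks : k ∈ s \ {i, j} := by simp [hk]
  simp only [Finset.mem_sdiff, Finset.mem_insert, Finset.mem_singleton, not_or] at hks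
  have hsum' := Finset.sum_sdiff (f := fun x : ZMod n => x) hsub
  rw [hk, Finset.sum_singleton, Finset.sum_pair hij, hsum] at hsum'
  have hk' : k = -i - j := by linear_combination hsum'
  subst hk'
  refine ⟨?_, Ne.symm hks.2.1, Ne.symm hks.2.2⟩
  rw [← Finset.sdiff_union_of_subset hsub, hk]
  ext x
  simp only [Finset.mem_union, Finset.mem_insert, Finset.mem_singleton]
  tauto

theorem triple_mem_zeroSumTriples {n : ℕ} [NeZero n] {i j : ZMod n} (hij : i ≠ j)
    (hi : i ≠ -i - j) (hj : j ≠ -i - j) : ({i, j, -i - j} : Finset (ZMod n)) ∈ zeroSumTriples n := by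
  refine Finset.mem_filter.2
    ⟨Finset.mem_univ _, Finset.card_eq_three.2 ⟨_, _, _, hij, hi, hj, rfl⟩, ?_⟩
  rw [Finset.sum_insert (by simp [hij, hi]), Finset.sum_pair hj]
  ring

theorem linesThrough_eq {n : ℕ} [NeZero n] {i j : ZMod n} {p : ℝ × ℝ} (hij : i ≠ j)
    (hi : OnBoLine (boAngle i) p) (hj : OnBoLine (boAngle j) p) :
    linesThrough n p = {i, j, -i - j} := by
  ext k
  rw [mem_linesThrough, onBoLine_third_iff hij hi hj]
  have : i + j + k = 0 ↔ k = -i - j :=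
    ⟨fun h => by linear_combination h, fun h => by rw [h]; ring⟩
  simp only [Finset.mem_insert, Finset.mem_singleton, this, eq_comm (a := j)]
  tauto

theorem existsUnique_onBoLine_boAngle {n : ℕ} [NeZero n] {i j : ZMod n} (hij : i ≠ j) :
    ∃! p, OnBoLine (boAngle i) p ∧ OnBoLine (boAngle j) p :=
  existsUnique_onBoLine fun h => hij ((sin_boAngle_sub_eq_zero_iff i j).1 h)

theorem linesThrough_bijOn (n : ℕ) [NeZero n] :
    Set.BijOn (linesThrough n) (tripleSet n) (zeroSumTriples n) := by
  refine ⟨fun p hp => ?_, fun p hp q hq hpq => ?_, fun s hs => ?_⟩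
  · rw [mem_tripleSet_iff] at hp
    obtain ⟨i, hi, j, hj, hij⟩ := Finset.one_lt_card.1 (by omega : 1 < (linesThrough n p).card)
    have h := linesThrough_eq hij (mem_linesThrough.1 hi) (mem_linesThrough.1 hj)
    rw [h] at hp
    rw [SetLike.mem_coe, h]
    refine triple_mem_zeroSumTriples hij (fun h₀ => ?_) (fun h₀ => ?_)
    · rw [← h₀] at hp
      have : ({i, j, i} : Finset (ZMod n)) = {i, j} := by ext; simp; tauto
      rw [this] at hp
      exact absurd hp (by have := Finset.card_le_two (a := i) (b := j); omega)
    · rw [← h₀] at hp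
      have : ({i, j, j} : Finset (ZMod n)) = {i, j} := by simp
      rw [this] at hp
      exact absurd hp (by have := Finset.card_le_two (a := i) (b := j); omega)
  · rw [mem_tripleSet_iff] at hp
    obtain ⟨i, hi, j, hj, hij⟩ := Finset.one_lt_card.1 (by omega : 1 < (linesThrough n p).card)
    refine (existsUnique_onBoLine_boAngle hij).unique
      ⟨mem_linesThrough.1 hi, mem_linesThrough.1 hj⟩ ?_
    rw [hpq] at hi hj
    exact ⟨mem_linesThrough.1 hi, mem_linesThrough.1 hj⟩
  · have hc := (Finset.mem_filter.1 (SetLike.mem_coe.1 hs)).2.1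
    obtain ⟨i, hi, j, hj, hij⟩ := Finset.one_lt_card.1 (by omega : 1 < s.card)
    obtain ⟨p, ⟨hpi, hpj⟩, -⟩ := existsUnique_onBoLine_boAngle hij
    have h : linesThrough n p = s :=
      (linesThrough_eq hij hpi hpj).trans (eq_of_mem_zeroSumTriples hs hi hj hij).1.symm
    exact ⟨p, (mem_tripleSet_iff p).2 (by rw [h, hc]), h⟩

/-- The ordered pairs which extend to an ordered triple of distinct elements with zero sum. -/
def distinctPairs (n : ℕ) [NeZero n] : Finset (ZMod n × ZMod n) :=
  Finset.univ.filter fun x => x.1 ≠ x.2 ∧ x.1 ≠ -x.1 - x.2 ∧ x.2 ≠ -x.1 - x.2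

theorem card_distinctPairs_eq_six_mul (n : ℕ) [NeZero n] :
    (distinctPairs n).card = 6 * (zeroSumTriples n).card := by
  rw [Finset.card_eq_sum_card_fiberwise (f := fun x => {x.1, x.2, -x.1 - x.2})
    (t := zeroSumTriples n)]
  · rw [Finset.sum_const_nat (m := 6), mul_comm]
    intro s hs
    have h : ((distinctPairs n).filter fun x => ({x.1, x.2, -x.1 - x.2} : Finset (ZMod n)) = s) =
        s.offDiag := by
      ext ⟨i, j⟩
      simp only [distinctPairs, Finset.mem_filter, Finset.mem_univ, true_and, Finset.mem_offDiag]
      constructor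
      · rintro ⟨⟨hij, -, -⟩, rfl⟩
        simp [hij]
      · rintro ⟨hi, hj, hij⟩
        obtain ⟨h₁, h₂, h₃⟩ := eq_of_mem_zeroSumTriples hs hi hj hij
        exact ⟨⟨hij, h₂, h₃⟩, h₁.symm⟩
    rw [h, Finset.offDiag_card, (Finset.mem_filter.1 hs).2.1]
  · intro x hx
    obtain ⟨h₁, h₂, h₃⟩ := (Finset.mem_filter.1 hx).2
    exact triple_mem_zeroSumTriples h₁ h₂ h₃

theorem card_filter_snd_eq {α : Type*} [Fintype α] [DecidableEq α] (f : α → α) :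
    (Finset.univ.filter fun x : α × α => x.2 = f x.1).card = Fintype.card α := by
  rw [← Finset.card_univ, ← Finset.card_image_of_injective (f := fun a => (a, f a)) Finset.univ
    fun a b h => (Prod.mk.inj h).1]
  congr 1
  ext ⟨a, b⟩
  simp [eq_comm]

theorem card_filter_fst_eq {α : Type*} [Fintype α] [DecidableEq α] (f : α → α) :
    (Finset.univ.filter fun x : α × α => x.1 = f x.2).card = Fintype.card α := by
  rw [← Finset.card_univ, ← Finset.card_image_of_injective (f := fun a => (f a, a)) Finset.univ
    fun a b h => (Prod.mk.inj h).2]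
  congr 1
  ext ⟨a, b⟩
  simp [eq_comm]

theorem card_filter_three_mul (n : ℕ) [NeZero n] :
    (Finset.univ.filter fun a : ZMod n => 3 * a = 0).card = n.gcd 3 := by
  have h := IsAddCyclic.card_nsmulAddMonoidHom_ker (ZMod n) 3
  rw [Nat.card_zmod] at h
  rw [← h, ← Nat.subtype_card _ fun a => ?_]
  simp

theorem indicator_sum {P Q R C : Prop} [Decidable P] [Decidable Q] [Decidable R] [Decidable C]
    (hQ : P → (Q ↔ C)) (hR : P → (R ↔ C)) (hP : Q → R → P) :
    (if ¬P ∧ ¬Q ∧ ¬R then 1 else 0) +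
      ((if P then 1 else 0) + (if Q then 1 else 0) + (if R then 1 else 0)) =
      1 + 2 * (if P ∧ C then 1 else 0) := by
  by_cases P <;> by_cases Q <;> by_cases R <;> by_cases C <;> simp_all

theorem card_distinctPairs (n : ℕ) [NeZero n] :
    (distinctPairs n).card + 3 * n = n * n + 2 * n.gcd 3 := by
  have hdiag : (Finset.univ.filter fun x : ZMod n × ZMod n => x.2 = x.1 ∧ 3 * x.1 = 0).card =
      n.gcd 3 := by
    rw [← card_filter_three_mul, ← Finset.card_image_of_injective (f := fun a => (a, a))
      (Finset.univ.filter fun a : ZMod n => 3 * a = 0) fun a b h => (Prod.mk.inj h).1]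
    congr 1
    ext ⟨a, b⟩
    simp only [Finset.mem_filter, Finset.mem_univ, true_and, Finset.mem_image, Prod.mk.injEq]
    constructor
    · rintro ⟨rfl, h⟩
      exact ⟨_, h, rfl, rfl⟩
    · rintro ⟨_, h, rfl, rfl⟩
      exact ⟨rfl, h⟩
  have h₁ := card_filter_snd_eq fun a : ZMod n => a
  have h₂ := card_filter_snd_eq fun a : ZMod n => -2 * a
  have h₃ := card_filter_fst_eq fun a : ZMod n => -2 * a
  have huniv : (Finset.univ : Finset (ZMod n × ZMod n)).card = n * n := by
    rw [Finset.card_univ, Fintype.card_prod, ZMod.card]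
  rw [ZMod.card] at h₁ h₂ h₃
  have hsum : (distinctPairs n).card +
      ((Finset.univ.filter fun x : ZMod n × ZMod n => x.2 = x.1).card +
      (Finset.univ.filter fun x : ZMod n × ZMod n => x.2 = -2 * x.1).card +
      (Finset.univ.filter fun x : ZMod n × ZMod n => x.1 = -2 * x.2).card) =
      (Finset.univ : Finset (ZMod n × ZMod n)).card +
      2 * (Finset.univ.filter fun x : ZMod n × ZMod n => x.2 = x.1 ∧ 3 * x.1 = 0).card := by
    rw [distinctPairs, Finset.card_eq_sum_ones Finset.univ]
    simp only [Finset.card_filter]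
    rw [Finset.mul_sum, ← Finset.sum_add_distrib, ← Finset.sum_add_distrib,
      ← Finset.sum_add_distrib, ← Finset.sum_add_distrib]
    refine Finset.sum_congr rfl fun x _ => ?_
    obtain ⟨a, b⟩ := x
    have e₂ : a = -a - b ↔ b = -2 * a :=
      ⟨fun h => by linear_combination h, fun h => by linear_combination h⟩
    have e₃ : b = -a - b ↔ a = -2 * b :=
      ⟨fun h => by linear_combination h, fun h => by linear_combination h⟩
    have e₄ : b = a → (b = -2 * a ↔ 3 * a = 0) := fun h =>
      ⟨fun h' => by linear_combination h' - h, fun h' => by linear_combination h' + h⟩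
    have e₅ : b = a → (a = -2 * b ↔ 3 * a = 0) := fun h =>
      ⟨fun h' => by linear_combination h' - 2 * h, fun h' => by linear_combination h' + 2 * h⟩
    have e₆ : b = -2 * a → a = -2 * b → b = a := fun h h' => by linear_combination -h + h'
    simp only [ne_eq, e₂, e₃, eq_comm (a := a) (b := b)]
    exact indicator_sum e₄ e₅ e₆
  rw [h₁, h₂, h₃, huniv, hdiag] at hsum
  omega

/-- For every `n ≥ 4`, the Böröczky arrangement of `n` lines has exactly
`⌊n(n-3)/6⌋ + 1` triple points. -/
theorem boroczky_card_triple_points (n : ℕ) (hn : 4 ≤ n) :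
    (tripleSet n).ncard = n * (n - 3) / 6 + 1 := by
  have : NeZero n := ⟨by omega⟩
  have hbij := linesThrough_bijOn n
  rw [← hbij.injOn.ncard_image, hbij.image_eq, Set.ncard_coe_finset]
  have h := card_distinctPairs n
  rw [card_distinctPairs_eq_six_mul] at h
  obtain ⟨m, rfl⟩ : ∃ m, n = m + 3 := ⟨n - 3, by omega⟩
  rw [Nat.add_sub_cancel]
  have hmul : (m + 3) * (m + 3) = (m + 3) * m + 3 * (m + 3) := by ring
  have hle : (m + 3).gcd 3 = 1 ∨ (m + 3).gcd 3 = 3 :=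
    (Nat.dvd_prime Nat.prime_three).1 (Nat.gcd_dvd_right _ _)
  omega
end

section
/- For every integer n ≥ 4, every line ℓ_k of the Böröczky arrangement B_n contains at least ⌊(n−3)/2⌋ triple points (points of T_n), and moreover there exists at least one line ℓ_k of the arrangement containing at least ⌊(n−3)/2⌋ + 1 triple points. -/
open Real

/-- The line `x sin θ + y cos θ = sin 3θ`. -/
def sineLine (θ : ℝ) : Set (ℝ × ℝ) :=
  {p | p.1 * sin θ + p.2 * cos θ = sin (3 * θ)}

/-- The common point of the lines `sineLine a`, `sineLine b` and `sineLine (-a - b)`. -/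
noncomputable def meetPt (a b : ℝ) : ℝ × ℝ :=
  (cos (2 * a) + cos (2 * b) + cos (2 * (a + b)), sin (2 * a) + sin (2 * b) - sin (2 * (a + b)))

theorem meetPt_comm (a b : ℝ) : meetPt a b = meetPt b a := by
  simp only [meetPt, add_comm b a, add_comm (cos (2 * b)), add_comm (sin (2 * b))]

theorem meetPt_mem_left (a b : ℝ) : meetPt a b ∈ sineLine a := by
  have h1 : sin (3 * a) = sin a * cos (2 * a) + cos a * sin (2 * a) := by
    rw [← sin_add]; ring_nf
  have h2 : sin (a + 2 * b) = sin a * cos (2 * b) + cos a * sin (2 * b) := sin_add _ _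
  have h3 : sin (a + 2 * b) = sin (2 * (a + b)) * cos a - cos (2 * (a + b)) * sin a := by
    rw [← sin_sub]; ring_nf
  simp only [sineLine, meetPt, Set.mem_ofPred_eq]
  linear_combination h3 - h2 - h1

theorem meetPt_mem_right (a b : ℝ) : meetPt a b ∈ sineLine b :=
  meetPt_comm b a ▸ meetPt_mem_left b a

theorem meetPt_mem_neg_add (a b : ℝ) : meetPt a b ∈ sineLine (-a - b) := by
  have h : meetPt a b = meetPt (-a - b) a := by
    simp only [meetPt]
    rw [show 2 * (-a - b) = -(2 * (a + b)) by ring, show 2 * (-a - b + a) = -(2 * b) by ring]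
    simp only [cos_neg, sin_neg, Prod.mk.injEq]
    constructor <;> ring
  exact h ▸ meetPt_mem_left _ _

theorem sineLine_add_int_mul_pi (θ : ℝ) (m : ℤ) : sineLine (θ + m * π) = sineLine θ := by
  ext p
  have h : sin (3 * (θ + m * π)) = (-1) ^ m * sin (3 * θ) := by
    rw [show 3 * (θ + m * π) = 3 * θ + (3 * m : ℤ) * π by push_cast; ring, sin_add_int_mul_pi,
      zpow_mul]
    norm_num
  have h0 : ((-1 : ℝ)) ^ m ≠ 0 := zpow_ne_zero _ (by norm_num)
  simp only [sineLine, Set.mem_ofPred_eq]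
  rw [h, sin_add_int_mul_pi, cos_add_int_mul_pi, ← mul_right_inj' h0 (b := p.1 * sin θ + _)]
  ring_nf

theorem eq_of_mem_sineLine {a b : ℝ} (hab : sin (a - b) ≠ 0) {p q : ℝ × ℝ}
    (hpa : p ∈ sineLine a) (hpb : p ∈ sineLine b) (hqa : q ∈ sineLine a) (hqb : q ∈ sineLine b) :
    p = q := by
  simp only [sineLine, Set.mem_ofPred_eq] at *
  rw [sin_sub] at hab
  ext
  · apply mul_right_cancel₀ hab
    linear_combination cos b * (hpa - hqa) - cos a * (hpb - hqb)
  · apply mul_right_cancel₀ hab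
    linear_combination sin a * (hpb - hqb) - sin b * (hpa - hqa)

theorem sin_mul_eq_zero_of_meetPt_mem {a b c : ℝ} (h : meetPt a b ∈ sineLine c) :
    sin (c - a) * (sin (c - b) * sin (a + b + c)) = 0 := by
  have e1 := two_mul_sin_mul_sin (c - b) (a + b + c)
  have e2 := two_mul_sin_mul_cos (c - a) (a + 2 * b)
  have e3 := two_mul_sin_mul_cos (c - a) (2 * c + a)
  rw [show c - b - (a + b + c) = -(a + 2 * b) by ring,
    show c - b + (a + b + c) = 2 * c + a by ring, cos_neg] at e1
  rw [show c - a - (a + 2 * b) = c - 2 * (a + b) by ring,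
    show c - a + (a + 2 * b) = c + 2 * b by ring, sin_sub c (2 * (a + b)), sin_add c] at e2
  rw [show c - a - (2 * c + a) = -(c + 2 * a) by ring,
    show c - a + (2 * c + a) = 3 * c by ring, sin_neg, sin_add c] at e3
  simp only [sineLine, meetPt, Set.mem_ofPred_eq] at h
  linear_combination (1 / 2) * sin (c - a) * e1 + (1 / 4) * e2 - (1 / 4) * e3 + (1 / 4) * h

theorem cos_two_mul_add_cos_four_mul (θ : ℝ) :
    cos (2 * θ) + cos (2 * (2 * θ)) = 2 * cos (3 * θ) * cos θ := by
  rw [show 2 * θ = 3 * θ - θ by ring, show 2 * (3 * θ - θ) = 3 * θ + θ by ring, cos_sub, cos_add]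
  ring

theorem sin_four_mul_sub_sin_two_mul (θ : ℝ) :
    sin (2 * (2 * θ)) - sin (2 * θ) = 2 * cos (3 * θ) * sin θ := by
  rw [show 2 * θ = 3 * θ - θ by ring, show 2 * (3 * θ - θ) = 3 * θ + θ by ring, sin_sub, sin_add]
  ring

theorem Qpt_eq_iff_cos_eq_zero (θ : ℝ) :
    Qpt (2 * θ) = Qpt (π - 2 * (2 * θ)) ↔ cos (3 * θ) = 0 := by
  have h1 := cos_two_mul_add_cos_four_mul θ
  have h2 := sin_four_mul_sub_sin_two_mul θ
  simp only [Qpt, Prod.mk.injEq, cos_pi_sub, sin_pi_sub]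
  constructor
  · rintro ⟨h3, h4⟩
    linear_combination (1 / 2) * (cos θ * (h3 - h1) - sin θ * (h4 + h2))
      - cos (3 * θ) * sin_sq_add_cos_sq θ
  · intro h
    rw [h] at h1 h2
    constructor <;> linarith

theorem mem_affineSpan_Qpt_iff {θ : ℝ} (hθ : cos (3 * θ) ≠ 0) (p : ℝ × ℝ) :
    p ∈ affineSpan ℝ {Qpt (2 * θ), Qpt (π - 2 * (2 * θ))} ↔ p ∈ sineLine θ := by
  have h1 := cos_two_mul_add_cos_four_mul θ
  have h2 := sin_four_mul_sub_sin_two_mul θ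
  have h3 : sin (3 * θ) = cos (2 * θ) * sin θ + sin (2 * θ) * cos θ := by
    rw [show 3 * θ = 2 * θ + θ by ring, sin_add]; ring
  have hQ (r : ℝ) : AffineMap.lineMap (Qpt (2 * θ)) (Qpt (π - 2 * (2 * θ))) r =
      (cos (2 * θ) - r * (2 * cos (3 * θ)) * cos θ,
        sin (2 * θ) + r * (2 * cos (3 * θ)) * sin θ) := by
    simp only [AffineMap.lineMap_apply, Qpt, cos_pi_sub, sin_pi_sub]
    ext
    · simp
      linear_combination (-r) * h1
    · simp
      linear_combination r * h2
  rw [mem_affineSpan_pair_iff_exists_lineMap_eq]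
  simp only [hQ, sineLine, Set.mem_ofPred_eq]
  constructor
  · rintro ⟨r, rfl⟩
    linear_combination -h3
  · intro h
    refine ⟨((p.2 - sin (2 * θ)) * sin θ - (p.1 - cos (2 * θ)) * cos θ) / (2 * cos (3 * θ)), ?_⟩
    rw [div_mul_cancel₀ _ (mul_ne_zero two_ne_zero hθ)]
    have h4 := sin_sq_add_cos_sq θ
    ext
    · linear_combination (p.1 - cos (2 * θ)) * h4 - sin θ * (h + h3)
    · linear_combination (p.2 - sin (2 * θ)) * h4 - cos θ * (h + h3)

theorem boLine_eq_sineLine (n k : ℕ) : boLine n k = sineLine (k * π / n) := by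
  have hk : 2 * (k : ℝ) * π / n = 2 * (k * π / n) := by ring
  unfold boLine
  rw [hk]
  generalize (k * π / n : ℝ) = θ
  split_ifs with h
  · rw [Qpt_eq_iff_cos_eq_zero] at h
    have h1 : cos (2 * θ) = sin (3 * θ) * sin θ := by
      rw [show 2 * θ = 3 * θ - θ by ring, cos_sub, h]; ring
    have h2 : sin (2 * θ) = sin (3 * θ) * cos θ := by
      rw [show 2 * θ = 3 * θ - θ by ring, sin_sub, h]; ring
    have h3 : sin (3 * θ) ^ 2 = 1 := by
      have := sin_sq_add_cos_sq (3 * θ)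
      rw [h] at this
      linarith
    ext p
    simp only [sineLine, Set.mem_ofPred_eq, h1, h2]
    constructor <;> intro hp
    · linear_combination sin (3 * θ) * hp - (p.1 * sin θ + p.2 * cos θ) * h3
    · linear_combination sin (3 * θ) * hp + h3
  · ext p
    exact mem_affineSpan_Qpt_iff (fun h0 => h ((Qpt_eq_iff_cos_eq_zero θ).2 h0)) p

theorem sin_int_mul_pi_div_eq_zero_iff_s1 {n : ℕ} (hn : 0 < n) (m : ℤ) :
    sin (m * π / n) = 0 ↔ (n : ℤ) ∣ m := by
  have hn' : (n : ℝ) ≠ 0 := by positivity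
  rw [sin_eq_zero_iff]
  constructor
  · rintro ⟨c, hc⟩
    refine ⟨c, ?_⟩
    have : (c * n : ℝ) * π = m * π := by
      rw [eq_div_iff hn'] at hc
      linarith
    have := mul_right_cancel₀ pi_ne_zero this
    rw [mul_comm]
    exact_mod_cast this.symm
  · rintro ⟨c, rfl⟩
    refine ⟨c, ?_⟩
    push_cast
    field_simp

theorem eq_of_dvd_sub {n i k : ℕ} (hi : i < n) (hk : k < n) (h : (n : ℤ) ∣ i - k) : i = k := by
  have := Int.eq_zero_of_abs_lt_dvd h (by rw [abs_lt]; omega)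
  omega

theorem eq_mod_of_dvd_add_two_mul {n i k : ℕ} (hi : i < n) (hk : k < n)
    (h : (n : ℤ) ∣ i + 2 * k) : i = (2 * n - 2 * k) % n := by
  refine eq_of_dvd_sub hi (Nat.mod_lt _ (by omega)) ?_
  have h2 : (((2 * n - 2 * k) % n : ℕ) : ℤ) = 2 * n - 2 * k - n * ((2 * n - 2 * k) / n : ℕ) := by
    have := Nat.mod_add_div (2 * n - 2 * k) n
    zify [show 2 * k ≤ 2 * n by omega] at this ⊢
    linarith
  rw [h2]
  obtain ⟨c, hc⟩ := h
  exact ⟨c - 2 + ((2 * n - 2 * k) / n : ℕ), by linear_combination hc⟩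

theorem two_mul_add_eq_of_dvd {n i k : ℕ} (hi : i < n) (hk : k < n)
    (h : (n : ℤ) ∣ 2 * i + k) : 2 * i + k = 0 ∨ 2 * i + k = n ∨ 2 * i + k = 2 * n := by
  obtain ⟨c, hc⟩ := h
  have h0 : 0 ≤ c := by
    by_contra! hneg
    nlinarith
  have h3 : c < 3 := by
    by_contra! hge
    nlinarith
  interval_cases c <;> omega

theorem eq_half_of_dvd_two_mul_add {n i k : ℕ} (hi : i < n) (hk : k < n)
    (h : (n : ℤ) ∣ 2 * i + k) : i = (n - k) / 2 ∨ i = (2 * n - k) / 2 % n := by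
  rcases two_mul_add_eq_of_dvd hi hk h with h | h | h
  · obtain rfl : k = 0 := by omega
    obtain rfl : i = 0 := by omega
    simp
  · left; omega
  · right
    rw [show (2 * n - k) / 2 = i by omega, Nat.mod_eq_of_lt hi]

/-- The intersection point of the lines of index `k` and `i`. -/
noncomputable def crossing (n k i : ℕ) : ℝ × ℝ := meetPt (k * π / n) (i * π / n)

theorem crossing_mem_left (n k i : ℕ) : crossing n k i ∈ boLine n k :=
  boLine_eq_sineLine n k ▸ meetPt_mem_left _ _

theorem crossing_mem_right (n k i : ℕ) : crossing n k i ∈ boLine n i :=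
  boLine_eq_sineLine n i ▸ meetPt_mem_right _ _

theorem crossing_mem_of_dvd {n k i j : ℕ} (hn : 0 < n) (h : (n : ℤ) ∣ k + i + j) :
    crossing n k i ∈ boLine n j := by
  obtain ⟨c, hc⟩ := h
  have hc' : (k + i + j : ℝ) = n * c := by exact_mod_cast hc
  have hn' : (n : ℝ) ≠ 0 := by positivity
  have hj : (j * π / n : ℝ) = -(k * π / n) - i * π / n + c * π := by
    field_simp
    linear_combination hc'
  rw [boLine_eq_sineLine, hj, sineLine_add_int_mul_pi]
  exact meetPt_mem_neg_add _ _

theorem eq_crossing {n k i : ℕ} (hk : k < n) (hi : i < n) (hik : i ≠ k) {p : ℝ × ℝ}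
    (hpk : p ∈ boLine n k) (hpi : p ∈ boLine n i) : p = crossing n k i := by
  have h : sin ((i : ℝ) * π / n - k * π / n) ≠ 0 := by
    intro h
    refine hik (eq_of_dvd_sub hi hk ((sin_int_mul_pi_div_eq_zero_iff_s1 (by omega) _).1 ?_))
    rw [← h]
    push_cast
    ring_nf
  have h1 := crossing_mem_left n k i
  have h2 := crossing_mem_right n k i
  rw [boLine_eq_sineLine] at *
  exact eq_of_mem_sineLine h hpi hpk h2 h1

theorem dvd_of_crossing_mem {n k i j : ℕ} (hk : k < n) (hi : i < n) (hj : j < n) (hjk : j ≠ k)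
    (hji : j ≠ i) (h : crossing n k i ∈ boLine n j) : (n : ℤ) ∣ k + i + j := by
  have hn : 0 < n := by omega
  rw [boLine_eq_sineLine] at h
  have h := sin_mul_eq_zero_of_meetPt_mem h
  have e1 : (j * π / n - k * π / n : ℝ) = ((j - k : ℤ) : ℝ) * π / n := by push_cast; ring
  have e2 : (j * π / n - i * π / n : ℝ) = ((j - i : ℤ) : ℝ) * π / n := by push_cast; ring
  have e3 : (k * π / n + i * π / n + j * π / n : ℝ) = ((k + i + j : ℤ) : ℝ) * π / n := by
    push_cast; ring
  rw [e1, e2, e3, mul_eq_zero, mul_eq_zero] at h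
  simp only [sin_int_mul_pi_div_eq_zero_iff_s1 hn] at h
  rcases h with h | h | h
  · exact absurd (eq_of_dvd_sub hj hk h) hjk
  · exact absurd (eq_of_dvd_sub hj hi h) hji
  · exact h

theorem finite_tripleSet_inter_boLine {n k : ℕ} (hk : k < n) :
    (tripleSet n ∩ boLine n k).Finite := by
  refine ((Finset.range n).image (crossing n k)).finite_toSet.subset ?_
  rintro p ⟨hp, hpk⟩
  have hp : 1 < {j : ℕ | j < n ∧ p ∈ boLine n j}.ncard := lt_of_lt_of_le (by norm_num) hp
  obtain ⟨i, ⟨hi, hpi⟩, hik⟩ := Set.exists_ne_of_one_lt_ncard hp k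
  rw [Finset.mem_coe, Finset.mem_image]
  exact ⟨i, Finset.mem_range.2 hi, (eq_crossing hk hi hik hpk hpi).symm⟩

theorem crossing_mem_tripleSet {n k i : ℕ} (hk : k < n) (hi : i < n) (h1 : ¬(n : ℤ) ∣ i - k)
    (h2 : ¬(n : ℤ) ∣ i + 2 * k) (h3 : ¬(n : ℤ) ∣ 2 * i + k) : crossing n k i ∈ tripleSet n := by
  have hn : 0 < n := by omega
  obtain ⟨j, hj, hsum⟩ : ∃ j < n, (n : ℤ) ∣ k + i + j := by
    refine ⟨(2 * n - (k + i)) % n, Nat.mod_lt _ hn, 2 - ((2 * n - (k + i)) / n : ℕ), ?_⟩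
    have := Nat.mod_add_div (2 * n - (k + i)) n
    zify [show k + i ≤ 2 * n by omega] at this ⊢
    linear_combination this
  have hik : k ≠ i := by rintro rfl; exact h1 (by simp)
  have hkj : k ≠ j := by rintro rfl; exact h2 (by convert hsum using 1; ring)
  have hij : i ≠ j := by rintro rfl; exact h3 (by convert hsum using 1; ring)
  have hsub : (({k, i, j} : Finset ℕ) : Set ℕ) ⊆ {l | l < n ∧ crossing n k i ∈ boLine n l} := by
    intro l hl
    simp only [Finset.coe_insert, Finset.coe_singleton, Set.mem_insert_iff,
      Set.mem_singleton_iff] at hl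
    rcases hl with rfl | rfl | rfl
    · exact ⟨hk, crossing_mem_left _ _ _⟩
    · exact ⟨hi, crossing_mem_right _ _ _⟩
    · exact ⟨hj, crossing_mem_of_dvd hn hsum⟩
  have hcard := Set.ncard_le_ncard hsub ((Set.finite_lt_nat n).subset fun _ hl => hl.1)
  rwa [Set.ncard_coe_finset, Finset.card_eq_three.2 ⟨k, i, j, hik, hkj, hij, rfl⟩] at hcard

/-- If `B` contains every index `i` for which the lines of index `k`, `i` and `-k - i` are not
three distinct lines, then the other indices pair up to triple points on the line of index `k`. -/
theorem le_card_add_two_mul_ncard {n k : ℕ} (hk : k < n) (B : Finset ℕ)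
    (hB : ∀ i < n, ((n : ℤ) ∣ i - k ∨ (n : ℤ) ∣ i + 2 * k ∨ (n : ℤ) ∣ 2 * i + k) → i ∈ B) :
    n ≤ B.card + 2 * (tripleSet n ∩ boLine n k).ncard := by
  set S := Finset.range n \ B with hS
  have hmem {i : ℕ} (hi : i ∈ S) : i < n ∧ ¬(n : ℤ) ∣ i - k ∧ ¬(n : ℤ) ∣ i + 2 * k ∧
      ¬(n : ℤ) ∣ 2 * i + k := by
    rw [hS, Finset.mem_sdiff, Finset.mem_range] at hi
    have := mt (hB i hi.1) hi.2
    tauto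
  have himage : ((S.image (crossing n k) : Finset _) : Set (ℝ × ℝ)) ⊆
      tripleSet n ∩ boLine n k := by
    intro p hp
    rw [Finset.mem_coe, Finset.mem_image] at hp
    obtain ⟨i, hi, rfl⟩ := hp
    obtain ⟨hin, h1, h2, h3⟩ := hmem hi
    exact ⟨crossing_mem_tripleSet hk hin h1 h2 h3, crossing_mem_left _ _ _⟩
  have hle := Set.ncard_le_ncard himage (finite_tripleSet_inter_boLine hk)
  rw [Set.ncard_coe_finset] at hle
  have hfib : S.card ≤ 2 * (S.image (crossing n k)).card := by
    refine Finset.card_le_mul_card_image S 2 fun p _ => ?_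
    by_contra! hlt
    obtain ⟨a, b, c, ha, hb, hc, hab, hac, hbc⟩ := Finset.two_lt_card_iff.1 hlt
    rw [Finset.mem_filter] at ha hb hc
    have key {i j : ℕ} (hi : i ∈ S ∧ crossing n k i = p) (hj : j ∈ S ∧ crossing n k j = p)
        (hij : i ≠ j) : (n : ℤ) ∣ k + i + j := by
      obtain ⟨hjn, hjk, -, -⟩ := hmem hj.1
      refine dvd_of_crossing_mem hk (hmem hi.1).1 hjn ?_ hij.symm ?_
      · rintro rfl
        exact hjk (by simp)
      · rw [hi.2, ← hj.2]
        exact crossing_mem_right _ _ _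
    refine hbc (eq_of_dvd_sub (hmem hb.1).1 (hmem hc.1).1 ?_)
    rw [show (b - c : ℤ) = (k + a + b) - (k + a + c) by ring]
    exact dvd_sub (key ha hb hab) (key ha hc hac)
  have hSB : n ≤ S.card + B.card := by
    have := Finset.le_card_sdiff B (Finset.range n)
    rw [Finset.card_range, ← hS] at this
    omega
  omega

/-- For every `n ≥ 4`, every line of the Böröczky arrangement of `n` lines contains
at least `⌊(n-3)/2⌋` triple points, and some line contains at least `⌊(n-3)/2⌋ + 1`
triple points. -/
theorem boroczky_triple_points_on_lines (n : ℕ) (hn : 4 ≤ n) :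
    (∀ k < n, (n - 3) / 2 ≤ (tripleSet n ∩ boLine n k).ncard) ∧
    (∃ k < n, (n - 3) / 2 + 1 ≤ (tripleSet n ∩ boLine n k).ncard) := by
  have hn0 : 0 < n := by omega
  refine ⟨fun k hk => ?_, ?_⟩
  · rcases Nat.even_or_odd' n with ⟨m, hm | hm⟩
    · have h := le_card_add_two_mul_ncard hk
        {k, (2 * n - 2 * k) % n, (n - k) / 2, (2 * n - k) / 2 % n} (fun i hi hbad => by
          simp only [Finset.mem_insert, Finset.mem_singleton]
          rcases hbad with h | h | h
          · exact Or.inl (eq_of_dvd_sub hi hk h)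
          · exact Or.inr (Or.inl (eq_mod_of_dvd_add_two_mul hi hk h))
          · exact Or.inr (Or.inr (eq_half_of_dvd_two_mul_add hi hk h)))
      have hc := Finset.card_le_four (a := k) (b := (2 * n - 2 * k) % n) (c := (n - k) / 2)
        (d := (2 * n - k) / 2 % n)
      omega
    · have h := le_card_add_two_mul_ncard hk
        {k, (2 * n - 2 * k) % n, if k % 2 = 0 then (2 * n - k) / 2 % n else (n - k) / 2}
        (fun i hi hbad => by
          simp only [Finset.mem_insert, Finset.mem_singleton]
          rcases hbad with h | h | h
          · exact Or.inl (eq_of_dvd_sub hi hk h)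
          · exact Or.inr (Or.inl (eq_mod_of_dvd_add_two_mul hi hk h))
          · refine Or.inr (Or.inr ?_)
            rcases two_mul_add_eq_of_dvd hi hk h with h | h | h
            · obtain rfl : k = 0 := by omega
              obtain rfl : i = 0 := by omega
              simp
            · rw [if_neg (by omega)]
              omega
            · rw [if_pos (by omega), show (2 * n - k) / 2 = i by omega, Nat.mod_eq_of_lt hi])
      have hc := Finset.card_le_three (a := k) (b := (2 * n - 2 * k) % n)
        (c := if k % 2 = 0 then (2 * n - k) / 2 % n else (n - k) / 2)
      omega
  · rcases Nat.even_or_odd' n with ⟨m, hm | hm⟩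
    · refine ⟨1, by omega, ?_⟩
      have h1 : 1 < n := by omega
      have h := le_card_add_two_mul_ncard h1 {1, n - 2} (fun i hi hbad => by
          simp only [Finset.mem_insert, Finset.mem_singleton]
          rcases hbad with h | h | h
          · exact Or.inl (eq_of_dvd_sub hi h1 h)
          · right
            have := eq_mod_of_dvd_add_two_mul hi h1 h
            rw [show 2 * n - 2 * 1 = n - 2 + n by omega, Nat.add_mod_right,
              Nat.mod_eq_of_lt (by omega)] at this
            exact this
          · rcases two_mul_add_eq_of_dvd hi h1 h with h | h | h <;> omega)
      have hc := Finset.card_le_two (a := 1) (b := n - 2)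
      omega
    · refine ⟨0, hn0, ?_⟩
      have h := le_card_add_two_mul_ncard hn0 {0} (fun i hi hbad => by
          simp only [Finset.mem_singleton]
          rcases hbad with h | h | h
          · exact eq_of_dvd_sub hi hn0 h
          · exact eq_of_dvd_sub hi hn0 (by simpa using h)
          · rcases two_mul_add_eq_of_dvd hi hn0 h with h | h | h <;> omega)
      rw [Finset.card_singleton] at h
      omega
end

section
/- For every integer n with 4 ≤ n ≤ 11, the radical ideal I_n = ⋂_{P ∈ T_n} m_P ⊆ ℂ[x,y,z] of the set of triple points of the Böröczky arrangement B_n satisfies the containment I_n^{(3)} ⊆ I_n², where I_n^{(3)} = ⋂_{P ∈ T_n} m_P³ is the third symbolic power of I_n. -/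
open MvPolynomial

/-- The homogeneous ideal in `ℂ[x,y,z]` of the projective point `(a : b : 1)`
associated to the affine point `P = (a, b) ∈ ℝ²`. -/
noncomputable def mP (P : ℝ × ℝ) : Ideal (MvPolynomial (Fin 3) ℂ) :=
  Ideal.span {X 0 - C (P.1 : ℂ) * X 2, X 1 - C (P.2 : ℂ) * X 2}

open Finset in
/-- The triples of indices of lines of `B_n` meeting in a common point. -/
def triples (n : ℕ) : Finset (Finset ℕ) :=
  ((range n).powersetCard 3).filter fun t => n ∣ ∑ k ∈ t, k

/-- The primitive `n`-th root of unity `exp (2πi / n)`. -/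
noncomputable def zeta (n : ℕ) : ℂ := Complex.exp (2 * Real.pi * Complex.I / n)

/-- The coordinate `x + i y` of the point attached to a triple of lines. -/
noncomputable def ptU (n : ℕ) (t : Finset ℕ) : ℂ := ∑ k ∈ t, zeta n ^ k

/-- The coordinate `x - i y` of the point attached to a triple of lines. -/
noncomputable def ptV (n : ℕ) (t : Finset ℕ) : ℂ := ∑ k ∈ t, (zeta n ^ k)⁻¹

lemma zeta_primitive {n : ℕ} (hn : n ≠ 0) : IsPrimitiveRoot (zeta n) n :=
  Complex.isPrimitiveRoot_exp n hn

lemma zeta_ne_zero (n : ℕ) : zeta n ≠ 0 := Complex.exp_ne_zero _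

lemma zeta_pow_inj {n i j : ℕ} (hi : i < n) (hj : j < n) (h : zeta n ^ i = zeta n ^ j) : i = j :=
  (zeta_primitive (by omega)).pow_inj hi hj h

lemma exists_of_mem_triples {n : ℕ} {t : Finset ℕ} (ht : t ∈ triples n) :
    ∃ i j k, i < n ∧ j < n ∧ k < n ∧ i ≠ j ∧ i ≠ k ∧ j ≠ k ∧ t = {i, j, k} ∧
      zeta n ^ i * zeta n ^ j * zeta n ^ k = 1 := by
  simp only [triples, Finset.mem_filter, Finset.mem_powersetCard] at ht
  obtain ⟨⟨hr, hc⟩, hd⟩ := ht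
  obtain ⟨i, j, k, hij, hik, hjk, rfl⟩ := Finset.card_eq_three.mp hc
  simp only [Finset.insert_subset_iff, Finset.singleton_subset_iff, Finset.mem_range] at hr
  refine ⟨i, j, k, hr.1, hr.2.1, hr.2.2, hij, hik, hjk, rfl, ?_⟩
  rw [Finset.sum_insert (by simp [hij, hik]), Finset.sum_pair hjk] at hd
  rw [← pow_add, ← pow_add, (zeta_primitive (by omega)).pow_eq_one_iff_dvd, add_assoc]
  exact hd

lemma cubic_eq_prod {x y z s : ℂ} (h : x * y * z = 1) :
    s ^ 3 - (x + y + z) * s ^ 2 + (x⁻¹ + y⁻¹ + z⁻¹) * s - 1 = (s - x) * (s - y) * (s - z) := by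
  have e1 : x⁻¹ = y * z := inv_eq_of_mul_eq_one_right (by linear_combination h)
  have e2 : y⁻¹ = x * z := inv_eq_of_mul_eq_one_right (by linear_combination h)
  have e3 : z⁻¹ = x * y := inv_eq_of_mul_eq_one_right (by linear_combination h)
  rw [e1, e2, e3]
  linear_combination h

lemma ptU_triple {n i j k : ℕ} (hij : i ≠ j) (hik : i ≠ k) (hjk : j ≠ k) :
    ptU n {i, j, k} = zeta n ^ i + zeta n ^ j + zeta n ^ k := by
  rw [ptU, Finset.sum_insert (by simp [hij, hik]), Finset.sum_pair hjk, add_assoc]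

lemma ptV_triple {n i j k : ℕ} (hij : i ≠ j) (hik : i ≠ k) (hjk : j ≠ k) :
    ptV n {i, j, k} = (zeta n ^ i)⁻¹ + (zeta n ^ j)⁻¹ + (zeta n ^ k)⁻¹ := by
  rw [ptV, Finset.sum_insert (by simp [hij, hik]), Finset.sum_pair hjk, add_assoc]

lemma cubic_iff_mem {n l : ℕ} {t : Finset ℕ} (ht : t ∈ triples n) (hl : l < n) :
    (zeta n ^ l) ^ 3 - ptU n t * (zeta n ^ l) ^ 2 + ptV n t * zeta n ^ l - 1 = 0 ↔ l ∈ t := by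
  obtain ⟨i, j, k, hi, hj, hk, hij, hik, hjk, rfl, h⟩ := exists_of_mem_triples ht
  rw [ptU_triple hij hik hjk, ptV_triple hij hik hjk, cubic_eq_prod h]
  simp only [mul_eq_zero, sub_eq_zero, Finset.mem_insert, Finset.mem_singleton]
  constructor
  · rintro ((h | h) | h)
    · exact .inl (zeta_pow_inj hl hi h)
    · exact .inr (.inl (zeta_pow_inj hl hj h))
    · exact .inr (.inr (zeta_pow_inj hl hk h))
  · rintro (rfl | rfl | rfl) <;> simp

lemma pt_injOn {n : ℕ} {t t' : Finset ℕ} (ht : t ∈ triples n) (ht' : t' ∈ triples n)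
    (hU : ptU n t = ptU n t') (hV : ptV n t = ptV n t') : t = t' := by
  have hlt : ∀ s ∈ triples n, ∀ l ∈ s, l < n := fun s hs l hl => by
    simp only [triples, Finset.mem_filter, Finset.mem_powersetCard] at hs
    exact Finset.mem_range.mp (hs.1.1 hl)
  ext l
  constructor <;> intro hl
  · rwa [← cubic_iff_mem ht' (hlt t ht l hl), ← hU, ← hV, cubic_iff_mem ht (hlt t ht l hl)]
  · rwa [← cubic_iff_mem ht (hlt t' ht' l hl), hU, hV, cubic_iff_mem ht' (hlt t' ht' l hl)]

lemma line_iff_mem {n l : ℕ} {t : Finset ℕ} (ht : t ∈ triples n) (hl : l < n) :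
    ptV n t = zeta n ^ l * ptU n t + ((zeta n ^ l)⁻¹ - (zeta n ^ l) ^ 2) ↔ l ∈ t := by
  rw [← cubic_iff_mem ht hl, ← mul_right_inj' (pow_ne_zero l (zeta_ne_zero n))]
  have h := mul_inv_cancel₀ (pow_ne_zero l (zeta_ne_zero n))
  constructor <;> intro e
  · linear_combination e + h
  · linear_combination e - h

lemma ptU_injOn_line {n l : ℕ} {t t' : Finset ℕ} (ht : t ∈ triples n) (ht' : t' ∈ triples n)
    (hl : l < n) (hlt : l ∈ t) (hlt' : l ∈ t') (hU : ptU n t = ptU n t') : t = t' := by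
  refine pt_injOn ht ht' hU ?_
  rw [(line_iff_mem ht hl).mpr hlt, (line_iff_mem ht' hl).mpr hlt', hU]

/-- The equation `x sin (α/2) + y cos (α/2) = sin (3α/2)` of the line through `Q_α` and
`Q_{π - 2α}`, stated with `θ = α/2`. -/
lemma mem_boLine_iff_half {n k : ℕ} {θ : ℝ} (hθ : 2 * k * Real.pi / n = 2 * θ) (p : ℝ × ℝ) :
    p ∈ boLine n k ↔ p.1 * Real.sin θ + p.2 * Real.cos θ = Real.sin (3 * θ) := by
  have h2 := Real.sin_sq_add_cos_sq θ
  have c4 : Real.cos (2 * (2 * θ)) = 2 * (2 * Real.cos θ ^ 2 - 1) ^ 2 - 1 := by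
    rw [Real.cos_two_mul, Real.cos_two_mul]
  have s4 : Real.sin (2 * (2 * θ)) =
      2 * (2 * Real.sin θ * Real.cos θ) * (2 * Real.cos θ ^ 2 - 1) := by
    rw [Real.sin_two_mul, Real.sin_two_mul, Real.cos_two_mul]
  rw [boLine, hθ, Real.sin_three_mul]
  simp only [Qpt, Real.cos_pi_sub, Real.sin_pi_sub, Prod.mk.injEq, c4, s4, Real.cos_two_mul,
    Real.sin_two_mul]
  set s := Real.sin θ
  set c := Real.cos θ
  obtain ⟨x, y⟩ := p
  have hs : s ^ 2 = 1 - c ^ 2 := by linarith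
  have hs3 : s ^ 3 = s * (1 - c ^ 2) := by rw [← hs]; ring
  split_ifs with h
  · obtain ⟨h1, h3⟩ := h
    have h4 : (4 * c ^ 2 - 3) * c ^ 2 = 0 := by linear_combination h1 / 2
    simp only [Set.mem_ofPred_eq]
    rcases mul_eq_zero.mp h4 with h5 | h5
    · have hc : c ^ 2 = 3 / 4 := by linarith
      have hs4 : s ^ 2 = 1 / 4 := by linarith
      have hs0 : 2 * s ≠ 0 := by
        intro h0
        rw [show s = 0 by linarith] at hs4; norm_num at hs4
      rw [hc]
      constructor <;> intro e
      · refine mul_left_cancel₀ hs0 ?_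
        linear_combination e + (2 * x - 6 + 8 * s ^ 2 + 2) * hs4
      · linear_combination 2 * s * e - (2 * x - 6 + 8 * s ^ 2 + 2) * hs4
    · have hc : c = 0 := by simpa using h5
      have hs1 : s ^ 2 = 1 := by rw [hs, hc]; ring
      have hs0 : s ≠ 0 := by
        rintro h0
        rw [h0] at hs1; norm_num at hs1
      rw [hc]
      constructor <;> intro e
      · linear_combination -s * e + 4 * s * hs1
      · linear_combination -s * e + (x - 3 + 4 * s ^ 2 + 4) * hs1
  · rw [SetLike.mem_coe, mem_affineSpan_pair_iff_exists_lineMap_eq]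
    set l := -2 * (4 * c ^ 3 - 3 * c) with hl
    have e1 : -(2 * (2 * c ^ 2 - 1) ^ 2 - 1) - (2 * c ^ 2 - 1) = l * c := by rw [hl]; ring
    have e2 : 2 * (2 * s * c) * (2 * c ^ 2 - 1) - 2 * s * c = -(l * s) := by rw [hl]; ring
    have hl0 : l ≠ 0 := by
      intro h0
      rw [h0] at e1 e2
      exact h ⟨by linarith, by linarith⟩
    simp only [AffineMap.lineMap_apply, vsub_eq_sub, vadd_eq_add, Prod.mk_sub_mk, Prod.smul_mk,
      smul_eq_mul, Prod.mk_add_mk, Prod.mk.injEq, e1, e2]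
    constructor
    · rintro ⟨r, rfl, rfl⟩
      linear_combination (4 * s) * h2
    · intro e
      refine ⟨((x - (2 * c ^ 2 - 1)) * c - (y - 2 * s * c) * s) / l, ?_, ?_⟩
      · field_simp
        linear_combination -s * e + (x - (2 * c ^ 2 - 1)) * h2 + 4 * s ^ 2 * h2
      · field_simp
        linear_combination -c * e + (y - 2 * s * c) * h2 + 4 * s * c * h2

lemma zeta_pow_eq {n k : ℕ} {θ : ℝ} (hθ : 2 * k * Real.pi / n = 2 * θ) :
    zeta n ^ k = Complex.exp (θ * Complex.I) ^ 2 := by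
  rw [zeta, ← Complex.exp_nat_mul, ← Complex.exp_nat_mul]
  congr 1
  have : (2 * k * Real.pi / n : ℂ) = 2 * θ := by exact_mod_cast congrArg (fun x : ℝ => (x : ℂ)) hθ
  push_cast
  linear_combination Complex.I * this

/-- The line `ℓ_k` in the coordinates `u = x + i y`, `v = x - i y`, with `τ = ζ ^ k`. -/
lemma mem_boLine_iff_s3 {n k : ℕ} (p : ℝ × ℝ) :
    p ∈ boLine n k ↔ (zeta n ^ k) ^ 3 - ((p.1 : ℂ) + p.2 * Complex.I) * (zeta n ^ k) ^ 2
      + ((p.1 : ℂ) - p.2 * Complex.I) * zeta n ^ k - 1 = 0 := by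
  have hθ : 2 * k * Real.pi / n = 2 * (k * Real.pi / n) := by ring
  rw [mem_boLine_iff_half hθ, zeta_pow_eq hθ]
  set θ : ℝ := k * Real.pi / n
  obtain ⟨x, y⟩ := p
  set E := Complex.exp (θ * Complex.I) with hE
  have hE0 : E ≠ 0 := Complex.exp_ne_zero _
  have key : (E ^ 2) ^ 3 - ((x : ℂ) + y * Complex.I) * (E ^ 2) ^ 2
      + ((x : ℂ) - y * Complex.I) * E ^ 2 - 1 =
      2 * Complex.I * E ^ 3 * (Complex.sin (3 * θ) - (x * Complex.sin θ + y * Complex.cos θ)) := by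
    have hexp (z : ℂ) : Complex.exp (z * Complex.I) = Complex.cos z + Complex.sin z * Complex.I :=
      Complex.exp_mul_I z
    have h1 := hexp θ
    have h2 := hexp (-θ)
    have h3 := hexp (3 * θ)
    have h4 := hexp (-(3 * θ))
    have hEF : E * Complex.exp (-θ * Complex.I) = 1 := by
      rw [hE, ← Complex.exp_add, ← Complex.exp_zero]; congr 1; ring
    have hE3 : Complex.exp (3 * θ * Complex.I) = E ^ 3 := by
      rw [hE, ← Complex.exp_nat_mul]; congr 1; push_cast; ring
    have hF3 : Complex.exp (-(3 * θ) * Complex.I) = Complex.exp (-θ * Complex.I) ^ 3 := by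
      rw [← Complex.exp_nat_mul]; congr 1; push_cast; ring
    rw [hE3] at h3
    rw [hF3] at h4
    rw [← hE] at h1
    set F := Complex.exp (-θ * Complex.I)
    rw [Complex.cos_neg, Complex.sin_neg] at h2 h4
    have hEF3 : E ^ 3 * F ^ 3 = 1 := by rw [← mul_pow, hEF, one_pow]
    linear_combination E ^ 3 * (h3 - h4) + hEF3 - x * E ^ 3 * (h1 - h2) - x * E ^ 2 * hEF
      - y * Complex.I * E ^ 3 * (h1 + h2) + y * Complex.I * E ^ 2 * hEF
  rw [key]
  simp only [mul_eq_zero, OfNat.ofNat_ne_zero, Complex.I_ne_zero, pow_eq_zero_iff, ne_eq,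
    not_false_eq_true, hE0, false_or, sub_eq_zero]
  rw [eq_comm]
  norm_cast

lemma exists_triple_of_mem_tripleSet {n : ℕ} {p : ℝ × ℝ} (hp : p ∈ tripleSet n) :
    ∃ t ∈ triples n, (p.1 : ℂ) + p.2 * Complex.I = ptU n t ∧
      (p.1 : ℂ) - p.2 * Complex.I = ptV n t := by
  rw [tripleSet, Set.mem_ofPred_eq] at hp
  obtain ⟨s, hs, hcard⟩ := Set.exists_subset_card_eq hp
  obtain ⟨i, j, k, hij, hik, hjk, rfl⟩ := Set.ncard_eq_three.mp hcard
  have hi := hs (show i ∈ ({i, j, k} : Set ℕ) by simp)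
  have hj := hs (show j ∈ ({i, j, k} : Set ℕ) by simp)
  have hk := hs (show k ∈ ({i, j, k} : Set ℕ) by simp)
  simp only [Set.mem_ofPred_eq, mem_boLine_iff_s3] at hi hj hk
  obtain ⟨hin, hi⟩ := hi
  obtain ⟨hjn, hj⟩ := hj
  obtain ⟨hkn, hk⟩ := hk
  set u : ℂ := (p.1 : ℂ) + p.2 * Complex.I
  set v : ℂ := (p.1 : ℂ) - p.2 * Complex.I
  have hxy : zeta n ^ i - zeta n ^ j ≠ 0 := fun h => hij (zeta_pow_inj hin hjn (sub_eq_zero.mp h))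
  have hxz : zeta n ^ i - zeta n ^ k ≠ 0 := fun h => hik (zeta_pow_inj hin hkn (sub_eq_zero.mp h))
  have hyz : zeta n ^ j - zeta n ^ k ≠ 0 := fun h => hjk (zeta_pow_inj hjn hkn (sub_eq_zero.mp h))
  have hprim := zeta_primitive (n := n) (by omega)
  have hx0 := pow_ne_zero i (zeta_ne_zero n)
  have hy0 := pow_ne_zero j (zeta_ne_zero n)
  have hz0 := pow_ne_zero k (zeta_ne_zero n)
  have hprod : zeta n ^ (i + j + k) = zeta n ^ i * zeta n ^ j * zeta n ^ k := by
    rw [pow_add, pow_add]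
  have hU := ptU_triple (n := n) hij hik hjk
  have hV := ptV_triple (n := n) hij hik hjk
  generalize zeta n ^ i = x at *
  generalize zeta n ^ j = y at *
  generalize zeta n ^ k = z at *
  have h1 : x ^ 2 + x * y + y ^ 2 - u * (x + y) + v = 0 :=
    mul_left_cancel₀ hxy (by linear_combination hi - hj)
  have h2 : x ^ 2 + x * z + z ^ 2 - u * (x + z) + v = 0 :=
    mul_left_cancel₀ hxz (by linear_combination hi - hk)
  have hu : u = x + y + z :=
    mul_left_cancel₀ hyz (by linear_combination h2 - h1)
  have hv : v = x * y + x * z + y * z := by rw [hu] at h1; linear_combination h1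
  have h3 : x * y * z = 1 := by rw [hu, hv] at hi; linear_combination hi
  refine ⟨{i, j, k}, ?_, ?_, ?_⟩
  · simp only [triples, Finset.mem_filter, Finset.mem_powersetCard]
    refine ⟨⟨?_, Finset.card_eq_three.mpr ⟨i, j, k, hij, hik, hjk, rfl⟩⟩, ?_⟩
    · simp [Finset.insert_subset_iff, hin, hjn, hkn]
    · rw [Finset.sum_insert (by simp [hij, hik]), Finset.sum_pair hjk, ← add_assoc,
        ← hprim.pow_eq_one_iff_dvd, hprod, h3]
  · rw [hU, hu]
  · rw [hV, hv]
    field_simp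
    linear_combination (x * y + x * z + y * z) * h3

lemma exists_mem_tripleSet_of_triple {n : ℕ} {t : Finset ℕ} (ht : t ∈ triples n) :
    ∃ p ∈ tripleSet n, (p.1 : ℂ) + p.2 * Complex.I = ptU n t ∧
      (p.1 : ℂ) - p.2 * Complex.I = ptV n t := by
  obtain ⟨i, j, k, hi, hj, hk, hij, hik, hjk, rfl, h⟩ := exists_of_mem_triples ht
  have hconj (l : ℕ) : (starRingEnd ℂ) (zeta n ^ l) = (zeta n ^ l)⁻¹ := by
    rw [Complex.inv_def, Complex.normSq_eq_norm_sq, norm_pow,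
      (zeta_primitive (n := n) (by omega)).norm'_eq_one (by omega)]
    simp
  have hU : ((ptU n {i, j, k}).re : ℂ) + (ptU n {i, j, k}).im * Complex.I = ptU n {i, j, k} :=
    Complex.re_add_im _
  have hV : ((ptU n {i, j, k}).re : ℂ) - (ptU n {i, j, k}).im * Complex.I = ptV n {i, j, k} := by
    have hre (z : ℂ) : (z.re : ℂ) - z.im * Complex.I = (starRingEnd ℂ) z := by
      apply Complex.ext <;> simp
    rw [hre, ptU_triple hij hik hjk, ptV_triple hij hik hjk]
    simp only [map_add, hconj]
  refine ⟨((ptU n {i, j, k}).re, (ptU n {i, j, k}).im), ?_, hU, hV⟩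
  rw [tripleSet, Set.mem_ofPred_eq]
  have hsub : ({i, j, k} : Set ℕ) ⊆ {l : ℕ | l < n ∧
      ((ptU n {i, j, k}).re, (ptU n {i, j, k}).im) ∈ boLine n l} := by
    intro l hl
    have hlt : l < n := by
      rcases hl with rfl | rfl | rfl <;> assumption
    refine ⟨hlt, ?_⟩
    rw [mem_boLine_iff_s3, hU, hV, cubic_iff_mem ht hlt]
    simpa using hl
  calc 3 = ({i, j, k} : Set ℕ).ncard := (Set.ncard_eq_three.mpr ⟨i, j, k, hij, hik, hjk, rfl⟩).symm
    _ ≤ _ := Set.ncard_le_ncard hsub ((Set.finite_lt_nat n).subset fun l hl => hl.1)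

/-- The homogeneous ideal of the point `(a : b : 1)` over `ℂ`. -/
noncomputable def ptIdeal (a b : ℂ) : Ideal (MvPolynomial (Fin 3) ℂ) :=
  Ideal.span {X 0 - C a * X 2, X 1 - C b * X 2}

/-- The linear change of coordinates `u = x + i y`, `v = x - i y`. -/
noncomputable def coordEquiv : MvPolynomial (Fin 3) ℂ ≃ₐ[ℂ] MvPolynomial (Fin 3) ℂ :=
  AlgEquiv.ofAlgHom
    (aeval ![X 0 + C Complex.I * X 1, X 0 - C Complex.I * X 1, X 2])
    (aeval ![C 2⁻¹ * (X 0 + X 1), C (-Complex.I / 2) * (X 0 - X 1), X 2])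
    (by
      have h2 : (C 2⁻¹ : MvPolynomial (Fin 3) ℂ) * 2 = 1 := by
        rw [show (2 : MvPolynomial (Fin 3) ℂ) = C 2 from rfl, ← C_mul]; norm_num
      have hI : (C (-Complex.I / 2) : MvPolynomial (Fin 3) ℂ) * C Complex.I * 2 = 1 := by
        rw [show (2 : MvPolynomial (Fin 3) ℂ) = C 2 from rfl, ← C_mul, ← C_mul]
        rw [show -Complex.I / 2 * Complex.I * 2 = -(Complex.I * Complex.I) by ring, Complex.I_mul_I]
        norm_num
      apply algHom_ext
      intro i
      fin_cases i
      · simp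
        linear_combination X 0 * h2
      · simp
        linear_combination X 1 * hI
      · simp)
    (by
      have h2 : (C 2⁻¹ : MvPolynomial (Fin 3) ℂ) * 2 = 1 := by
        rw [show (2 : MvPolynomial (Fin 3) ℂ) = C 2 from rfl, ← C_mul]; norm_num
      have hI : (C (-Complex.I / 2) : MvPolynomial (Fin 3) ℂ) * C Complex.I = C 2⁻¹ := by
        rw [← C_mul]
        rw [show -Complex.I / 2 * Complex.I = -(Complex.I * Complex.I) / 2 by ring, Complex.I_mul_I]
        norm_num
      apply algHom_ext
      intro i
      fin_cases i
      · simp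
        linear_combination X 0 * h2 + (X 0 - X 1) * hI
      · simp
        linear_combination X 1 * h2 - (X 0 - X 1) * hI
      · simp)

lemma map_coordEquiv_ptIdeal (P : ℝ × ℝ) :
    (ptIdeal (P.1 + P.2 * Complex.I) (P.1 - P.2 * Complex.I)).map
      coordEquiv.toRingEquiv = mP P := by
  have h2 : (C 2⁻¹ : MvPolynomial (Fin 3) ℂ) * 2 = 1 := by
    rw [show (2 : MvPolynomial (Fin 3) ℂ) = C 2 from rfl, ← C_mul]; norm_num
  have hI : (C Complex.I : MvPolynomial (Fin 3) ℂ) * C Complex.I = -1 := by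
    rw [← C_mul, Complex.I_mul_I]; simp
  rw [ptIdeal, Ideal.map_span, mP, Set.image_pair]
  simp only [coordEquiv, AlgEquiv.coe_ringEquiv,
    AlgEquiv.ofAlgHom_apply, map_sub, map_mul, aeval_X, aeval_C, algebraMap_eq, map_add,
    Matrix.cons_val]
  apply le_antisymm <;> rw [Ideal.span_le] <;> rintro _ (rfl | rfl) <;>
    rw [SetLike.mem_coe, Ideal.mem_span_pair]
  · exact ⟨1, C Complex.I, by ring⟩
  · exact ⟨1, -C Complex.I, by ring⟩
  · exact ⟨C 2⁻¹, C 2⁻¹, by linear_combination (X 0 - C (P.1 : ℂ) * X 2) * h2⟩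
  · exact ⟨-C 2⁻¹ * C Complex.I, C 2⁻¹ * C Complex.I, by
      linear_combination (X 1 - C (P.2 : ℂ) * X 2) * h2
        - 2 * C 2⁻¹ * (X 1 - C (P.2 : ℂ) * X 2) * hI⟩

theorem containment_of_triples {n : ℕ}
    (h : (⨅ t ∈ triples n, ptIdeal (ptU n t) (ptV n t) ^ 3) ≤
      (⨅ t ∈ triples n, ptIdeal (ptU n t) (ptV n t)) ^ 2) :
    (⨅ P ∈ tripleSet n, (mP P) ^ 3) ≤ (⨅ P ∈ tripleSet n, mP P) ^ 2 := by
  have hsymm (P : ℝ × ℝ) : (mP P).map coordEquiv.toRingEquiv.symm =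
      ptIdeal (P.1 + P.2 * Complex.I) (P.1 - P.2 * Complex.I) := by
    rw [← map_coordEquiv_ptIdeal, Ideal.map_symm,
      Ideal.comap_map_of_bijective _ (RingEquiv.bijective _)]
  intro f hf
  have hg : coordEquiv.toRingEquiv.symm f ∈ (⨅ t ∈ triples n, ptIdeal (ptU n t) (ptV n t)) ^ 2 := by
    refine h ?_
    simp only [Ideal.mem_iInf] at hf ⊢
    intro t ht
    obtain ⟨p, hp, hU, hV⟩ := exists_mem_tripleSet_of_triple ht
    rw [← hU, ← hV, ← hsymm, ← Ideal.map_pow]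
    exact Ideal.mem_map_of_mem _ (hf p hp)
  have hmap : (⨅ t ∈ triples n, ptIdeal (ptU n t) (ptV n t)).map coordEquiv.toRingEquiv ≤
      ⨅ P ∈ tripleSet n, mP P := by
    refine le_iInf₂ fun P hP => ?_
    obtain ⟨t, ht, hU, hV⟩ := exists_triple_of_mem_tripleSet hP
    rw [← map_coordEquiv_ptIdeal, hU, hV]
    exact Ideal.map_mono (iInf₂_le t ht)
  have := Ideal.mem_map_of_mem coordEquiv.toRingEquiv hg
  rw [RingEquiv.apply_symm_apply, Ideal.map_pow] at this
  exact Ideal.pow_right_mono hmap 2 this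

/-- Dehomogenization with respect to the last variable. -/
noncomputable def dehom : MvPolynomial (Fin 3) ℂ →ₐ[ℂ] MvPolynomial (Fin 2) ℂ :=
  aeval ![X 0, X 1, 1]

/-- Expansion of a polynomial along a generic line through the point `(a, b)`. -/
noncomputable def expandAt (a b : ℂ) :
    MvPolynomial (Fin 2) ℂ →ₐ[ℂ] Polynomial (MvPolynomial (Fin 2) ℂ) :=
  aeval ![Polynomial.C (C a) + Polynomial.X * Polynomial.C (X 0),
    Polynomial.C (C b) + Polynomial.X * Polynomial.C (X 1)]

/-- The equation of the line `v = τ u + c`. -/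
noncomputable def lineEq (τ c : ℂ) : MvPolynomial (Fin 2) ℂ := X 1 - C τ * X 0 - C c

/-- Restriction of a polynomial to the line `v = τ u + c`. -/
noncomputable def restrictLine (τ c : ℂ) : MvPolynomial (Fin 2) ℂ →ₐ[ℂ] Polynomial ℂ :=
  aeval ![Polynomial.X, Polynomial.C τ * Polynomial.X + Polynomial.C c]

lemma X_pow_dvd_expandAt_dehom {a b : ℂ} {k : ℕ} {f : MvPolynomial (Fin 3) ℂ}
    (hf : f ∈ ptIdeal a b ^ k) : Polynomial.X ^ k ∣ expandAt a b (dehom f) := by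
  have hle : (ptIdeal a b).map ((expandAt a b).comp dehom) ≤ Ideal.span {Polynomial.X} := by
    rw [ptIdeal, Ideal.map_span, Ideal.span_le, Set.image_pair]
    have hC (z : ℂ) : algebraMap ℂ (Polynomial (MvPolynomial (Fin 2) ℂ)) z =
      Polynomial.C (C z) := rfl
    rintro _ (rfl | rfl) <;> rw [SetLike.mem_coe, Ideal.mem_span_singleton]
    · exact ⟨Polynomial.C (X 0), by simp [expandAt, dehom, hC]⟩
    · exact ⟨Polynomial.C (X 1), by simp [expandAt, dehom, hC]⟩
  have h := Ideal.mem_map_of_mem ((expandAt a b).comp dehom) hf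
  rw [Ideal.map_pow] at h
  have h' := Ideal.pow_right_mono hle k h
  rwa [Ideal.span_singleton_pow, Ideal.mem_span_singleton] at h'

lemma expandAt_lineEq (a b τ c : ℂ) : expandAt a b (lineEq τ c) =
    Polynomial.C (C (b - (τ * a + c))) + Polynomial.X * Polynomial.C (X 1 - C τ * X 0) := by
  have hC (z : ℂ) : algebraMap ℂ (Polynomial (MvPolynomial (Fin 2) ℂ)) z =
    Polynomial.C (C z) := rfl
  simp only [expandAt, lineEq, map_sub, map_mul, aeval_X, aeval_C, hC, Matrix.cons_val, map_add]
  ring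

lemma X_pow_dvd_of_lineEq_mul {a b τ c : ℂ} {k : ℕ} {f : MvPolynomial (Fin 2) ℂ}
    (h : Polynomial.X ^ k ∣ expandAt a b (lineEq τ c * f)) :
    Polynomial.X ^ (k - if b = τ * a + c then 1 else 0) ∣ expandAt a b f := by
  rw [map_mul, expandAt_lineEq] at h
  split_ifs with hb
  · rw [← sub_eq_zero] at hb
    rw [hb, map_zero, map_zero, zero_add, mul_assoc] at h
    rcases k with _ | k
    · simp
    rw [pow_succ', mul_dvd_mul_iff_left Polynomial.X_ne_zero] at h
    refine Polynomial.prime_X.pow_dvd_of_dvd_mul_left k ?_ h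
    rw [Polynomial.X_dvd_iff, Polynomial.coeff_C_zero]
    intro h0
    have := congrArg (eval ![0, 1]) h0
    simp at this
  · refine Polynomial.prime_X.pow_dvd_of_dvd_mul_left k ?_ h
    rw [Polynomial.X_dvd_iff]
    intro h0
    have := congrArg (eval 0) h0
    simp [sub_eq_zero] at this
    exact hb this

lemma sub_pow_dvd_restrictLine {a b τ c : ℂ} {k : ℕ} {f : MvPolynomial (Fin 2) ℂ}
    (hb : b = τ * a + c) (h : Polynomial.X ^ k ∣ expandAt a b f) :
    (Polynomial.X - Polynomial.C a) ^ k ∣ restrictLine τ c f := by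
  let κ : Polynomial (MvPolynomial (Fin 2) ℂ) →+* Polynomial ℂ :=
    Polynomial.eval₂RingHom (Polynomial.C.comp (eval ![1, τ])) (Polynomial.X - Polynomial.C a)
  have hκ : κ.comp (expandAt a b : MvPolynomial (Fin 2) ℂ →+* _) = restrictLine τ c := by
    have hC (z : ℂ) : algebraMap ℂ (Polynomial (MvPolynomial (Fin 2) ℂ)) z =
      Polynomial.C (C z) := rfl
    apply ringHom_ext
    · intro r
      simp [κ, expandAt, restrictLine, hC]
    · intro i
      fin_cases i
      · simp [κ, expandAt, restrictLine]
      · simp [κ, expandAt, restrictLine, hb]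
        ring
  have h2 := map_dvd κ h
  rw [map_pow] at h2
  have h3 : κ (expandAt a b f) = restrictLine τ c f := RingHom.congr_fun hκ f
  rw [h3] at h2
  simpa [κ] using h2

lemma natDegree_restrictLine_le (τ c : ℂ) (f : MvPolynomial (Fin 2) ℂ) :
    (restrictLine τ c f).natDegree ≤ f.totalDegree := by
  rw [restrictLine, aeval_def, eval₂_eq']
  refine Polynomial.natDegree_sum_le_of_forall_le _ _ fun d hd => ?_
  have hle := le_totalDegree hd
  rw [Finsupp.sum_fintype _ _ (fun _ => rfl), Fin.sum_univ_two] at hle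
  refine le_trans ?_ hle
  rw [Fin.prod_univ_two]
  simp only [Matrix.cons_val, Polynomial.algebraMap_eq]
  refine (Polynomial.natDegree_C_mul_le _ _).trans ?_
  refine Polynomial.natDegree_mul_le_of_le ?_ ?_
  · simp
  · refine Polynomial.natDegree_pow_le_of_le _ ?_ |>.trans (mul_one _).le
    exact Polynomial.natDegree_linear_le

lemma lineEq_dvd_of_restrictLine_eq_zero {τ c : ℂ} {f : MvPolynomial (Fin 2) ℂ}
    (h : restrictLine τ c f = 0) : lineEq τ c ∣ f := by
  rw [← Ideal.mem_span_singleton, ← Ideal.Quotient.eq_zero_iff_mem]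
  let q := Ideal.Quotient.mkₐ ℂ (Ideal.span {lineEq τ c})
  have hq : (q.comp (Polynomial.aeval (X 0))).comp (restrictLine τ c) = q := by
    apply algHom_ext
    intro i
    fin_cases i
    · simp [restrictLine]
    · simp only [restrictLine, q]
      simp only [AlgHom.coe_comp, Function.comp_apply, Fin.mk_one, aeval_X, Matrix.cons_val]
      rw [Ideal.Quotient.mkₐ_eq_mk, Ideal.Quotient.eq, Ideal.mem_span_singleton]
      refine ⟨-1, ?_⟩
      simp [lineEq, algebraMap_eq]
      ring
  have := AlgHom.congr_fun hq f
  simp only [AlgHom.coe_comp, Function.comp_apply, h, map_zero] at this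
  exact this.symm

lemma lineEq_ne_zero (τ c : ℂ) : lineEq τ c ≠ 0 := by
  intro h0
  have := congrArg (eval ![0, c + 1]) h0
  simp [lineEq] at this

lemma totalDegree_lineEq_pos (τ c : ℂ) : 0 < (lineEq τ c).totalDegree := by
  rw [Nat.pos_iff_ne_zero, Ne, totalDegree_eq_zero_iff_eq_C]
  intro h
  have h1 := congrArg (eval ![0, 0]) h
  have h2 := congrArg (eval ![0, 1]) h
  simp [lineEq] at h1 h2

/-- Bézout peeling: the lines in the second list split off successively from a polynomial of
degree at most `d` vanishing to order `3` at all triple points, after the lines in the first list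
have been split off, until nothing is left. -/
def peelsOff (T : Finset (Finset ℕ)) : List ℕ → ℕ → List ℕ → Bool
  | _, _, [] => false
  | L, d, k :: ks => decide (d < ∑ t ∈ T with k ∈ t, (3 - L.countP (· ∈ t))) &&
      (d == 0 || peelsOff T (k :: L) (d - 1) ks)

lemma restrictLine_eq_zero {n k d : ℕ} (hk : k < n) (m : Finset ℕ → ℕ)
    {f : MvPolynomial (Fin 2) ℂ} (hdeg : f.totalDegree ≤ d)
    (hord : ∀ t ∈ triples n, Polynomial.X ^ m t ∣ expandAt (ptU n t) (ptV n t) f)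
    (hd : d < ∑ t ∈ triples n with k ∈ t, m t) :
    restrictLine (zeta n ^ k) ((zeta n ^ k)⁻¹ - (zeta n ^ k) ^ 2) f = 0 := by
  by_contra h0
  have hdvd : ∏ t ∈ triples n with k ∈ t, (Polynomial.X - Polynomial.C (ptU n t)) ^ m t ∣
      restrictLine (zeta n ^ k) ((zeta n ^ k)⁻¹ - (zeta n ^ k) ^ 2) f := by
    refine Finset.prod_dvd_of_coprime ?_ fun t ht => ?_
    · intro t ht t' ht' hne
      simp only [Finset.coe_filter, Set.mem_ofPred_eq] at ht ht'
      refine (Polynomial.isCoprime_X_sub_C_of_isUnit_sub ?_).pow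
      rw [isUnit_iff_ne_zero, sub_ne_zero]
      exact fun h => hne (ptU_injOn_line ht.1 ht'.1 hk ht.2 ht'.2 h)
    · rw [Finset.mem_filter] at ht
      exact sub_pow_dvd_restrictLine ((line_iff_mem ht.1 hk).mpr ht.2) (hord t ht.1)
  have h1 := Polynomial.natDegree_le_of_dvd hdvd h0
  rw [Polynomial.natDegree_prod_of_monic _ _ fun t _ => (Polynomial.monic_X_sub_C _).pow _] at h1
  simp only [Polynomial.natDegree_pow, Polynomial.natDegree_X_sub_C, mul_one] at h1
  have h2 := natDegree_restrictLine_le (zeta n ^ k) ((zeta n ^ k)⁻¹ - (zeta n ^ k) ^ 2) f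
  omega

lemma eq_zero_of_peelsOff {n : ℕ} (ks : List ℕ) : ∀ (L : List ℕ) (d : ℕ),
    peelsOff (triples n) L d ks = true → (∀ k ∈ ks, k < n) →
    ∀ f : MvPolynomial (Fin 2) ℂ, f.totalDegree ≤ d →
    (∀ t ∈ triples n, Polynomial.X ^ (3 - L.countP (· ∈ t)) ∣
      expandAt (ptU n t) (ptV n t) f) → f = 0 := by
  induction ks with
  | nil => intro L d h; simp [peelsOff] at h
  | cons k ks ih =>
    intro L d h hks f hdeg hord
    rw [peelsOff, Bool.and_eq_true, decide_eq_true_eq, Bool.or_eq_true, beq_iff_eq] at h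
    have hk : k < n := hks k List.mem_cons_self
    obtain ⟨g, rfl⟩ := lineEq_dvd_of_restrictLine_eq_zero (restrictLine_eq_zero hk _ hdeg hord h.1)
    by_cases hg : g = 0
    · rw [hg, mul_zero]
    rw [totalDegree_mul_of_isDomain (lineEq_ne_zero _ _) hg] at hdeg
    have hpos := totalDegree_lineEq_pos (zeta n ^ k) ((zeta n ^ k)⁻¹ - (zeta n ^ k) ^ 2)
    rcases h.2 with h0 | h2
    · omega
    rw [ih (k :: L) (d - 1) h2 (fun l hl => hks l (List.mem_cons_of_mem _ hl)) g (by omega),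
      mul_zero]
    intro t ht
    have := X_pow_dvd_of_lineEq_mul (hord t ht)
    simp only [line_iff_mem ht hk] at this
    convert this using 2
    rw [List.countP_cons]
    split_ifs <;> simp_all [Nat.sub_sub]

lemma totalDegree_dehom_le (f : MvPolynomial (Fin 3) ℂ) :
    (dehom f).totalDegree ≤ f.totalDegree := by
  rw [dehom, aeval_def, eval₂_eq']
  refine totalDegree_finsetSum_le fun e he => ?_
  have hle := le_totalDegree he
  rw [Finsupp.sum_fintype _ _ (fun _ => rfl), Fin.sum_univ_three] at hle
  simp only [Fin.prod_univ_three, Matrix.cons_val, one_pow, mul_one, algebraMap_eq]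
  refine (totalDegree_mul _ _).trans ?_
  rw [totalDegree_C, zero_add]
  refine (totalDegree_mul _ _).trans ?_
  rw [totalDegree_X_pow, totalDegree_X_pow]
  omega

lemma eval_smul_of_isHomogeneous {f : MvPolynomial (Fin 3) ℂ} {d : ℕ} (hf : f.IsHomogeneous d)
    (c : ℂ) (r : Fin 3 → ℂ) : eval (c • r) f = c ^ d * eval r f := by
  rw [eval_eq', eval_eq', Finset.mul_sum]
  refine Finset.sum_congr rfl fun e he => ?_
  have hd : ∑ i, e i = d := by
    rw [← hf (mem_support_iff.mp he), Finsupp.weight_apply, Finsupp.sum_fintype _ _ (by simp)]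
    simp
  simp only [Pi.smul_apply, smul_eq_mul, mul_pow, Finset.prod_mul_distrib,
    Finset.prod_pow_eq_pow_sum]
  rw [hd]
  ring

lemma eq_zero_of_dehom_eq_zero {f : MvPolynomial (Fin 3) ℂ} {d : ℕ} (hf : f.IsHomogeneous d)
    (h : dehom f = 0) : f = 0 := by
  have h2 : X 2 * f = 0 := by
    refine funext fun r => ?_
    rw [map_mul, eval_X, map_zero]
    by_cases hr : r 2 = 0
    · rw [hr, zero_mul]
    have h3 : r = r 2 • ![r 0 / r 2, r 1 / r 2, 1] := by
      ext i
      fin_cases i <;> simp <;> field_simp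
    have h4 : eval ![r 0 / r 2, r 1 / r 2, 1] f = eval ![r 0 / r 2, r 1 / r 2] (dehom f) := by
      have : (eval ![r 0 / r 2, r 1 / r 2]).comp
          (dehom : MvPolynomial (Fin 3) ℂ →+* MvPolynomial (Fin 2) ℂ) =
          eval ![r 0 / r 2, r 1 / r 2, 1] := by
        apply ringHom_ext
        · intro z
          simp
        · intro i
          fin_cases i <;> simp [dehom]
      exact (RingHom.congr_fun this f).symm
    rw [h3, eval_smul_of_isHomogeneous hf, h4, h, map_zero, mul_zero, mul_zero]
  exact (mul_eq_zero.mp h2).resolve_left (X_ne_zero 2)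

/-- A homogeneous form of degree `d` with a triple zero at every triple point vanishes if the
Bézout peeling succeeds in degree `d`. -/
theorem eq_zero_of_mem_iInf_pow_three {n d N : ℕ} (ks : List ℕ)
    (h : peelsOff (triples n) [] N ks = true) (hks : ∀ k ∈ ks, k < n)
    {f : MvPolynomial (Fin 3) ℂ} (hf : f.IsHomogeneous d) (hd : d ≤ N)
    (hmem : ∀ t ∈ triples n, f ∈ ptIdeal (ptU n t) (ptV n t) ^ 3) : f = 0 := by
  have hdeg : (dehom f).totalDegree ≤ N :=
    (totalDegree_dehom_le f).trans (hf.totalDegree_le.trans hd)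
  have h0 := eq_zero_of_peelsOff ks [] N h hks (dehom f) hdeg
    fun t ht => X_pow_dvd_expandAt_dehom (hmem t ht)
  exact eq_zero_of_dehom_eq_zero hf h0

/-- The ideal of the triple points in the coordinates `u = x + i y`, `v = x - i y`, `z`. -/
noncomputable def triIdeal (n : ℕ) : Ideal (MvPolynomial (Fin 3) ℂ) :=
  ⨅ t ∈ triples n, ptIdeal (ptU n t) (ptV n t)

/-- The value and the two affine partial derivatives at the point `(a : b : 1)`. -/
noncomputable def jetAt (a b : ℂ) : MvPolynomial (Fin 3) ℂ →ₗ[ℂ] (Fin 3 → ℂ) :=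
  LinearMap.pi ![(aeval ![a, b, 1]).toLinearMap,
    (aeval ![a, b, 1]).toLinearMap ∘ₗ (pderiv 0).toLinearMap,
    (aeval ![a, b, 1]).toLinearMap ∘ₗ (pderiv 1).toLinearMap]

lemma jetAt_apply (a b : ℂ) (f : MvPolynomial (Fin 3) ℂ) :
    jetAt a b f = ![eval ![a, b, 1] f, eval ![a, b, 1] (pderiv 0 f),
      eval ![a, b, 1] (pderiv 1 f)] := by
  ext i
  fin_cases i <;> simp [jetAt]

lemma eval_eq_zero_of_mem_ptIdeal {a b : ℂ} {f : MvPolynomial (Fin 3) ℂ} (hf : f ∈ ptIdeal a b) :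
    eval ![a, b, 1] f = 0 := by
  have : ptIdeal a b ≤ RingHom.ker (eval ![a, b, 1]) := by
    rw [ptIdeal, Ideal.span_le]
    rintro _ (rfl | rfl) <;> simp [RingHom.mem_ker]
  exact this hf

lemma jetAt_eq_zero_of_mem_sq {a b : ℂ} {f : MvPolynomial (Fin 3) ℂ} (hf : f ∈ ptIdeal a b ^ 2) :
    jetAt a b f = 0 := by
  rw [pow_two] at hf
  refine Submodule.mul_induction_on hf (fun p hp q hq => ?_) fun _ _ hp hq => ?_
  · rw [jetAt_apply]
    ext i
    fin_cases i <;>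
      simp [eval_eq_zero_of_mem_ptIdeal hp, eval_eq_zero_of_mem_ptIdeal hq, Derivation.leibniz]
  · rw [map_add, hp, hq, add_zero]

lemma jetAt_X_two_pow_mul (a b : ℂ) (k : ℕ) (f : MvPolynomial (Fin 3) ℂ) :
    jetAt a b (X 2 ^ k * f) = jetAt a b f := by
  rw [jetAt_apply, jetAt_apply]
  simp [Derivation.leibniz, Derivation.leibniz_pow, pderiv_X]

/-- The `1`-jets at all triple points. -/
noncomputable def jets (n : ℕ) : MvPolynomial (Fin 3) ℂ →ₗ[ℂ] (triples n → Fin 3 → ℂ) :=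
  LinearMap.pi fun t => jetAt (ptU n t) (ptV n t)

lemma exists_separating {n : ℕ} (t : triples n) : ∃ g : MvPolynomial (Fin 3) ℂ,
    (∀ s : triples n, s ≠ t → g ∈ ptIdeal (ptU n s) (ptV n s) ^ 2) ∧
      eval ![ptU n t, ptV n t, 1] g ≠ 0 := by
  have h (s : triples n) : ∃ g : MvPolynomial (Fin 3) ℂ, s ≠ t →
      g ∈ ptIdeal (ptU n s) (ptV n s) ∧ eval ![ptU n t, ptV n t, 1] g ≠ 0 := by
    by_cases hU : ptU n t = ptU n s
    · refine ⟨X 1 - C (ptV n s) * X 2, fun hst => ⟨Ideal.subset_span (by simp), ?_⟩⟩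
      have hV : ptV n t ≠ ptV n s := fun hV => hst (Subtype.ext (pt_injOn t.2 s.2 hU hV)).symm
      simpa [sub_eq_zero] using hV
    · refine ⟨X 0 - C (ptU n s) * X 2, fun hst => ⟨Ideal.subset_span (by simp), ?_⟩⟩
      simpa [sub_eq_zero] using hU
  choose g hg using h
  refine ⟨∏ s ∈ Finset.univ.erase t, g s ^ 2, fun s hs => ?_, ?_⟩
  · rw [← Finset.mul_prod_erase _ _ (Finset.mem_erase.mpr ⟨hs, Finset.mem_univ s⟩)]
    exact Ideal.mul_mem_right _ _ (Ideal.pow_mem_pow (hg s hs).1 2)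
  · rw [map_prod, Finset.prod_ne_zero_iff]
    intro s hs
    rw [map_pow]
    exact pow_ne_zero 2 (hg s (Finset.ne_of_mem_erase hs)).2

lemma jets_surjective (n : ℕ) : Function.Surjective (jets n) := by
  rw [← LinearMap.range_eq_top, eq_top_iff]
  have hsingle (t : triples n) (y : Fin 3 → ℂ) : Pi.single t y ∈ LinearMap.range (jets n) := by
    obtain ⟨g, hg, hgt⟩ := exists_separating t
    have hjet (q : MvPolynomial (Fin 3) ℂ) :
        jets n (g * q) = Pi.single t (jetAt (ptU n t) (ptV n t) (g * q)) := by
      ext1 s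
      by_cases hs : s = t
      · subst hs
        simp [jets]
      · rw [Pi.single_eq_of_ne hs]
        exact jetAt_eq_zero_of_mem_sq (Ideal.mul_mem_right _ _ (hg s hs))
    obtain ⟨a, ha⟩ : ∃ a, a = ptU n t := ⟨_, rfl⟩
    obtain ⟨b, hb⟩ : ∃ b, b = ptV n t := ⟨_, rfl⟩
    rw [← ha, ← hb] at hjet hgt
    obtain ⟨e, he⟩ : ∃ e, e = eval ![a, b, 1] g := ⟨_, rfl⟩
    obtain ⟨e0, he0⟩ : ∃ e, e = eval ![a, b, 1] (pderiv 0 g) := ⟨_, rfl⟩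
    obtain ⟨e1, he1⟩ : ∃ e, e = eval ![a, b, 1] (pderiv 1 g) := ⟨_, rfl⟩
    rw [← he] at hgt
    refine ⟨g * (C (y 0 / e) + C ((y 1 - y 0 / e * e0) / e) * (X 0 - C a)
      + C ((y 2 - y 0 / e * e1) / e) * (X 1 - C b)), ?_⟩
    rw [hjet]
    congr 1
    rw [jetAt_apply]
    ext i
    fin_cases i
    · simp [← he]
      field_simp
    · simp [Derivation.leibniz, ← he, ← he0, pderiv_X]
      field_simp
      ring
    · simp [Derivation.leibniz, ← he, ← he1, pderiv_X]
      field_simp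
      ring
  intro y _
  rw [← Finset.univ_sum_single y]
  exact Submodule.sum_mem _ fun t _ => hsingle t (y t)

/-- The monomial `u ^ m.1 * v ^ m.2`. -/
noncomputable def mon (m : ℕ × ℕ) : MvPolynomial (Fin 3) ℂ := X 0 ^ m.1 * X 1 ^ m.2

/-- The exponents of degree less than `M`, with those in `E` removed. -/
def stdExp (M : ℕ) (E : Finset (ℕ × ℕ)) : Finset (ℕ × ℕ) :=
  ((Finset.range M ×ˢ Finset.range M).filter fun m => m.1 + m.2 < M) \ E

lemma mem_stdExp {M : ℕ} {E : Finset (ℕ × ℕ)} {m : ℕ × ℕ} :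
    m ∈ stdExp M E ↔ m.1 + m.2 < M ∧ m ∉ E := by
  simp only [stdExp, Finset.mem_sdiff, Finset.mem_filter, Finset.mem_product, Finset.mem_range]
  constructor
  · exact fun h => ⟨h.1.2, h.2⟩
  · exact fun h => ⟨⟨⟨by omega, by omega⟩, h.1⟩, h.2⟩

/-- The polynomials which lie in the square of the ideal of the triple points after multiplication
by the power of the last variable which raises the degree from `d` to `N`. -/
noncomputable def sqColon (n N d : ℕ) : Ideal (MvPolynomial (Fin 3) ℂ) :=
  (triIdeal n ^ 2).colon {X 2 ^ (N - d)}

lemma mem_sqColon {n N d : ℕ} {q : MvPolynomial (Fin 3) ℂ} :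
    q ∈ sqColon n N d ↔ X 2 ^ (N - d) * q ∈ triIdeal n ^ 2 := by
  rw [sqColon, Submodule.mem_colon_singleton, smul_eq_mul, mul_comm]

lemma sq_le_sqColon (n N d : ℕ) : triIdeal n ^ 2 ≤ sqColon n N d := fun _ hq =>
  mem_sqColon.mpr (Ideal.mul_mem_left _ _ hq)

section
attribute [local instance] MvPolynomial.gradedAlgebra

lemma isHomogeneous_ptIdeal (a b : ℂ) :
    (ptIdeal a b).IsHomogeneous (homogeneousSubmodule (Fin 3) ℂ) := by
  refine Ideal.homogeneous_span _ _ ?_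
  rintro _ (rfl | rfl)
  · exact ⟨1, (isHomogeneous_X _ _).sub ((isHomogeneous_X _ _).C_mul _)⟩
  · exact ⟨1, (isHomogeneous_X _ _).sub ((isHomogeneous_X _ _).C_mul _)⟩

lemma homogeneousComponent_mem_ptIdeal_pow_three {a b : ℂ} {q : MvPolynomial (Fin 3) ℂ}
    (hq : q ∈ ptIdeal a b ^ 3) (d : ℕ) : homogeneousComponent d q ∈ ptIdeal a b ^ 3 := by
  refine homogeneousComponent_mem_of_mem ?_ hq d
  rw [pow_succ, pow_two]
  have h := isHomogeneous_ptIdeal a b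
  exact (h.mul h).mul h

lemma homogeneousComponent_mem_sq {n : ℕ} {q : MvPolynomial (Fin 3) ℂ} (hq : q ∈ triIdeal n ^ 2)
    (d : ℕ) : homogeneousComponent d q ∈ triIdeal n ^ 2 := by
  have h : (triIdeal n).IsHomogeneous (homogeneousSubmodule (Fin 3) ℂ) :=
    Ideal.IsHomogeneous.iInf₂ fun t _ => isHomogeneous_ptIdeal _ _
  refine homogeneousComponent_mem_of_mem ?_ hq d
  rw [pow_two]
  exact h.mul h

end

lemma homogeneousComponent_X_two_pow_mul (k d : ℕ) (q : MvPolynomial (Fin 3) ℂ) :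
    homogeneousComponent (k + d) (X 2 ^ k * q) = X 2 ^ k * homogeneousComponent d q := by
  conv_lhs => rw [← sum_homogeneousComponent q, Finset.mul_sum, map_sum]
  have h (i : ℕ) : homogeneousComponent (k + d) (X 2 ^ k * homogeneousComponent i q) =
      if i = d then X 2 ^ k * homogeneousComponent d q else 0 := by
    have hi : (X 2 ^ k * homogeneousComponent i q).IsHomogeneous (k + i) :=
      (isHomogeneous_X_pow 2 k).mul (homogeneousComponent_isHomogeneous i q)
    rw [homogeneousComponent_of_mem hi]
    by_cases hid : i = d
    · simp [hid]
    · rw [if_neg (by omega), if_neg hid]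
  simp only [h]
  rw [Finset.sum_ite_eq']
  split_ifs with hd
  · rfl
  · rw [homogeneousComponent_eq_zero _ _ (by simpa using hd), mul_zero]

lemma homogeneousComponent_mem_sqColon {n N d : ℕ} {q : MvPolynomial (Fin 3) ℂ}
    (hq : q ∈ sqColon n N d) (e : ℕ) : homogeneousComponent e q ∈ sqColon n N d := by
  rw [mem_sqColon] at hq ⊢
  rw [← homogeneousComponent_X_two_pow_mul]
  exact homogeneousComponent_mem_sq hq _

lemma X_two_mul_mem_sqColon {n N d : ℕ} {q : MvPolynomial (Fin 3) ℂ} (hq : q ∈ sqColon n N d) :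
    X 2 * q ∈ sqColon n N (d + 1) := by
  rw [mem_sqColon] at hq ⊢
  rw [← mul_assoc, ← pow_succ]
  obtain ⟨k, hk⟩ := Nat.exists_eq_add_of_le (show N - d ≤ N - (d + 1) + 1 by omega)
  rw [hk, pow_add, mul_right_comm]
  exact Ideal.mul_mem_right _ _ hq

/-- The span of the standard forms of degree `d`, together with the polynomials of degree `d`
whose multiple of degree `N` by a power of the last variable lies in the square of the ideal. -/
noncomputable def stdSpan (n N : ℕ) (D : Finset (ℕ × ℕ)) (d : ℕ) :
    Submodule ℂ (MvPolynomial (Fin 3) ℂ) :=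
  Submodule.span ℂ ((fun m => mon m * X 2 ^ (d - (m.1 + m.2))) '' {m | m ∈ D ∧ m.1 + m.2 ≤ d}) ⊔
    (sqColon n N d).restrictScalars ℂ

lemma mon_mem_stdSpan {n N d : ℕ} {D : Finset (ℕ × ℕ)} {m : ℕ × ℕ} (hm : m ∈ D)
    (hd : m.1 + m.2 = d) : mon m ∈ stdSpan n N D d := by
  refine Submodule.mem_sup_left (Submodule.subset_span ⟨m, ⟨hm, hd.le⟩, ?_⟩)
  simp [hd]

lemma X_two_mul_mem_stdSpan {n N d : ℕ} {D : Finset (ℕ × ℕ)} {q : MvPolynomial (Fin 3) ℂ}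
    (hq : q ∈ stdSpan n N D d) : X 2 * q ∈ stdSpan n N D (d + 1) := by
  obtain ⟨p, hp, r, hr, rfl⟩ := Submodule.mem_sup.mp hq
  rw [mul_add]
  refine Submodule.add_mem _ ?_ (Submodule.mem_sup_right (X_two_mul_mem_sqColon hr))
  refine Submodule.mem_sup_left ?_
  clear hq hr
  induction hp using Submodule.span_induction with
  | mem p hp =>
    obtain ⟨m, hm, rfl⟩ := hp
    refine Submodule.subset_span ⟨m, ⟨hm.1, hm.2.trans d.le_succ⟩, ?_⟩
    dsimp only
    rw [Nat.sub_add_comm hm.2, pow_succ]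
    ring
  | zero => simp
  | add p q _ _ hp hq => rw [mul_add]; exact Submodule.add_mem _ hp hq
  | smul c p _ hp => rw [mul_smul_comm]; exact Submodule.smul_mem _ c hp

lemma monomial_eq_mon_mul (s : Fin 3 →₀ ℕ) (c : ℂ) :
    monomial s c = c • (X 2 ^ s 2 * mon (s 0, s 1)) := by
  rw [monomial_eq, Finsupp.prod_fintype _ _ (by simp), Fin.prod_univ_three, smul_eq_C_mul, mon]
  ring

lemma mem_of_forall_mon_mem {d : ℕ} (W : Submodule ℂ (MvPolynomial (Fin 3) ℂ))
    (h : ∀ (k : ℕ) (m : ℕ × ℕ), m.1 + m.2 + k = d → X 2 ^ k * mon m ∈ W)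
    {f : MvPolynomial (Fin 3) ℂ} (hf : f.IsHomogeneous d) : f ∈ W := by
  rw [f.as_sum]
  refine Submodule.sum_mem _ fun s hs => ?_
  rw [monomial_eq_mon_mul]
  refine Submodule.smul_mem _ _ (h _ _ ?_)
  have := hf (mem_support_iff.mp hs)
  rwa [Finsupp.weight_apply, Finsupp.sum_fintype _ _ (by simp), Fin.sum_univ_three,
    Pi.one_apply, Pi.one_apply, Pi.one_apply, smul_eq_mul, smul_eq_mul, smul_eq_mul, mul_one,
    mul_one, mul_one] at this

lemma isHomogeneous_mon (m : ℕ × ℕ) : (mon m).IsHomogeneous (m.1 + m.2) :=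
  (isHomogeneous_X_pow 0 m.1).mul (isHomogeneous_X_pow 1 m.2)

/-- Every form of degree `d` reduces to standard forms, given a reduction of the binary leading
forms. -/
lemma mem_stdSpan_of_isHomogeneous {n N : ℕ} {D : Finset (ℕ × ℕ)} (h0 : (0, 0) ∈ D)
    (hred : ∀ m ∉ D, ∃ p ∈ Submodule.span ℂ (mon '' {k | k ∈ D ∧ k.1 + k.2 = m.1 + m.2}),
      mon m - p ∈ sqColon n N (m.1 + m.2) ⊔ Ideal.span {X 2}) :
    ∀ {d : ℕ} {f : MvPolynomial (Fin 3) ℂ}, f.IsHomogeneous d → f ∈ stdSpan n N D d := by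
  intro d
  induction d with
  | zero =>
    refine mem_of_forall_mon_mem _ fun k m hm => ?_
    obtain rfl : m = (0, 0) := Prod.ext (by simp; omega) (by simp; omega)
    obtain rfl : k = 0 := by omega
    rw [pow_zero, one_mul]
    exact mon_mem_stdSpan h0 rfl
  | succ d ih =>
    refine mem_of_forall_mon_mem _ fun k m hm => ?_
    obtain _ | k := k
    · rw [pow_zero, one_mul]
      rw [add_zero] at hm
      by_cases hD : m ∈ D
      · exact mon_mem_stdSpan hD hm
      obtain ⟨p, hp, hr⟩ := hred m hD
      obtain ⟨q, hq, r, hr, hqr⟩ := Submodule.mem_sup.mp hr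
      obtain ⟨r, rfl⟩ := Ideal.mem_span_singleton.mp hr
      rw [hm] at hp hq
      have hph : p.IsHomogeneous (d + 1) := by
        rw [← mem_homogeneousSubmodule]
        refine Submodule.span_le.mpr ?_ hp
        rintro _ ⟨k, hk, rfl⟩
        exact hk.2 ▸ isHomogeneous_mon k
      have hcomp : mon m - p = homogeneousComponent (d + 1) q + X 2 * homogeneousComponent d r := by
        have hX := homogeneousComponent_X_two_pow_mul 1 d r
        rw [pow_one, add_comm 1 d] at hX
        rw [← hX, ← map_add, hqr, homogeneousComponent_of_mem, if_pos rfl]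
        exact (hm ▸ isHomogeneous_mon m).sub hph
      rw [← sub_add_cancel (mon m) p, hcomp]
      refine Submodule.add_mem _ (Submodule.add_mem _ ?_ ?_) ?_
      · exact Submodule.mem_sup_right (homogeneousComponent_mem_sqColon hq _)
      · exact X_two_mul_mem_stdSpan (ih (homogeneousComponent_isHomogeneous d r))
      · refine Submodule.span_le.mpr ?_ hp
        rintro _ ⟨k, hk, rfl⟩
        exact mon_mem_stdSpan hk.1 hk.2
    · rw [pow_succ', mul_assoc]
      refine X_two_mul_mem_stdSpan (ih ?_)
      have : d = k + (m.1 + m.2) := by omega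
      exact this ▸ (isHomogeneous_X_pow 2 k).mul (isHomogeneous_mon m)

lemma jets_X_two_pow_mul (n k : ℕ) (f : MvPolynomial (Fin 3) ℂ) :
    jets n (X 2 ^ k * f) = jets n f :=
  funext fun t => jetAt_X_two_pow_mul (ptU n t) (ptV n t) k f

lemma jets_eq_zero_of_mem {n : ℕ} {f : MvPolynomial (Fin 3) ℂ}
    (hf : ∀ t ∈ triples n, f ∈ ptIdeal (ptU n t) (ptV n t) ^ 2) : jets n f = 0 :=
  funext fun t => jetAt_eq_zero_of_mem_sq (hf t t.2)

lemma jets_eq_zero_of_mem_sq {n : ℕ} {f : MvPolynomial (Fin 3) ℂ} (hf : f ∈ triIdeal n ^ 2) :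
    jets n f = 0 :=
  jets_eq_zero_of_mem fun _ ht => by
    have hle := iInf₂_le (f := fun t (_ : t ∈ triples n) => ptIdeal (ptU n t) (ptV n t)) _ ht
    exact Ideal.pow_right_mono hle 2 hf

lemma jets_eq_zero_of_mem_sqColon {n N d : ℕ} {f : MvPolynomial (Fin 3) ℂ}
    (hf : f ∈ sqColon n N d) : jets n f = 0 := by
  rw [← jets_X_two_pow_mul n (N - d)]
  exact jets_eq_zero_of_mem_sq (mem_sqColon.mp hf)

lemma linearIndependent_jets_mon {n N : ℕ} {D : Finset (ℕ × ℕ)}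
    (hcard : D.card = 3 * (triples n).card)
    (hspan : ∀ {d : ℕ} {f : MvPolynomial (Fin 3) ℂ}, f.IsHomogeneous d → f ∈ stdSpan n N D d) :
    LinearIndependent ℂ fun m : D => jets n (mon m) := by
  refine linearIndependent_of_top_le_span_of_card_eq_finrank ?_ ?_
  · rintro y -
    obtain ⟨f, rfl⟩ := jets_surjective n y
    rw [← sum_homogeneousComponent f, map_sum]
    refine Submodule.sum_mem _ fun d _ => ?_
    obtain ⟨p, hp, r, hr, hpr⟩ :=
      Submodule.mem_sup.mp (hspan (homogeneousComponent_isHomogeneous d f))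
    rw [← hpr, map_add, jets_eq_zero_of_mem_sqColon hr, add_zero]
    clear hpr
    induction hp using Submodule.span_induction with
    | mem p hp =>
      obtain ⟨m, hm, rfl⟩ := hp
      dsimp only
      rw [mul_comm, jets_X_two_pow_mul]
      exact Submodule.subset_span ⟨⟨m, hm.1⟩, rfl⟩
    | zero => simp
    | add p q _ _ hp hq => rw [map_add]; exact Submodule.add_mem _ hp hq
    | smul c p _ hp => rw [map_smul]; exact Submodule.smul_mem _ c hp
  · simp [Module.finrank_pi_fintype, hcard, mul_comm]

lemma mem_sq_of_mem_symbolic_sq {n N : ℕ} {D : Finset (ℕ × ℕ)}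
    (hcard : D.card = 3 * (triples n).card)
    (hspan : ∀ {d : ℕ} {f : MvPolynomial (Fin 3) ℂ}, f.IsHomogeneous d → f ∈ stdSpan n N D d)
    {d : ℕ} (hd : N ≤ d) {f : MvPolynomial (Fin 3) ℂ} (hf : f.IsHomogeneous d)
    (hmem : ∀ t ∈ triples n, f ∈ ptIdeal (ptU n t) (ptV n t) ^ 2) : f ∈ triIdeal n ^ 2 := by
  obtain ⟨p, hp, r, hr, hpr⟩ := Submodule.mem_sup.mp (hspan hf)
  have hp0 : jets n p = 0 := by
    have := jets_eq_zero_of_mem hmem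
    rwa [← hpr, map_add, jets_eq_zero_of_mem_sqColon hr, add_zero] at this
  have hind : LinearIndependent ℂ (jets n ∘ fun m : {m : ℕ × ℕ | m ∈ D ∧ m.1 + m.2 ≤ d} =>
      mon (m : ℕ × ℕ) * X 2 ^ (d - ((m : ℕ × ℕ).1 + (m : ℕ × ℕ).2))) := by
    have := (linearIndependent_jets_mon hcard hspan).comp
      (fun m : {m : ℕ × ℕ | m ∈ D ∧ m.1 + m.2 ≤ d} => (⟨m, m.2.1⟩ : D))
      fun a b hab => Subtype.ext (congrArg (fun m : D => (m : ℕ × ℕ)) hab)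
    convert this using 1
    funext m
    rw [Function.comp_apply, mul_comm, jets_X_two_pow_mul]
    rfl
  rw [Set.image_eq_range] at hp
  rw [Submodule.disjoint_def.mp (Submodule.range_ker_disjoint hind) p hp hp0, zero_add] at hpr
  have := mem_sqColon.mp hr
  rwa [Nat.sub_eq_zero_of_le hd, pow_zero, one_mul, hpr] at this

/-- The containment for the ideal of the triple points, from a list `ks` of lines showing that the
third symbolic power vanishes in degrees less than `N`, and from a set of standard exponents for
the saturation of the square of the ideal in degrees at least `N`. -/
theorem containment_of_reduction {n N : ℕ} {D : Finset (ℕ × ℕ)} (ks : List ℕ)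
    (hks : ∀ k ∈ ks, k < n) (hpeel : peelsOff (triples n) [] (N - 1) ks = true)
    (hcard : D.card = 3 * (triples n).card) (h0 : (0, 0) ∈ D)
    (hred : ∀ m ∉ D, ∃ p ∈ Submodule.span ℂ (mon '' {k | k ∈ D ∧ k.1 + k.2 = m.1 + m.2}),
      mon m - p ∈ sqColon n N (m.1 + m.2) ⊔ Ideal.span {X 2}) :
    (⨅ P ∈ tripleSet n, (mP P) ^ 3) ≤ (⨅ P ∈ tripleSet n, mP P) ^ 2 := by
  refine containment_of_triples fun f hf => ?_
  rw [Ideal.mem_iInf] at hf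
  have hf (t) (ht : t ∈ triples n) : f ∈ ptIdeal (ptU n t) (ptV n t) ^ 3 := by
    have := hf t
    rw [Ideal.mem_iInf] at this
    exact this ht
  rw [← sum_homogeneousComponent f]
  refine Submodule.sum_mem _ fun d _ => ?_
  have hd (t) (ht : t ∈ triples n) := homogeneousComponent_mem_ptIdeal_pow_three (hf t ht) d
  by_cases hdN : d < N
  · rw [eq_zero_of_mem_iInf_pow_three ks hpeel hks (homogeneousComponent_isHomogeneous d f)
      (by omega) hd]
    exact zero_mem _
  · exact mem_sq_of_mem_symbolic_sq hcard (fun hf => mem_stdSpan_of_isHomogeneous h0 hred hf)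
      (not_lt.mp hdN) (homogeneousComponent_isHomogeneous d f)
      fun t ht => Ideal.pow_le_pow_right (by norm_num) (hd t ht)

/-- The complete homogeneous symmetric polynomials in three variables with product `1`, in terms of
the elementary symmetric polynomials `u` and `v`. -/
def complSymm {A : Type*} [CommRing A] (u v : A) : ℕ → A
  | 0 => 1
  | 1 => u
  | 2 => u ^ 2 - v
  | k + 3 => u * complSymm u v (k + 2) - v * complSymm u v (k + 1) + complSymm u v k

lemma map_complSymm {A B : Type*} [CommRing A] [CommRing B] (φ : A →+* B) (u v : A) (k : ℕ) :
    φ (complSymm u v k) = complSymm (φ u) (φ v) k := by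
  induction k using complSymm.induct with
  | case1 => simp [complSymm]
  | case2 => simp [complSymm]
  | case3 => simp [complSymm]
  | case4 k h2 h1 h0 => simp [complSymm, h2, h1, h0]

lemma vandermonde_mul_complSymm {A : Type*} [CommRing A] {x y z : A} (h : x * y * z = 1) (k : ℕ) :
    (x - y) * (y - z) * (x - z) * complSymm (x + y + z) (x * y + x * z + y * z) k =
      x ^ (k + 2) * (y - z) - y ^ (k + 2) * (x - z) + z ^ (k + 2) * (x - y) := by
  induction k using complSymm.induct with
  | case1 => simp only [complSymm]; ring
  | case2 => simp only [complSymm]; ring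
  | case3 => simp only [complSymm]; ring
  | case4 k h2 h1 h0 =>
    rw [show k.succ.succ.succ = k + 3 from rfl, complSymm]
    linear_combination (x + y + z) * h2 - (x * y + x * z + y * z) * h1 + h0 -
      (x ^ (k + 2) * (y - z) - y ^ (k + 2) * (x - z) + z ^ (k + 2) * (x - y)) * h

/-- The relations between the coordinates of the triple points. -/
lemma complSymm_ptU_ptV {n j k : ℕ} (hjk : j + k + 3 = n) {t : Finset ℕ} (ht : t ∈ triples n) :
    complSymm (ptU n t) (ptV n t) k = complSymm (ptV n t) (ptU n t) j := by
  obtain ⟨i₁, i₂, i₃, hi₁, hi₂, hi₃, h12, h13, h23, rfl, h⟩ := exists_of_mem_triples ht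
  rw [ptU_triple h12 h13 h23, ptV_triple h12 h13 h23]
  have hpow (i : ℕ) : (zeta n ^ i) ^ (j + k + 3) = 1 := by
    rw [hjk, ← pow_mul, mul_comm, pow_mul, (zeta_primitive (by omega)).pow_eq_one, one_pow]
  have hx := hpow i₁
  have hy := hpow i₂
  have hz := hpow i₃
  have hxy : zeta n ^ i₁ - zeta n ^ i₂ ≠ 0 := fun h => h12 (zeta_pow_inj hi₁ hi₂ (sub_eq_zero.mp h))
  have hxz : zeta n ^ i₁ - zeta n ^ i₃ ≠ 0 := fun h => h13 (zeta_pow_inj hi₁ hi₃ (sub_eq_zero.mp h))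
  have hyz : zeta n ^ i₂ - zeta n ^ i₃ ≠ 0 := fun h => h23 (zeta_pow_inj hi₂ hi₃ (sub_eq_zero.mp h))
  generalize zeta n ^ i₁ = x at *
  generalize zeta n ^ i₂ = y at *
  generalize zeta n ^ i₃ = z at *
  have e1 : x⁻¹ = y * z := inv_eq_of_mul_eq_one_right (by linear_combination h)
  have e2 : y⁻¹ = x * z := inv_eq_of_mul_eq_one_right (by linear_combination h)
  have e3 : z⁻¹ = x * y := inv_eq_of_mul_eq_one_right (by linear_combination h)
  have key := vandermonde_mul_complSymm (x := y * z) (y := x * z) (z := x * y)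
    (by linear_combination (x * y * z + 1) * h) j
  have hu : y * z * (x * z) + y * z * (x * y) + x * z * (x * y) = x + y + z := by
    linear_combination (x + y + z) * h
  have hv : y * z + x * z + x * y = x * y + x * z + y * z := by ring
  rw [hu, hv] at key
  have hinv (a b : ℂ) (hab : a * b = 1) (ha : a ^ (j + k + 3) = 1) :
      b ^ (j + 2) = a ^ (k + 1) := by
    have hb : a ^ (j + 2) * b ^ (j + 2) = 1 := by rw [← mul_pow, hab, one_pow]
    calc b ^ (j + 2) = b ^ (j + 2) * a ^ (j + k + 3) := by rw [ha, mul_one]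
      _ = a ^ (j + 2) * b ^ (j + 2) * a ^ (k + 1) := by ring
      _ = a ^ (k + 1) := by rw [hb, one_mul]
  rw [hinv x _ (by linear_combination h) hx, hinv y _ (by linear_combination h) hy,
    hinv z _ (by linear_combination h) hz] at key
  rw [e1, e2, e3, hv]
  refine mul_left_cancel₀ (mul_ne_zero (mul_ne_zero hxy hyz) hxz) ?_
  rw [vandermonde_mul_complSymm h]
  linear_combination key + (x - y) * (y - z) * (x - z) *
    complSymm (x * y + x * z + y * z) (x + y + z) j * h

lemma mem_ptIdeal_of_aeval_eq_zero {a b : ℂ} {f : MvPolynomial (Fin 3) ℂ}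
    (h : aeval ![C a * X 2, C b * X 2, X 2] f = (0 : MvPolynomial (Fin 3) ℂ)) :
    f ∈ ptIdeal a b := by
  rw [← Ideal.Quotient.eq_zero_iff_mem]
  have hq : (Ideal.Quotient.mkₐ ℂ (ptIdeal a b)).comp (aeval ![C a * X 2, C b * X 2, X 2]) =
      Ideal.Quotient.mkₐ ℂ (ptIdeal a b) := by
    apply algHom_ext
    intro i
    rw [AlgHom.comp_apply, aeval_X, Ideal.Quotient.mkₐ_eq_mk, eq_comm, Ideal.Quotient.eq]
    fin_cases i
    · exact Ideal.subset_span (by simp)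
    · exact Ideal.subset_span (by simp)
    · simp
  have := AlgHom.congr_fun hq f
  rw [AlgHom.comp_apply, h, map_zero] at this
  exact this.symm

/-- A homogeneous polynomial lies in the ideal of the triple points if its dehomogenization is a
combination of the relations between the coordinates. -/
lemma mem_triIdeal {n : ℕ} {f : MvPolynomial (Fin 3) ℂ}
    (h : ∀ u v : MvPolynomial (Fin 3) ℂ,
      (∀ j k, j + k + 3 = n → complSymm u v k = complSymm v u j) →
      aeval ![u * X 2, v * X 2, X 2] f = 0) : f ∈ triIdeal n := by
  simp only [triIdeal, Ideal.mem_iInf]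
  refine fun t ht => mem_ptIdeal_of_aeval_eq_zero (h _ _ fun j k hjk => ?_)
  rw [← map_complSymm, ← map_complSymm, complSymm_ptU_ptV hjk ht]

/-- The binary form obtained by setting the last variable to zero. -/
noncomputable def lead : MvPolynomial (Fin 3) ℂ →ₐ[ℂ] MvPolynomial (Fin 3) ℂ :=
  aeval ![X 0, X 1, 0]

lemma lead_X_zero : lead (X 0) = X 0 := by simp [lead]

lemma lead_X_one : lead (X 1) = X 1 := by simp [lead]

lemma lead_X_two : lead (X 2) = 0 := by simp [lead]

lemma lead_mem {I : Ideal (MvPolynomial (Fin 3) ℂ)} {f : MvPolynomial (Fin 3) ℂ} (hf : f ∈ I) :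
    lead f ∈ I ⊔ Ideal.span {X 2} := by
  have hq : (Ideal.Quotient.mkₐ ℂ (I ⊔ Ideal.span {X 2})).comp lead =
      Ideal.Quotient.mkₐ ℂ (I ⊔ Ideal.span {X 2}) := by
    apply algHom_ext
    intro i
    rw [AlgHom.comp_apply, lead, aeval_X, Ideal.Quotient.mkₐ_eq_mk, eq_comm, Ideal.Quotient.eq]
    fin_cases i
    · simp
    · simp
    · exact Ideal.mem_sup_right (Ideal.subset_span (by simp))
  have := AlgHom.congr_fun hq f
  rwa [AlgHom.comp_apply, Ideal.Quotient.mkₐ_eq_mk,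
    Ideal.Quotient.eq_zero_iff_mem.mpr (Ideal.mem_sup_left hf),
    Ideal.Quotient.eq_zero_iff_mem] at this

/-- The quadratic combination `∑ c * (g i * g j)` over the entries `(i, j, c)` of a list. -/
def quadComb {ι A : Type*} [CommRing A] (g : ι → A) (L : List (ι × ι × A)) : A :=
  (L.map fun a => a.2.2 * (g a.1 * g a.2.1)).sum

lemma quadComb_nil {ι A : Type*} [CommRing A] (g : ι → A) : quadComb g [] = 0 := rfl

lemma quadComb_cons {ι A : Type*} [CommRing A] (g : ι → A) (i j : ι) (c : A)
    (L : List (ι × ι × A)) : quadComb g ((i, j, c) :: L) = c * (g i * g j) + quadComb g L := by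
  simp [quadComb]

lemma quadComb_mem {ι A : Type*} [CommRing A] {I : Ideal A} {g : ι → A} (hg : ∀ i, g i ∈ I)
    (L : List (ι × ι × A)) : quadComb g L ∈ I ^ 2 := by
  rw [quadComb]
  refine list_sum_mem fun x hx => ?_
  obtain ⟨a, -, rfl⟩ := List.mem_map.mp hx
  rw [pow_two]
  exact Ideal.mul_mem_left _ _ (Ideal.mul_mem_mul (hg _) (hg _))

/-- The binary form with the given integer coefficients. -/
noncomputable def binForm (P : List (ℤ × ℕ × ℕ)) : MvPolynomial (Fin 3) ℂ :=
  (P.map fun a => (a.1 : MvPolynomial (Fin 3) ℂ) * mon a.2).sum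

lemma binForm_nil : binForm [] = 0 := rfl

lemma binForm_cons (c : ℤ) (m : ℕ × ℕ) (P : List (ℤ × ℕ × ℕ)) :
    binForm ((c, m) :: P) = (c : MvPolynomial (Fin 3) ℂ) * mon m + binForm P := by
  simp [binForm]

lemma binForm_mem_span {S : Set (ℕ × ℕ)} {P : List (ℤ × ℕ × ℕ)} (hP : ∀ a ∈ P, a.2 ∈ S) :
    binForm P ∈ Submodule.span ℂ (mon '' S) := by
  rw [binForm]
  refine list_sum_mem fun x hx => ?_
  obtain ⟨a, ha, rfl⟩ := List.mem_map.mp hx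
  rw [← zsmul_eq_mul]
  exact zsmul_mem (Submodule.subset_span (Set.mem_image_of_mem mon (hP a ha))) _

lemma mon_mem_of_le {I : Ideal (MvPolynomial (Fin 3) ℂ)} {M : ℕ}
    (h : ∀ k ≤ M, mon (k, M - k) ∈ I) {m : ℕ × ℕ} (hm : M ≤ m.1 + m.2) : mon m ∈ I := by
  have hk := h (min m.1 M) (min_le_right _ _)
  have h1 : min m.1 M + (m.1 - min m.1 M) = m.1 := by omega
  have h2 : M - min m.1 M + (m.2 - (M - min m.1 M)) = m.2 := by omega
  have : mon m = mon (m.1 - min m.1 M, m.2 - (M - min m.1 M)) * mon (min m.1 M, M - min m.1 M) := by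
    conv_lhs => rw [mon, ← h1, ← h2, pow_add, pow_add]
    simp only [mon]
    ring
  rw [this]
  exact Ideal.mul_mem_left _ _ hk

/-- The containment, from explicit generators `g` of the ideal of the triple points, quadratic
combinations of them with leading forms the monomials of degree `M`, and reductions of the
exponents in `E`. -/
theorem containment_of_certificates {n N M r : ℕ} {E : Finset (ℕ × ℕ)} (ks : List ℕ)
    (hpeel : peelsOff (triples n) [] (N - 1) ks = true) (hks : ∀ k ∈ ks, k < n)
    (hcard : (stdExp M E).card = 3 * (triples n).card) (h0 : (0, 0) ∈ stdExp M E)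
    {g : Fin r → MvPolynomial (Fin 3) ℂ} (hg : ∀ i, g i ∈ triIdeal n)
    (hM : ∀ k ≤ M, ∃ L, lead (quadComb g L) = mon (k, M - k))
    (hE : ∀ m ∈ E, ∃ P : List (ℤ × ℕ × ℕ),
      (∀ a ∈ P, a.2 ∈ stdExp M E ∧ a.2.1 + a.2.2 = m.1 + m.2) ∧
      ∃ L, ∃ q ∈ sqColon n N (m.1 + m.2), lead (quadComb g L + q) = mon m - binForm P) :
    (⨅ P ∈ tripleSet n, (mP P) ^ 3) ≤ (⨅ P ∈ tripleSet n, mP P) ^ 2 := by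
  refine containment_of_reduction ks hks hpeel hcard h0 fun m hm => ?_
  rw [mem_stdExp, not_and_or, not_not] at hm
  by_cases hmE : m ∈ E
  · obtain ⟨P, hP, L, q, hq, hL⟩ := hE m hmE
    refine ⟨binForm P, binForm_mem_span hP, ?_⟩
    rw [← hL]
    exact lead_mem (Ideal.add_mem _ (sq_le_sqColon _ _ _ (quadComb_mem hg L)) hq)
  · refine ⟨0, zero_mem _, ?_⟩
    rw [sub_zero]
    refine sup_le_sup_right (sq_le_sqColon n N _) _ (mon_mem_of_le (M := M) (fun k hk => ?_)
      (not_lt.mp (hm.resolve_right hmE)))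
    obtain ⟨L, hL⟩ := hM k hk
    rw [← hL]
    exact lead_mem (quadComb_mem hg L)

lemma mem_sqColon_of_eq {n N d r : ℕ} {g : Fin r → MvPolynomial (Fin 3) ℂ}
    (hg : ∀ i, g i ∈ triIdeal n) {q : MvPolynomial (Fin 3) ℂ}
    (L : List (Fin r × Fin r × MvPolynomial (Fin 3) ℂ))
    (h : X 2 ^ (N - d) * q = quadComb g L) : q ∈ sqColon n N d := by
  rw [mem_sqColon, h]
  exact quadComb_mem hg L

lemma mem_sqColon_of_natCast_mul {n N d : ℕ} {q : MvPolynomial (Fin 3) ℂ} (c : ℕ) (hc : c ≠ 0)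
    (h : (c : MvPolynomial (Fin 3) ℂ) * q ∈ sqColon n N d) : q ∈ sqColon n N d := by
  have hC : C (c : ℂ)⁻¹ * (c : MvPolynomial (Fin 3) ℂ) = 1 := by
    rw [← map_natCast C, ← C_mul, inv_mul_cancel₀ (Nat.cast_ne_zero.mpr hc), C_1]
  rw [← one_mul q, ← hC, mul_assoc]
  exact Ideal.mul_mem_left _ _ h

local notation "𝐮" => (X 0 : MvPolynomial (Fin 3) ℂ)
local notation "𝐯" => (X 1 : MvPolynomial (Fin 3) ℂ)
local notation "𝐰" => (X 2 : MvPolynomial (Fin 3) ℂ)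

set_option linter.unusedSimpArgs false

/-- Generators of the ideal of the triple points of `B_4`. -/
noncomputable def gens4 : Fin 2 → MvPolynomial (Fin 3) ℂ :=
  ![𝐮 - 𝐰,
    𝐯 - 𝐰]

lemma gens4_mem (i : Fin 2) : gens4 i ∈ triIdeal 4 := by
  refine mem_triIdeal fun u v h => ?_
  have h0 := h 1 0 rfl
  have h1 := h 0 1 rfl
  simp only [complSymm] at h0 h1
  fin_cases i <;> simp only [gens4, Fin.reduceFinMk, Fin.zero_eta, Fin.mk_one, Matrix.cons_val,
    map_add, map_sub, map_mul, map_pow, map_ofNat, aeval_X]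
  · linear_combination 𝐰 * h1
  · linear_combination 𝐰 * (-h0)

theorem containment_four :
    (⨅ P ∈ tripleSet 4, (mP P) ^ 3) ≤ (⨅ P ∈ tripleSet 4, mP P) ^ 2 := by
  refine containment_of_certificates (N := 0) (M := 2) (E := ∅) [0] (by decide +kernel)
    (by decide) (by decide +kernel) (by decide) gens4_mem ?_ ?_
  · intro k hk
    refine ⟨[
        [(1, 1, 1)],
        [(0, 1, 1)],
        [(0, 0, 1)]].getD k [], ?_⟩
    interval_cases k <;> simp only [List.getD_cons_zero, List.getD_cons_succ, quadComb_cons,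
      quadComb_nil, gens4, mon, Matrix.cons_val, lead_X_zero, lead_X_one, lead_X_two, map_add,
      map_sub, map_mul, map_pow, map_neg, map_one, map_zero, map_ofNat] <;> ring
  · simp

/-- Generators of the ideal of the triple points of `B_5`. -/
noncomputable def gens5 : Fin 2 → MvPolynomial (Fin 3) ℂ :=
  ![𝐮 - 𝐯,
    𝐮 ^ 2 - 𝐯 * 𝐰 - 𝐰 ^ 2]

lemma gens5_mem (i : Fin 2) : gens5 i ∈ triIdeal 5 := by
  refine mem_triIdeal fun u v h => ?_
  have h1 := h 1 1 rfl
  have h2 := h 0 2 rfl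
  simp only [complSymm] at h1 h2
  fin_cases i <;> simp only [gens5, Fin.reduceFinMk, Fin.zero_eta, Fin.mk_one, Matrix.cons_val,
    map_add, map_sub, map_mul, map_pow, map_ofNat, aeval_X]
  · linear_combination 𝐰 * h1
  · linear_combination 𝐰 ^ 2 * h2

theorem containment_five :
    (⨅ P ∈ tripleSet 5, (mP P) ^ 3) ≤ (⨅ P ∈ tripleSet 5, mP P) ^ 2 := by
  refine containment_of_certificates (N := 0) (M := 4) (E := {(2, 0), (3, 0), (2, 1), (1, 2)})
    [0] (by decide +kernel) (by decide) (by decide +kernel) (by decide) gens5_mem ?_ ?_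
  · intro k hk
    refine ⟨[
        [(0, 0, 3 * 𝐮 ^ 2 + 2 * 𝐮 * 𝐯 + 𝐯 ^ 2), (0, 1, -4 * 𝐮), (1, 1, 1)],
        [(0, 0, 2 * 𝐮 ^ 2 + 𝐮 * 𝐯), (0, 1, -3 * 𝐮), (1, 1, 1)],
        [(0, 0, 𝐮 ^ 2), (0, 1, -2 * 𝐮), (1, 1, 1)],
        [(0, 1, -𝐮), (1, 1, 1)],
        [(1, 1, 1)]].getD k [], ?_⟩
    interval_cases k <;> simp only [List.getD_cons_zero, List.getD_cons_succ, quadComb_cons,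
      quadComb_nil, gens5, mon, Matrix.cons_val, lead_X_zero, lead_X_one, lead_X_two, map_add,
      map_sub, map_mul, map_pow, map_neg, map_one, map_zero, map_ofNat] <;> ring
  · simp only [Finset.forall_mem_insert, Finset.mem_singleton, forall_eq]
    refine ⟨⟨[(2, 1, 1), (-1, 0, 2)], by decide, [(0, 0, 1)], 0, zero_mem _, ?_⟩,
      ⟨[(1, 0, 3)], by decide, [(0, 0, -2 * 𝐮 - 𝐯), (0, 1, 3)], 0, zero_mem _, ?_⟩,
      ⟨[(1, 0, 3)], by decide, [(0, 0, -2 * 𝐮 - 𝐯), (0, 1, 2)], 0, zero_mem _, ?_⟩,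
      ⟨[(1, 0, 3)], by decide, [(0, 0, -𝐮 - 𝐯), (0, 1, 1)], 0, zero_mem _, ?_⟩⟩
    all_goals
      simp only [quadComb_cons, quadComb_nil, gens5, mon, binForm_cons, binForm_nil, Int.cast_ofNat,
        Int.cast_neg, Int.cast_one, Matrix.cons_val, lead_X_zero, lead_X_one, lead_X_two, map_add,
        map_sub, map_mul, map_pow, map_neg, map_one, map_zero, map_ofNat]
      ring

/-- Generators of the ideal of the triple points of `B_6`. -/
noncomputable def gens6 : Fin 2 → MvPolynomial (Fin 3) ℂ :=
  ![𝐮 ^ 2 - 2 * 𝐯 * 𝐰,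
    𝐯 ^ 2 - 2 * 𝐮 * 𝐰]

lemma gens6_mem (i : Fin 2) : gens6 i ∈ triIdeal 6 := by
  refine mem_triIdeal fun u v h => ?_
  have h1 := h 2 1 rfl
  have h2 := h 1 2 rfl
  simp only [complSymm] at h1 h2
  fin_cases i <;> simp only [gens6, Fin.reduceFinMk, Fin.zero_eta, Fin.mk_one, Matrix.cons_val,
    map_add, map_sub, map_mul, map_pow, map_ofNat, aeval_X]
  · linear_combination 𝐰 ^ 2 * h2
  · linear_combination 𝐰 ^ 2 * (-h1)

theorem containment_six :
    (⨅ P ∈ tripleSet 6, (mP P) ^ 3) ≤ (⨅ P ∈ tripleSet 6, mP P) ^ 2 := by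
  refine containment_of_certificates (N := 0) (M := 5) (E := {(4, 0), (2, 2), (0, 4)}) [0]
    (by decide +kernel) (by decide) (by decide +kernel) (by decide) gens6_mem ?_ ?_
  · intro k hk
    refine ⟨[
        [(1, 1, 𝐯)],
        [(1, 1, 𝐮)],
        [(0, 1, 𝐯)],
        [(0, 1, 𝐮)],
        [(0, 0, 𝐯)],
        [(0, 0, 𝐮)]].getD k [], ?_⟩
    interval_cases k <;> simp only [List.getD_cons_zero, List.getD_cons_succ, quadComb_cons,
      quadComb_nil, gens6, mon, Matrix.cons_val, lead_X_zero, lead_X_one, lead_X_two, map_add,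
      map_sub, map_mul, map_pow, map_neg, map_one, map_zero, map_ofNat] <;> ring
  · simp only [Finset.forall_mem_insert, Finset.mem_singleton, forall_eq]
    refine ⟨⟨[], by decide, [(0, 0, 1)], 0, zero_mem _, ?_⟩,
      ⟨[], by decide, [(0, 1, 1)], 0, zero_mem _, ?_⟩,
      ⟨[], by decide, [(1, 1, 1)], 0, zero_mem _, ?_⟩⟩
    all_goals
      simp only [quadComb_cons, quadComb_nil, gens6, mon, binForm_cons, binForm_nil, Int.cast_ofNat,
        Int.cast_neg, Int.cast_one, Matrix.cons_val, lead_X_zero, lead_X_one, lead_X_two, map_add,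
        map_sub, map_mul, map_pow, map_neg, map_one, map_zero, map_ofNat]
      ring

/-- Generators of the ideal of the triple points of `B_7`. -/
noncomputable def gens7 : Fin 3 → MvPolynomial (Fin 3) ℂ :=
  ![𝐮 ^ 2 - 𝐯 ^ 2 + 𝐮 * 𝐰 - 𝐯 * 𝐰,
    𝐮 ^ 3 - 2 * 𝐮 * 𝐯 * 𝐰 - 𝐯 * 𝐰 ^ 2 + 𝐰 ^ 3,
    𝐯 ^ 3 - 2 * 𝐮 * 𝐯 * 𝐰 - 𝐮 * 𝐰 ^ 2 + 𝐰 ^ 3]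

lemma gens7_mem (i : Fin 3) : gens7 i ∈ triIdeal 7 := by
  refine mem_triIdeal fun u v h => ?_
  have h1 := h 3 1 rfl
  have h2 := h 2 2 rfl
  have h3 := h 1 3 rfl
  simp only [complSymm] at h1 h2 h3
  fin_cases i <;> simp only [gens7, Fin.reduceFinMk, Fin.zero_eta, Fin.mk_one, Matrix.cons_val,
    map_add, map_sub, map_mul, map_pow, map_ofNat, aeval_X]
  · linear_combination 𝐰 ^ 2 * h2
  · linear_combination 𝐰 ^ 3 * h3
  · linear_combination 𝐰 ^ 3 * (-h1)

/-- A form of degree `5` in the saturation of the square of the ideal of the triple points of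
`B_7`. -/
noncomputable def sat7_5 : MvPolynomial (Fin 3) ℂ :=
  𝐮 * 𝐯 ^ 4 - 𝐯 ^ 5 + 𝐮 ^ 4 * 𝐰 - 𝐮 ^ 3 * 𝐯 * 𝐰 - 𝐮 ^ 2 * 𝐯 ^ 2 * 𝐰 + 3 * 𝐮 * 𝐯 ^ 3 * 𝐰
  - 2 * 𝐯 ^ 4 * 𝐰 - 2 * 𝐮 ^ 3 * 𝐰 ^ 2 - 6 * 𝐮 ^ 2 * 𝐯 * 𝐰 ^ 2 + 9 * 𝐮 * 𝐯 ^ 2 * 𝐰 ^ 2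
  - 𝐯 ^ 3 * 𝐰 ^ 2 - 3 * 𝐮 ^ 2 * 𝐰 ^ 3 + 3 * 𝐮 * 𝐯 * 𝐰 ^ 3 + 4 * 𝐮 * 𝐰 ^ 4 - 4 * 𝐯 * 𝐰 ^ 4

lemma sat7_5_mem : sat7_5 ∈ sqColon 7 6 5 := by
  refine mem_sqColon_of_eq gens7_mem
    [(0, 0, 𝐮 ^ 2), (0, 1, -2 * 𝐮), (0, 2, -𝐯 + 2 * 𝐰), (1, 1, 1), (2, 2, -1)] ?_
  simp only [quadComb_cons, quadComb_nil, gens7, sat7_5, Matrix.cons_val]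
  ring

theorem containment_seven :
    (⨅ P ∈ tripleSet 7, (mP P) ^ 3) ≤ (⨅ P ∈ tripleSet 7, mP P) ^ 2 := by
  refine containment_of_certificates (N := 6) (M := 6) (E := {(4, 0), (5, 0), (4, 1), (3, 2),
    (2, 3), (1, 4)}) [0, 0, 1, 2, 3, 1] (by decide +kernel) (by decide) (by decide +kernel)
    (by decide) gens7_mem ?_ ?_
  · intro k hk
    refine ⟨[
        [(2, 2, 1)],
        [(0, 2, -𝐮), (1, 2, 1)],
        [(0, 2, 𝐯), (2, 2, 1)],
        [(1, 2, 1)],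
        [(0, 1, -𝐮), (1, 1, 1)],
        [(0, 1, 𝐯), (1, 2, 1)],
        [(1, 1, 1)]].getD k [], ?_⟩
    interval_cases k <;> simp only [List.getD_cons_zero, List.getD_cons_succ, quadComb_cons,
      quadComb_nil, gens7, mon, Matrix.cons_val, lead_X_zero, lead_X_one, lead_X_two, map_add,
      map_sub, map_mul, map_pow, map_neg, map_one, map_zero, map_ofNat] <;> ring
  · simp only [Finset.forall_mem_insert, Finset.mem_singleton, forall_eq]
    refine ⟨⟨[(2, 2, 2), (-1, 0, 4)], by decide, [(0, 0, 1)], 0, zero_mem _, ?_⟩,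
      ⟨[(1, 0, 5)], by decide, [(0, 0, -𝐮), (0, 1, 2)], sat7_5, sat7_5_mem, ?_⟩,
      ⟨[(1, 0, 5)], by decide, [(0, 0, 𝐯), (0, 2, 2)], 0, zero_mem _, ?_⟩,
      ⟨[(1, 0, 5)], by decide, [(0, 0, -𝐮), (0, 1, 1)], sat7_5, sat7_5_mem, ?_⟩,
      ⟨[(1, 0, 5)], by decide, [(0, 2, 1)], 0, zero_mem _, ?_⟩,
      ⟨[(1, 0, 5)], by decide, [], sat7_5, sat7_5_mem, ?_⟩⟩
    all_goals
      simp only [quadComb_cons, quadComb_nil, gens7, sat7_5, mon, binForm_cons, binForm_nil,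
        Int.cast_ofNat, Int.cast_neg, Int.cast_one, Matrix.cons_val, lead_X_zero, lead_X_one,
        lead_X_two, map_add, map_sub, map_mul, map_pow, map_neg, map_one, map_zero, map_ofNat]
      ring

/-- Generators of the ideal of the triple points of `B_8`. -/
noncomputable def gens8 : Fin 3 → MvPolynomial (Fin 3) ℂ :=
  ![𝐮 ^ 3 - 2 * 𝐮 * 𝐯 * 𝐰 - 𝐯 ^ 2 * 𝐰 + 𝐮 * 𝐰 ^ 2 + 𝐰 ^ 3,
    𝐯 ^ 3 - 𝐮 ^ 2 * 𝐰 - 2 * 𝐮 * 𝐯 * 𝐰 + 𝐯 * 𝐰 ^ 2 + 𝐰 ^ 3,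
    𝐮 ^ 2 * 𝐯 - 𝐮 * 𝐯 ^ 2 + 𝐮 ^ 2 * 𝐰 - 𝐯 ^ 2 * 𝐰 - 𝐮 * 𝐰 ^ 2 + 𝐯 * 𝐰 ^ 2]

lemma gens8_mem (i : Fin 3) : gens8 i ∈ triIdeal 8 := by
  refine mem_triIdeal fun u v h => ?_
  have h2 := h 3 2 rfl
  have h3 := h 2 3 rfl
  have h4 := h 1 4 rfl
  simp only [complSymm] at h2 h3 h4
  fin_cases i <;> simp only [gens8, Fin.reduceFinMk, Fin.zero_eta, Fin.mk_one, Matrix.cons_val,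
    map_add, map_sub, map_mul, map_pow, map_ofNat, aeval_X]
  · linear_combination 𝐰 ^ 3 * h3
  · linear_combination 𝐰 ^ 3 * (-h2)
  · linear_combination 𝐰 ^ 3 * (u * h3 - h4)

/-- A form of degree `6` in the saturation of the square of the ideal of the triple points of
`B_8`. -/
noncomputable def sat8_6 : MvPolynomial (Fin 3) ℂ :=
  𝐮 ^ 2 * 𝐯 ^ 4 - 2 * 𝐮 ^ 5 * 𝐰 - 2 * 𝐮 ^ 3 * 𝐯 ^ 2 * 𝐰 - 2 * 𝐮 * 𝐯 ^ 4 * 𝐰 + 𝐮 ^ 4 * 𝐰 ^ 2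
  + 8 * 𝐮 ^ 3 * 𝐯 * 𝐰 ^ 2 + 6 * 𝐮 ^ 2 * 𝐯 ^ 2 * 𝐰 ^ 2 - 4 * 𝐮 * 𝐯 ^ 3 * 𝐰 ^ 2 - 2 * 𝐮 ^ 3 * 𝐰 ^ 3
  + 4 * 𝐮 ^ 2 * 𝐯 * 𝐰 ^ 3 - 6 * 𝐮 * 𝐯 ^ 2 * 𝐰 ^ 3 - 5 * 𝐮 ^ 2 * 𝐰 ^ 4 - 4 * 𝐮 * 𝐯 * 𝐰 ^ 4
  + 4 * 𝐯 ^ 2 * 𝐰 ^ 4 - 2 * 𝐮 * 𝐰 ^ 5 + 4 * 𝐯 * 𝐰 ^ 5 + 𝐰 ^ 6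

lemma sat8_6_mem : sat8_6 ∈ sqColon 8 7 6 := by
  refine mem_sqColon_of_eq gens8_mem
    [(0, 0, -𝐰), (0, 1, -𝐮 + 𝐯 + 𝐰), (0, 2, 𝐯), (1, 1, 𝐰), (2, 2, -𝐮)] ?_
  simp only [quadComb_cons, quadComb_nil, gens8, sat8_6, Matrix.cons_val]
  ring

theorem containment_eight :
    (⨅ P ∈ tripleSet 8, (mP P) ^ 3) ≤ (⨅ P ∈ tripleSet 8, mP P) ^ 2 := by
  refine containment_of_certificates (N := 7) (M := 7) (E := {(6, 0), (5, 1), (4, 2), (3, 3),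
    (2, 4), (1, 5), (0, 6)}) [0, 0, 1, 1, 3, 2, 3] (by decide +kernel) (by decide)
    (by decide +kernel) (by decide) gens8_mem ?_ ?_
  · intro k hk
    refine ⟨[
        [(1, 1, 𝐯)],
        [(1, 1, 𝐮)],
        [(0, 1, 𝐯), (1, 2, -𝐮)],
        [(0, 1, 𝐯)],
        [(0, 1, 𝐮)],
        [(0, 0, 𝐯), (0, 2, -𝐮)],
        [(0, 0, 𝐯)],
        [(0, 0, 𝐮)]].getD k [], ?_⟩
    interval_cases k <;> simp only [List.getD_cons_zero, List.getD_cons_succ, quadComb_cons,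
      quadComb_nil, gens8, mon, Matrix.cons_val, lead_X_zero, lead_X_one, lead_X_two, map_add,
      map_sub, map_mul, map_pow, map_neg, map_one, map_zero, map_ofNat] <;> ring
  · simp only [Finset.forall_mem_insert, Finset.mem_singleton, forall_eq]
    refine ⟨⟨[], by decide, [(0, 0, 1)], 0, zero_mem _, ?_⟩,
      ⟨[], by decide, [(0, 1, 2), (0, 2, 1), (2, 2, 1)], -sat8_6, neg_mem sat8_6_mem, ?_⟩,
      ⟨[], by decide, [(0, 1, 2), (2, 2, 1)], -sat8_6, neg_mem sat8_6_mem, ?_⟩,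
      ⟨[], by decide, [(0, 1, 1)], 0, zero_mem _, ?_⟩,
      ⟨[], by decide, [], sat8_6, sat8_6_mem, ?_⟩,
      ⟨[], by decide, [(1, 2, -1)], sat8_6, sat8_6_mem, ?_⟩,
      ⟨[], by decide, [(1, 1, 1)], 0, zero_mem _, ?_⟩⟩
    all_goals
      simp only [quadComb_cons, quadComb_nil, gens8, sat8_6, mon, binForm_cons, binForm_nil,
        Int.cast_ofNat, Int.cast_neg, Int.cast_one, Matrix.cons_val, lead_X_zero, lead_X_one,
        lead_X_two, map_add, map_sub, map_mul, map_pow, map_neg, map_one, map_zero, map_ofNat]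
      ring

/-- Generators of the ideal of the triple points of `B_9`. -/
noncomputable def gens9 : Fin 3 → MvPolynomial (Fin 3) ℂ :=
  ![𝐮 ^ 3 - 𝐯 ^ 3,
    𝐮 ^ 4 - 3 * 𝐮 ^ 2 * 𝐯 * 𝐰 + 3 * 𝐮 * 𝐰 ^ 3,
    𝐯 ^ 4 - 3 * 𝐮 * 𝐯 ^ 2 * 𝐰 + 3 * 𝐯 * 𝐰 ^ 3]

lemma gens9_mem (i : Fin 3) : gens9 i ∈ triIdeal 9 := by
  refine mem_triIdeal fun u v h => ?_
  have h2 := h 4 2 rfl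
  have h3 := h 3 3 rfl
  have h4 := h 2 4 rfl
  simp only [complSymm] at h2 h3 h4
  fin_cases i <;> simp only [gens9, Fin.reduceFinMk, Fin.zero_eta, Fin.mk_one, Matrix.cons_val,
    map_add, map_sub, map_mul, map_pow, map_ofNat, aeval_X]
  · linear_combination 𝐰 ^ 3 * h3
  · linear_combination 𝐰 ^ 4 * h4
  · linear_combination 𝐰 ^ 4 * (-h2)

/-- A form of degree `6` in the saturation of the square of the ideal of the triple points of
`B_9`. -/
noncomputable def sat9_6 : MvPolynomial (Fin 3) ℂ :=
  𝐮 ^ 3 * 𝐯 ^ 3 - 𝐯 ^ 6 - 3 * 𝐮 ^ 4 * 𝐯 * 𝐰 + 3 * 𝐮 * 𝐯 ^ 4 * 𝐰 + 3 * 𝐮 ^ 3 * 𝐰 ^ 3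
  - 3 * 𝐯 ^ 3 * 𝐰 ^ 3

lemma sat9_6_mem : sat9_6 ∈ sqColon 9 9 6 := by
  refine mem_sqColon_of_natCast_mul 3 (by norm_num) <| mem_sqColon_of_eq gens9_mem
    [(0, 0, 𝐮 ^ 3), (0, 1, -2 * 𝐮 ^ 2), (0, 2, -𝐯 ^ 2 + 3 * 𝐮 * 𝐰), (1, 1, 𝐮), (2, 2, -𝐯)] ?_
  simp only [quadComb_cons, quadComb_nil, gens9, sat9_6, Matrix.cons_val]
  ring

theorem containment_nine :
    (⨅ P ∈ tripleSet 9, (mP P) ^ 3) ≤ (⨅ P ∈ tripleSet 9, mP P) ^ 2 := by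
  refine containment_of_certificates (N := 9) (M := 8) (E := {(6, 0), (3, 3), (7, 0), (6, 1),
    (4, 3), (3, 4)}) [0, 0, 1, 2, 3, 3, 4, 4, 1] (by decide +kernel) (by decide)
    (by decide +kernel) (by decide) gens9_mem ?_ ?_
  · intro k hk
    refine ⟨[
        [(2, 2, 1)],
        [(0, 2, -𝐮), (1, 2, 1)],
        [(0, 0, 𝐮 ^ 2), (0, 1, -2 * 𝐮), (1, 1, 1)],
        [(0, 2, 𝐯), (2, 2, 1)],
        [(1, 2, 1)],
        [(0, 1, -𝐮), (1, 1, 1)],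
        [(0, 0, 𝐯 ^ 2), (0, 2, 2 * 𝐯), (2, 2, 1)],
        [(0, 1, 𝐯), (1, 2, 1)],
        [(1, 1, 1)]].getD k [], ?_⟩
    interval_cases k <;> simp only [List.getD_cons_zero, List.getD_cons_succ, quadComb_cons,
      quadComb_nil, gens9, mon, Matrix.cons_val, lead_X_zero, lead_X_one, lead_X_two, map_add,
      map_sub, map_mul, map_pow, map_neg, map_one, map_zero, map_ofNat] <;> ring
  · simp only [Finset.forall_mem_insert, Finset.mem_singleton, forall_eq]
    refine ⟨⟨[(1, 0, 6)], by decide, [(0, 0, 1)], 2 * sat9_6, Ideal.mul_mem_left _ _ sat9_6_mem,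
        ?_⟩,
      ⟨[(1, 0, 6)], by decide, [], sat9_6, sat9_6_mem, ?_⟩,
      ⟨[(1, 1, 6)], by decide, [(0, 0, -𝐮), (0, 1, 2)], 0, zero_mem _, ?_⟩,
      ⟨[(1, 0, 7)], by decide, [(0, 0, 𝐯), (0, 2, 2)], 0, zero_mem _, ?_⟩,
      ⟨[(1, 1, 6)], by decide, [(0, 0, -𝐮), (0, 1, 1)], 0, zero_mem _, ?_⟩,
      ⟨[(1, 0, 7)], by decide, [(0, 2, 1)], 0, zero_mem _, ?_⟩⟩
    all_goals
      simp only [quadComb_cons, quadComb_nil, gens9, sat9_6, mon, binForm_cons, binForm_nil,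
        Int.cast_ofNat, Int.cast_neg, Int.cast_one, Matrix.cons_val, lead_X_zero, lead_X_one,
        lead_X_two, map_add, map_sub, map_mul, map_pow, map_neg, map_one, map_zero, map_ofNat]
      ring

/-- Generators of the ideal of the triple points of `B_10`. -/
noncomputable def gens10 : Fin 3 → MvPolynomial (Fin 3) ℂ :=
  ![𝐮 ^ 4 - 3 * 𝐮 ^ 2 * 𝐯 * 𝐰 - 𝐯 ^ 3 * 𝐰 + 2 * 𝐮 * 𝐯 * 𝐰 ^ 2 + 𝐯 ^ 2 * 𝐰 ^ 2 + 2 * 𝐮 * 𝐰 ^ 3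
      - 𝐰 ^ 4,
    𝐯 ^ 4 - 𝐮 ^ 3 * 𝐰 - 3 * 𝐮 * 𝐯 ^ 2 * 𝐰 + 𝐮 ^ 2 * 𝐰 ^ 2 + 2 * 𝐮 * 𝐯 * 𝐰 ^ 2 + 2 * 𝐯 * 𝐰 ^ 3
      - 𝐰 ^ 4,
    𝐮 ^ 3 * 𝐯 - 𝐮 * 𝐯 ^ 3 + 2 * 𝐮 ^ 2 * 𝐯 * 𝐰 - 2 * 𝐮 * 𝐯 ^ 2 * 𝐰 - 𝐮 ^ 2 * 𝐰 ^ 2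
      + 𝐯 ^ 2 * 𝐰 ^ 2 - 2 * 𝐮 * 𝐰 ^ 3 + 2 * 𝐯 * 𝐰 ^ 3]

lemma gens10_mem (i : Fin 3) : gens10 i ∈ triIdeal 10 := by
  refine mem_triIdeal fun u v h => ?_
  have h3 := h 4 3 rfl
  have h4 := h 3 4 rfl
  have h5 := h 2 5 rfl
  simp only [complSymm] at h3 h4 h5
  fin_cases i <;> simp only [gens10, Fin.reduceFinMk, Fin.zero_eta, Fin.mk_one, Matrix.cons_val,
    map_add, map_sub, map_mul, map_pow, map_ofNat, aeval_X]
  · linear_combination 𝐰 ^ 4 * h4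
  · linear_combination 𝐰 ^ 4 * (-h3)
  · linear_combination 𝐰 ^ 4 * (u * h4 - h5)

/-- A form of degree `7` in the saturation of the square of the ideal of the triple points of
`B_10`. -/
noncomputable def sat10_7 : MvPolynomial (Fin 3) ℂ :=
  𝐮 ^ 7 - 2 * 𝐮 ^ 6 * 𝐯 + 𝐮 ^ 5 * 𝐯 ^ 2 + 𝐮 ^ 2 * 𝐯 ^ 5 - 2 * 𝐮 * 𝐯 ^ 6 + 𝐯 ^ 7
  - 5 * 𝐮 ^ 5 * 𝐯 * 𝐰 + 10 * 𝐮 ^ 4 * 𝐯 ^ 2 * 𝐰 - 10 * 𝐮 ^ 3 * 𝐯 ^ 3 * 𝐰 + 10 * 𝐮 ^ 2 * 𝐯 ^ 4 * 𝐰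
  - 5 * 𝐮 * 𝐯 ^ 5 * 𝐰 + 5 * 𝐮 ^ 4 * 𝐯 * 𝐰 ^ 2 - 5 * 𝐮 ^ 3 * 𝐯 ^ 2 * 𝐰 ^ 2
  - 5 * 𝐮 ^ 2 * 𝐯 ^ 3 * 𝐰 ^ 2 + 5 * 𝐮 * 𝐯 ^ 4 * 𝐰 ^ 2 + 5 * 𝐮 ^ 4 * 𝐰 ^ 3 - 10 * 𝐮 ^ 3 * 𝐯 * 𝐰 ^ 3
  + 10 * 𝐮 ^ 2 * 𝐯 ^ 2 * 𝐰 ^ 3 - 10 * 𝐮 * 𝐯 ^ 3 * 𝐰 ^ 3 + 5 * 𝐯 ^ 4 * 𝐰 ^ 3 - 5 * 𝐮 ^ 3 * 𝐰 ^ 4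
  + 5 * 𝐮 ^ 2 * 𝐯 * 𝐰 ^ 4 + 5 * 𝐮 * 𝐯 ^ 2 * 𝐰 ^ 4 - 5 * 𝐯 ^ 3 * 𝐰 ^ 4 + 2 * 𝐮 ^ 2 * 𝐰 ^ 5
  - 4 * 𝐮 * 𝐯 * 𝐰 ^ 5 + 2 * 𝐯 ^ 2 * 𝐰 ^ 5

lemma sat10_7_mem : sat10_7 ∈ sqColon 10 10 7 := by
  refine mem_sqColon_of_eq gens10_mem
    [(0, 0, -𝐯 * 𝐰 + 𝐰 ^ 2), (0, 1, 𝐮 * 𝐰 + 𝐯 * 𝐰 - 2 * 𝐰 ^ 2), (0, 2, 𝐯 ^ 2), (1, 1, -𝐮 * 𝐰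
    + 𝐰 ^ 2), (1, 2, -𝐮 ^ 2), (2, 2, -𝐮 * 𝐯)] ?_
  simp only [quadComb_cons, quadComb_nil, gens10, sat10_7, Matrix.cons_val]
  ring

/-- A form of degree `8` in the saturation of the square of the ideal of the triple points of
`B_10`. -/
noncomputable def sat10_8 : MvPolynomial (Fin 3) ℂ :=
  𝐮 ^ 2 * 𝐯 ^ 6 - 2 * 𝐮 ^ 7 * 𝐰 - 4 * 𝐮 ^ 3 * 𝐯 ^ 4 * 𝐰 - 2 * 𝐮 ^ 2 * 𝐯 ^ 5 * 𝐰
  + 12 * 𝐮 ^ 5 * 𝐯 * 𝐰 ^ 2 + 4 * 𝐮 ^ 4 * 𝐯 ^ 2 * 𝐰 ^ 2 + 8 * 𝐮 ^ 3 * 𝐯 ^ 3 * 𝐰 ^ 2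
  - 4 * 𝐮 * 𝐯 ^ 5 * 𝐰 ^ 2 + 2 * 𝐯 ^ 6 * 𝐰 ^ 2 - 6 * 𝐮 ^ 4 * 𝐯 * 𝐰 ^ 3 - 20 * 𝐮 ^ 3 * 𝐯 ^ 2 * 𝐰 ^ 3
  + 14 * 𝐮 ^ 2 * 𝐯 ^ 3 * 𝐰 ^ 3 - 8 * 𝐮 * 𝐯 ^ 4 * 𝐰 ^ 3 - 9 * 𝐮 ^ 4 * 𝐰 ^ 4
  - 12 * 𝐮 ^ 3 * 𝐯 * 𝐰 ^ 4 + 8 * 𝐮 * 𝐯 ^ 3 * 𝐰 ^ 4 + 4 * 𝐯 ^ 4 * 𝐰 ^ 4 + 4 * 𝐮 ^ 3 * 𝐰 ^ 5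
  + 22 * 𝐮 ^ 2 * 𝐯 * 𝐰 ^ 5 - 12 * 𝐮 * 𝐯 ^ 2 * 𝐰 ^ 5 + 6 * 𝐯 ^ 3 * 𝐰 ^ 5 + 7 * 𝐮 ^ 2 * 𝐰 ^ 6
  - 4 * 𝐮 * 𝐯 * 𝐰 ^ 6 - 5 * 𝐯 ^ 2 * 𝐰 ^ 6 - 6 * 𝐮 * 𝐰 ^ 7 + 2 * 𝐯 * 𝐰 ^ 7 + 𝐰 ^ 8

lemma sat10_8_mem : sat10_8 ∈ sqColon 10 10 8 := by
  refine mem_sqColon_of_eq gens10_mem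
    [(0, 0, -𝐯 ^ 2 - 𝐯 * 𝐰), (0, 1, 𝐯 ^ 2 + 𝐰 ^ 2), (0, 2, 2 * 𝐮 * 𝐯 + 𝐮 * 𝐰 + 𝐯 * 𝐰 - 2 * 𝐰 ^ 2),
    (1, 1, 𝐯 * 𝐰), (2, 2, -𝐮 ^ 2 + 𝐯 * 𝐰)] ?_
  simp only [quadComb_cons, quadComb_nil, gens10, sat10_8, Matrix.cons_val]
  ring

/-- A form of degree `8` in the saturation of the square of the ideal of the triple points of
`B_10`. -/
noncomputable def sat10_8' : MvPolynomial (Fin 3) ℂ :=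
  𝐮 ^ 5 * 𝐯 ^ 3 - 𝐮 * 𝐯 ^ 7 + 2 * 𝐮 ^ 7 * 𝐰 - 3 * 𝐮 ^ 6 * 𝐯 * 𝐰 - 𝐮 ^ 5 * 𝐯 ^ 2 * 𝐰
  + 𝐮 ^ 4 * 𝐯 ^ 3 * 𝐰 - 3 * 𝐮 ^ 3 * 𝐯 ^ 4 * 𝐰 + 7 * 𝐮 ^ 2 * 𝐯 ^ 5 * 𝐰 - 2 * 𝐮 * 𝐯 ^ 6 * 𝐰
  - 𝐯 ^ 7 * 𝐰 + 2 * 𝐮 ^ 6 * 𝐰 ^ 2 - 15 * 𝐮 ^ 5 * 𝐯 * 𝐰 ^ 2 + 9 * 𝐮 ^ 4 * 𝐯 ^ 2 * 𝐰 ^ 2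
  - 12 * 𝐮 ^ 3 * 𝐯 ^ 3 * 𝐰 ^ 2 + 8 * 𝐮 ^ 2 * 𝐯 ^ 4 * 𝐰 ^ 2 + 9 * 𝐮 * 𝐯 ^ 5 * 𝐰 ^ 2 - 𝐯 ^ 6 * 𝐰 ^ 2
  + 2 * 𝐮 ^ 5 * 𝐰 ^ 3 + 𝐮 ^ 4 * 𝐯 * 𝐰 ^ 3 + 15 * 𝐮 ^ 3 * 𝐯 ^ 2 * 𝐰 ^ 3
  - 18 * 𝐮 ^ 2 * 𝐯 ^ 3 * 𝐰 ^ 3 - 𝐮 * 𝐯 ^ 4 * 𝐰 ^ 3 + 𝐯 ^ 5 * 𝐰 ^ 3 + 13 * 𝐮 ^ 4 * 𝐰 ^ 4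
  - 2 * 𝐮 ^ 3 * 𝐯 * 𝐰 ^ 4 + 16 * 𝐮 ^ 2 * 𝐯 ^ 2 * 𝐰 ^ 4 - 20 * 𝐮 * 𝐯 ^ 3 * 𝐰 ^ 4
  - 7 * 𝐯 ^ 4 * 𝐰 ^ 4 - 𝐮 ^ 3 * 𝐰 ^ 5 - 16 * 𝐮 ^ 2 * 𝐯 * 𝐰 ^ 5 + 21 * 𝐮 * 𝐯 ^ 2 * 𝐰 ^ 5
  - 4 * 𝐯 ^ 3 * 𝐰 ^ 5 - 4 * 𝐮 ^ 2 * 𝐰 ^ 6 - 6 * 𝐮 * 𝐯 * 𝐰 ^ 6 + 10 * 𝐯 ^ 2 * 𝐰 ^ 6 + 4 * 𝐮 * 𝐰 ^ 7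
  - 4 * 𝐯 * 𝐰 ^ 7

lemma sat10_8'_mem : sat10_8' ∈ sqColon 10 10 8 := by
  refine mem_sqColon_of_eq gens10_mem
    [(0, 0, 𝐮 * 𝐰 + 𝐰 ^ 2), (0, 1, 𝐮 ^ 2 - 2 * 𝐯 ^ 2 + 3 * 𝐮 * 𝐰 - 2 * 𝐯 * 𝐰 - 𝐰 ^ 2),
    (0, 2, -𝐯 * 𝐰), (1, 1, 𝐮 ^ 2 - 2 * 𝐯 * 𝐰), (1, 2, 𝐮 * 𝐰 + 𝐰 ^ 2), (2, 2, -𝐯 ^ 2 + 2 * 𝐮 * 𝐰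
    - 𝐰 ^ 2)] ?_
  simp only [quadComb_cons, quadComb_nil, gens10, sat10_8', Matrix.cons_val]
  ring

theorem containment_ten :
    (⨅ P ∈ tripleSet 10, (mP P) ^ 3) ≤ (⨅ P ∈ tripleSet 10, mP P) ^ 2 := by
  refine containment_of_certificates (N := 10) (M := 9) (E := {(7, 0), (8, 0), (7, 1), (6, 2),
    (5, 3), (4, 4), (3, 5), (2, 6), (0, 8)}) [0, 1, 3, 4, 2, 3, 4, 5, 0, 1] (by decide +kernel)
    (by decide) (by decide +kernel) (by decide) gens10_mem ?_ ?_
  · intro k hk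
    refine ⟨[
        [(1, 1, 𝐯)],
        [(1, 1, 𝐮)],
        [(0, 1, 𝐯), (1, 2, -𝐮)],
        [(1, 1, 𝐮), (1, 2, 𝐯)],
        [(0, 1, 𝐯)],
        [(0, 1, 𝐮)],
        [(0, 0, 𝐯), (0, 2, -𝐮)],
        [(0, 1, 𝐮), (0, 2, 𝐯)],
        [(0, 0, 𝐯)],
        [(0, 0, 𝐮)]].getD k [], ?_⟩
    interval_cases k <;> simp only [List.getD_cons_zero, List.getD_cons_succ, quadComb_cons,
      quadComb_nil, gens10, mon, Matrix.cons_val, lead_X_zero, lead_X_one, lead_X_two, map_add,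
      map_sub, map_mul, map_pow, map_neg, map_one, map_zero, map_ofNat] <;> ring
  · simp only [Finset.forall_mem_insert, Finset.mem_singleton, forall_eq]
    refine ⟨⟨[(2, 6, 1), (-1, 5, 2), (-1, 2, 5), (2, 1, 6), (-1, 0, 7)], by decide, [], sat10_7,
        sat10_7_mem, ?_⟩,
      ⟨[], by decide, [(0, 0, 1)], 0, zero_mem _, ?_⟩,
      ⟨[(1, 1, 7)], by decide, [(0, 2, 1)], sat10_8', sat10_8'_mem, ?_⟩,
      ⟨[], by decide, [(0, 1, 2), (2, 2, 1)], -sat10_8, neg_mem sat10_8_mem, ?_⟩,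
      ⟨[(1, 1, 7)], by decide, [], sat10_8', sat10_8'_mem, ?_⟩,
      ⟨[], by decide, [(0, 1, 1)], 0, zero_mem _, ?_⟩,
      ⟨[(1, 1, 7)], by decide, [(1, 2, 1)], 0, zero_mem _, ?_⟩,
      ⟨[], by decide, [], sat10_8, sat10_8_mem, ?_⟩,
      ⟨[], by decide, [(1, 1, 1)], 0, zero_mem _, ?_⟩⟩
    all_goals
      simp only [quadComb_cons, quadComb_nil, gens10, sat10_7, sat10_8', sat10_8, mon, binForm_cons,
        binForm_nil, Int.cast_ofNat, Int.cast_neg, Int.cast_one, Matrix.cons_val, lead_X_zero,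
        lead_X_one, lead_X_two, map_add, map_sub, map_mul, map_pow, map_neg, map_one, map_zero,
        map_ofNat]
      ring

/-- Generators of the ideal of the triple points of `B_11`. -/
noncomputable def gens11 : Fin 6 → MvPolynomial (Fin 3) ℂ :=
  ![𝐮 ^ 4 - 𝐯 ^ 4 - 3 * 𝐮 ^ 2 * 𝐯 * 𝐰 + 3 * 𝐮 * 𝐯 ^ 2 * 𝐰 - 𝐮 ^ 2 * 𝐰 ^ 2 + 𝐯 ^ 2 * 𝐰 ^ 2
      + 2 * 𝐮 * 𝐰 ^ 3 - 2 * 𝐯 * 𝐰 ^ 3,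
    𝐮 ^ 5 - 4 * 𝐮 ^ 3 * 𝐯 * 𝐰 + 3 * 𝐮 * 𝐯 ^ 2 * 𝐰 ^ 2 - 𝐯 ^ 3 * 𝐰 ^ 2 + 3 * 𝐮 ^ 2 * 𝐰 ^ 3
      + 2 * 𝐮 * 𝐯 * 𝐰 ^ 3 - 2 * 𝐯 * 𝐰 ^ 4 - 𝐰 ^ 5,
    𝐯 ^ 5 - 4 * 𝐮 * 𝐯 ^ 3 * 𝐰 - 𝐮 ^ 3 * 𝐰 ^ 2 + 3 * 𝐮 ^ 2 * 𝐯 * 𝐰 ^ 2 + 2 * 𝐮 * 𝐯 * 𝐰 ^ 3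
      + 3 * 𝐯 ^ 2 * 𝐰 ^ 3 - 2 * 𝐮 * 𝐰 ^ 4 - 𝐰 ^ 5,
    𝐮 ^ 3 * 𝐯 ^ 2 - 𝐮 ^ 2 * 𝐯 ^ 3 + 2 * 𝐮 ^ 3 * 𝐯 * 𝐰 - 2 * 𝐮 * 𝐯 ^ 3 * 𝐰
      - 2 * 𝐮 ^ 2 * 𝐯 * 𝐰 ^ 2 + 2 * 𝐮 * 𝐯 ^ 2 * 𝐰 ^ 2 - 3 * 𝐮 ^ 2 * 𝐰 ^ 3 + 3 * 𝐯 ^ 2 * 𝐰 ^ 3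
      + 𝐮 * 𝐰 ^ 4 - 𝐯 * 𝐰 ^ 4,
    𝐮 ^ 4 * 𝐯 - 3 * 𝐮 ^ 2 * 𝐯 ^ 2 * 𝐰 - 𝐮 * 𝐯 ^ 3 * 𝐰 - 𝐮 ^ 3 * 𝐰 ^ 2 + 2 * 𝐮 ^ 2 * 𝐯 * 𝐰 ^ 2
      + 𝐯 ^ 3 * 𝐰 ^ 2 + 4 * 𝐮 * 𝐯 * 𝐰 ^ 3 + 𝐯 ^ 2 * 𝐰 ^ 3 - 2 * 𝐮 * 𝐰 ^ 4 - 𝐰 ^ 5,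
    𝐮 * 𝐯 ^ 4 - 𝐮 ^ 3 * 𝐯 * 𝐰 - 3 * 𝐮 ^ 2 * 𝐯 ^ 2 * 𝐰 + 𝐮 ^ 3 * 𝐰 ^ 2 + 2 * 𝐮 * 𝐯 ^ 2 * 𝐰 ^ 2
      - 𝐯 ^ 3 * 𝐰 ^ 2 + 𝐮 ^ 2 * 𝐰 ^ 3 + 4 * 𝐮 * 𝐯 * 𝐰 ^ 3 - 2 * 𝐯 * 𝐰 ^ 4 - 𝐰 ^ 5]

lemma gens11_mem (i : Fin 6) : gens11 i ∈ triIdeal 11 := by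
  refine mem_triIdeal fun u v h => ?_
  have h3 := h 5 3 rfl
  have h4 := h 4 4 rfl
  have h5 := h 3 5 rfl
  have h6 := h 2 6 rfl
  simp only [complSymm] at h3 h4 h5 h6
  fin_cases i <;> simp only [gens11, Fin.reduceFinMk, Fin.zero_eta, Fin.mk_one, Matrix.cons_val,
    map_add, map_sub, map_mul, map_pow, map_ofNat, aeval_X]
  · linear_combination 𝐰 ^ 4 * h4
  · linear_combination 𝐰 ^ 5 * h5
  · linear_combination 𝐰 ^ 5 * (-h3)
  · linear_combination 𝐰 ^ 5 * (-u * h3 + (u * v + 1) * h4 - v * h5)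
  · linear_combination 𝐰 ^ 5 * (u * h5 - h6)
  · linear_combination 𝐰 ^ 5 * (-u * h4 + h5)

/-- A form of degree `8` in the saturation of the square of the ideal of the triple points of
`B_11`. -/
noncomputable def sat11_8 : MvPolynomial (Fin 3) ℂ :=
  2 * 𝐮 ^ 7 * 𝐯 - 𝐮 ^ 6 * 𝐯 ^ 2 + 𝐮 ^ 5 * 𝐯 ^ 3 + 3 * 𝐮 ^ 4 * 𝐯 ^ 4 - 𝐮 ^ 3 * 𝐯 ^ 5
  + 𝐮 ^ 2 * 𝐯 ^ 6 - 2 * 𝐮 * 𝐯 ^ 7 - 3 * 𝐯 ^ 8 + 2 * 𝐮 ^ 7 * 𝐰 - 5 * 𝐮 ^ 6 * 𝐯 * 𝐰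
  - 22 * 𝐮 ^ 5 * 𝐯 ^ 2 * 𝐰 + 7 * 𝐮 ^ 4 * 𝐯 ^ 3 * 𝐰 - 7 * 𝐮 ^ 3 * 𝐯 ^ 4 * 𝐰 + 4 * 𝐮 ^ 2 * 𝐯 ^ 5 * 𝐰
  + 23 * 𝐮 * 𝐯 ^ 6 * 𝐰 - 2 * 𝐯 ^ 7 * 𝐰 + 3 * 𝐮 ^ 6 * 𝐰 ^ 2 - 11 * 𝐮 ^ 5 * 𝐯 * 𝐰 ^ 2
  + 22 * 𝐮 ^ 4 * 𝐯 ^ 2 * 𝐰 ^ 2 + 27 * 𝐮 ^ 3 * 𝐯 ^ 3 * 𝐰 ^ 2 - 55 * 𝐮 ^ 2 * 𝐯 ^ 4 * 𝐰 ^ 2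
  + 11 * 𝐮 * 𝐯 ^ 5 * 𝐰 ^ 2 + 3 * 𝐯 ^ 6 * 𝐰 ^ 2 + 5 * 𝐮 ^ 5 * 𝐰 ^ 3 + 19 * 𝐮 ^ 4 * 𝐯 * 𝐰 ^ 3
  + 42 * 𝐮 ^ 3 * 𝐯 ^ 2 * 𝐰 ^ 3 - 24 * 𝐮 ^ 2 * 𝐯 ^ 3 * 𝐰 ^ 3 - 25 * 𝐮 * 𝐯 ^ 4 * 𝐰 ^ 3
  - 17 * 𝐯 ^ 5 * 𝐰 ^ 3 + 4 * 𝐮 ^ 4 * 𝐰 ^ 4 - 26 * 𝐮 ^ 3 * 𝐯 * 𝐰 ^ 4 - 33 * 𝐮 ^ 2 * 𝐯 ^ 2 * 𝐰 ^ 4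
  + 62 * 𝐮 * 𝐯 ^ 3 * 𝐰 ^ 4 - 7 * 𝐯 ^ 4 * 𝐰 ^ 4 - 5 * 𝐮 ^ 3 * 𝐰 ^ 5 - 50 * 𝐮 ^ 2 * 𝐯 * 𝐰 ^ 5
  + 38 * 𝐮 * 𝐯 ^ 2 * 𝐰 ^ 5 + 17 * 𝐯 ^ 3 * 𝐰 ^ 5 + 5 * 𝐮 ^ 2 * 𝐰 ^ 6 + 12 * 𝐮 * 𝐯 * 𝐰 ^ 6
  - 17 * 𝐯 ^ 2 * 𝐰 ^ 6 + 11 * 𝐮 * 𝐰 ^ 7 - 11 * 𝐯 * 𝐰 ^ 7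

lemma sat11_8_mem : sat11_8 ∈ sqColon 11 11 8 := by
  refine mem_sqColon_of_eq gens11_mem
    [(0, 0, -2 * 𝐮 * 𝐰 ^ 2), (0, 3, -2 * 𝐰 ^ 2), (0, 4, 6 * 𝐮 * 𝐰 + 6 * 𝐯 * 𝐰), (1, 2, 𝐮),
    (1, 4, -3 * 𝐰), (1, 5, 3 * 𝐮 - 3 * 𝐯), (2, 3, 𝐰), (2, 4, 3 * 𝐰), (3, 3, 𝐮 - 𝐰), (3, 4, -4 * 𝐯
    - 2 * 𝐰), (4, 5, -𝐯)] ?_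
  simp only [quadComb_cons, quadComb_nil, gens11, sat11_8, Matrix.cons_val]
  ring

/-- A form of degree `9` in the saturation of the square of the ideal of the triple points of
`B_11`. -/
noncomputable def sat11_9 : MvPolynomial (Fin 3) ℂ :=
  𝐮 ^ 7 * 𝐯 ^ 2 - 𝐮 * 𝐯 ^ 8 - 𝐮 ^ 7 * 𝐯 * 𝐰 - 𝐮 ^ 6 * 𝐯 ^ 2 * 𝐰 - 6 * 𝐮 ^ 5 * 𝐯 ^ 3 * 𝐰
  - 2 * 𝐮 ^ 4 * 𝐯 ^ 4 * 𝐰 + 𝐮 ^ 3 * 𝐯 ^ 5 * 𝐰 + 6 * 𝐮 ^ 2 * 𝐯 ^ 6 * 𝐰 + 2 * 𝐮 * 𝐯 ^ 7 * 𝐰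
  + 𝐯 ^ 8 * 𝐰 + 𝐮 ^ 6 * 𝐯 * 𝐰 ^ 2 + 11 * 𝐮 ^ 5 * 𝐯 ^ 2 * 𝐰 ^ 2 + 3 * 𝐮 ^ 4 * 𝐯 ^ 3 * 𝐰 ^ 2
  - 𝐮 ^ 3 * 𝐯 ^ 4 * 𝐰 ^ 2 - 6 * 𝐮 ^ 2 * 𝐯 ^ 5 * 𝐰 ^ 2 - 9 * 𝐮 * 𝐯 ^ 6 * 𝐰 ^ 2 + 𝐯 ^ 7 * 𝐰 ^ 2
  - 𝐮 ^ 6 * 𝐰 ^ 3 + 𝐮 ^ 5 * 𝐯 * 𝐰 ^ 3 + 7 * 𝐮 ^ 4 * 𝐯 ^ 2 * 𝐰 ^ 3 - 5 * 𝐮 ^ 3 * 𝐯 ^ 3 * 𝐰 ^ 3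
  + 13 * 𝐮 ^ 2 * 𝐯 ^ 4 * 𝐰 ^ 3 - 13 * 𝐮 * 𝐯 ^ 5 * 𝐰 ^ 3 - 2 * 𝐯 ^ 6 * 𝐰 ^ 3 - 2 * 𝐮 ^ 5 * 𝐰 ^ 4
  - 13 * 𝐮 ^ 4 * 𝐯 * 𝐰 ^ 4 - 18 * 𝐮 ^ 3 * 𝐯 ^ 2 * 𝐰 ^ 4 + 11 * 𝐮 ^ 2 * 𝐯 ^ 3 * 𝐰 ^ 4
  + 14 * 𝐮 * 𝐯 ^ 4 * 𝐰 ^ 4 + 8 * 𝐯 ^ 5 * 𝐰 ^ 4 + 2 * 𝐮 ^ 4 * 𝐰 ^ 5 - 2 * 𝐮 ^ 3 * 𝐯 * 𝐰 ^ 5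
  + 9 * 𝐮 ^ 2 * 𝐯 ^ 2 * 𝐰 ^ 5 - 15 * 𝐮 * 𝐯 ^ 3 * 𝐰 ^ 5 + 6 * 𝐯 ^ 4 * 𝐰 ^ 5 + 4 * 𝐮 ^ 3 * 𝐰 ^ 6
  + 16 * 𝐮 ^ 2 * 𝐯 * 𝐰 ^ 6 - 13 * 𝐮 * 𝐯 ^ 2 * 𝐰 ^ 6 - 7 * 𝐯 ^ 3 * 𝐰 ^ 6 + 𝐮 ^ 2 * 𝐰 ^ 7
  - 5 * 𝐮 * 𝐯 * 𝐰 ^ 7 + 4 * 𝐯 ^ 2 * 𝐰 ^ 7 - 3 * 𝐮 * 𝐰 ^ 8 + 3 * 𝐯 * 𝐰 ^ 8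

lemma sat11_9_mem : sat11_9 ∈ sqColon 11 11 9 := by
  refine mem_sqColon_of_eq gens11_mem
    [(0, 5, -2 * 𝐯 * 𝐰 + 𝐰 ^ 2), (2, 3, 𝐯), (5, 5, -𝐮 + 𝐯)] ?_
  simp only [quadComb_cons, quadComb_nil, gens11, sat11_9, Matrix.cons_val]
  ring

/-- A form of degree `9` in the saturation of the square of the ideal of the triple points of
`B_11`. -/
noncomputable def sat11_9' : MvPolynomial (Fin 3) ℂ :=
  𝐮 ^ 2 * 𝐯 ^ 7 - 𝐯 ^ 9 + 𝐮 ^ 8 * 𝐰 + 2 * 𝐮 ^ 7 * 𝐯 * 𝐰 - 𝐮 ^ 5 * 𝐯 ^ 3 * 𝐰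
  - 2 * 𝐮 ^ 4 * 𝐯 ^ 4 * 𝐰 - 6 * 𝐮 ^ 3 * 𝐯 ^ 5 * 𝐰 - 𝐮 ^ 2 * 𝐯 ^ 6 * 𝐰 + 7 * 𝐮 * 𝐯 ^ 7 * 𝐰
  - 𝐮 ^ 7 * 𝐰 ^ 2 - 5 * 𝐮 ^ 6 * 𝐯 * 𝐰 ^ 2 - 6 * 𝐮 ^ 5 * 𝐯 ^ 2 * 𝐰 ^ 2 + 10 * 𝐮 ^ 4 * 𝐯 ^ 3 * 𝐰 ^ 2
  + 11 * 𝐮 ^ 3 * 𝐯 ^ 4 * 𝐰 ^ 2 - 10 * 𝐮 ^ 2 * 𝐯 ^ 5 * 𝐰 ^ 2 + 𝐮 * 𝐯 ^ 6 * 𝐰 ^ 2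
  - 2 * 𝐮 ^ 6 * 𝐰 ^ 3 + 𝐮 ^ 5 * 𝐯 * 𝐰 ^ 3 - 3 * 𝐮 ^ 4 * 𝐯 ^ 2 * 𝐰 ^ 3 + 15 * 𝐮 ^ 3 * 𝐯 ^ 3 * 𝐰 ^ 3
  + 𝐮 ^ 2 * 𝐯 ^ 4 * 𝐰 ^ 3 - 5 * 𝐮 * 𝐯 ^ 5 * 𝐰 ^ 3 - 7 * 𝐯 ^ 6 * 𝐰 ^ 3 + 6 * 𝐮 ^ 5 * 𝐰 ^ 4
  + 9 * 𝐮 ^ 4 * 𝐯 * 𝐰 ^ 4 - 15 * 𝐮 ^ 3 * 𝐯 ^ 2 * 𝐰 ^ 4 - 12 * 𝐮 ^ 2 * 𝐯 ^ 3 * 𝐰 ^ 4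
  + 13 * 𝐮 * 𝐯 ^ 4 * 𝐰 ^ 4 - 𝐯 ^ 5 * 𝐰 ^ 4 + 5 * 𝐮 ^ 3 * 𝐯 * 𝐰 ^ 5 - 17 * 𝐮 ^ 2 * 𝐯 ^ 2 * 𝐰 ^ 5
  + 6 * 𝐮 * 𝐯 ^ 3 * 𝐰 ^ 5 + 6 * 𝐯 ^ 4 * 𝐰 ^ 5 - 3 * 𝐮 ^ 3 * 𝐰 ^ 6 + 5 * 𝐮 ^ 2 * 𝐯 * 𝐰 ^ 6
  + 2 * 𝐮 * 𝐯 ^ 2 * 𝐰 ^ 6 - 4 * 𝐯 ^ 3 * 𝐰 ^ 6 - 2 * 𝐮 ^ 2 * 𝐰 ^ 7 + 3 * 𝐮 * 𝐯 * 𝐰 ^ 7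
  - 𝐯 ^ 2 * 𝐰 ^ 7 - 𝐮 * 𝐰 ^ 8 + 𝐯 * 𝐰 ^ 8

lemma sat11_9'_mem : sat11_9' ∈ sqColon 11 11 9 := by
  refine mem_sqColon_of_eq gens11_mem
    [(0, 2, 𝐰 ^ 2), (0, 4, 2 * 𝐮 * 𝐰), (1, 3, -𝐮), (4, 4, 𝐮 - 𝐯)] ?_
  simp only [quadComb_cons, quadComb_nil, gens11, sat11_9', Matrix.cons_val]
  ring

/-- A form of degree `9` in the saturation of the square of the ideal of the triple points of
`B_11`. -/
noncomputable def sat11_9'' : MvPolynomial (Fin 3) ℂ :=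
  𝐮 ^ 6 * 𝐯 ^ 3 - 𝐮 * 𝐯 ^ 8 + 𝐮 ^ 8 * 𝐰 - 𝐮 ^ 7 * 𝐯 * 𝐰 - 2 * 𝐮 ^ 6 * 𝐯 ^ 2 * 𝐰
  - 6 * 𝐮 ^ 4 * 𝐯 ^ 4 * 𝐰 + 7 * 𝐮 ^ 2 * 𝐯 ^ 6 * 𝐰 + 𝐯 ^ 8 * 𝐰 + 2 * 𝐮 ^ 7 * 𝐰 ^ 2
  - 6 * 𝐮 ^ 6 * 𝐯 * 𝐰 ^ 2 + 6 * 𝐮 ^ 5 * 𝐯 ^ 2 * 𝐰 ^ 2 + 10 * 𝐮 ^ 4 * 𝐯 ^ 3 * 𝐰 ^ 2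
  - 15 * 𝐮 ^ 3 * 𝐯 ^ 4 * 𝐰 ^ 2 + 10 * 𝐮 ^ 2 * 𝐯 ^ 5 * 𝐰 ^ 2 - 6 * 𝐮 * 𝐯 ^ 6 * 𝐰 ^ 2
  - 𝐯 ^ 7 * 𝐰 ^ 2 - 10 * 𝐮 ^ 5 * 𝐯 * 𝐰 ^ 3 + 21 * 𝐮 ^ 4 * 𝐯 ^ 2 * 𝐰 ^ 3
  - 8 * 𝐮 ^ 3 * 𝐯 ^ 3 * 𝐰 ^ 3 - 𝐮 ^ 2 * 𝐯 ^ 4 * 𝐰 ^ 3 - 2 * 𝐯 ^ 6 * 𝐰 ^ 3 + 3 * 𝐮 ^ 5 * 𝐰 ^ 4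
  - 𝐮 ^ 4 * 𝐯 * 𝐰 ^ 4 - 2 * 𝐮 ^ 3 * 𝐯 ^ 2 * 𝐰 ^ 4 + 4 * 𝐮 ^ 2 * 𝐯 ^ 3 * 𝐰 ^ 4
  - 10 * 𝐮 * 𝐯 ^ 4 * 𝐰 ^ 4 + 6 * 𝐯 ^ 5 * 𝐰 ^ 4 + 9 * 𝐮 ^ 4 * 𝐰 ^ 5 - 20 * 𝐮 ^ 3 * 𝐯 * 𝐰 ^ 5
  + 16 * 𝐮 ^ 2 * 𝐯 ^ 2 * 𝐰 ^ 5 - 2 * 𝐮 * 𝐯 ^ 3 * 𝐰 ^ 5 - 3 * 𝐯 ^ 4 * 𝐰 ^ 5 - 4 * 𝐮 ^ 3 * 𝐰 ^ 6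
  - 8 * 𝐮 ^ 2 * 𝐯 * 𝐰 ^ 6 + 8 * 𝐮 * 𝐯 ^ 2 * 𝐰 ^ 6 + 4 * 𝐯 ^ 3 * 𝐰 ^ 6 + 5 * 𝐮 ^ 2 * 𝐰 ^ 7
  - 7 * 𝐮 * 𝐯 * 𝐰 ^ 7 + 2 * 𝐯 ^ 2 * 𝐰 ^ 7 + 3 * 𝐮 * 𝐰 ^ 8 - 3 * 𝐯 * 𝐰 ^ 8

lemma sat11_9''_mem : sat11_9'' ∈ sqColon 11 11 9 := by
  refine mem_sqColon_of_eq gens11_mem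
    [(0, 0, -𝐮 * 𝐰 ^ 2), (0, 1, 𝐯 * 𝐰), (1, 3, 𝐯), (1, 5, 𝐮), (4, 4, -𝐯 + 𝐰), (4, 5, -𝐰)] ?_
  simp only [quadComb_cons, quadComb_nil, gens11, sat11_9'', Matrix.cons_val]
  ring

theorem containment_eleven :
    (⨅ P ∈ tripleSet 11, (mP P) ^ 3) ≤ (⨅ P ∈ tripleSet 11, mP P) ^ 2 := by
  refine containment_of_certificates (N := 11) (M := 10) (E := {(2, 6), (8, 0), (9, 0), (8, 1),
    (7, 2), (6, 3), (5, 4), (4, 5), (3, 6), (2, 7)}) [0, 0, 1, 2, 3, 4, 5, 3, 4, 5, 1]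
    (by decide +kernel) (by decide) (by decide +kernel) (by decide) gens11_mem ?_ ?_
  · intro k hk
    refine ⟨[
        [(2, 2, 1)],
        [(2, 5, 1)],
        [(5, 5, 1)],
        [(2, 4, 1), (3, 5, -1)],
        [(2, 4, 1)],
        [(1, 2, 1)],
        [(1, 5, 1)],
        [(1, 3, -1), (4, 4, 1)],
        [(4, 4, 1)],
        [(1, 4, 1)],
        [(1, 1, 1)]].getD k [], ?_⟩
    interval_cases k <;> simp only [List.getD_cons_zero, List.getD_cons_succ, quadComb_cons,
      quadComb_nil, gens11, mon, Matrix.cons_val, lead_X_zero, lead_X_one, lead_X_two, map_add,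
      map_sub, map_mul, map_pow, map_neg, map_one, map_zero, map_ofNat] <;> ring
  · simp only [Finset.forall_mem_insert, Finset.mem_singleton, forall_eq]
    refine ⟨⟨[(-2, 7, 1), (1, 6, 2), (2, 1, 7), (1, 3, 5), (-3, 4, 4), (3, 0, 8),
        (-1, 5, 3)], by decide, [], sat11_8, sat11_8_mem, ?_⟩,
      ⟨[(2, 4, 4), (-1, 0, 8)], by decide, [(0, 0, 1)], 0, zero_mem _, ?_⟩,
      ⟨[(1, 1, 8)], by decide, [(0, 0, -𝐮), (0, 1, 2)], 0, zero_mem _, ?_⟩,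
      ⟨[(1, 0, 9)], by decide, [(0, 0, 𝐯), (0, 2, 2)], 0, zero_mem _, ?_⟩,
      ⟨[(1, 1, 8)], by decide, [], sat11_9, sat11_9_mem, ?_⟩,
      ⟨[(1, 1, 8)], by decide, [], sat11_9'', sat11_9''_mem, ?_⟩,
      ⟨[(1, 1, 8)], by decide, [(0, 5, 1)], 0, zero_mem _, ?_⟩,
      ⟨[(1, 0, 9)], by decide, [(0, 2, 1)], 0, zero_mem _, ?_⟩,
      ⟨[(1, 0, 9)], by decide, [(0, 3, -1)], sat11_9 + sat11_9' + -sat11_9'', add_mem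
        (add_mem sat11_9_mem sat11_9'_mem) (neg_mem sat11_9''_mem), ?_⟩,
      ⟨[(1, 0, 9)], by decide, [], sat11_9', sat11_9'_mem, ?_⟩⟩
    all_goals
      simp only [quadComb_cons, quadComb_nil, gens11, sat11_8, sat11_9, sat11_9'', sat11_9', mon,
        binForm_cons, binForm_nil, Int.cast_ofNat, Int.cast_neg, Int.cast_one, Matrix.cons_val,
        lead_X_zero, lead_X_one, lead_X_two, map_add, map_sub, map_mul, map_pow, map_neg, map_one,
        map_zero, map_ofNat]
      ring

/-- For `4 ≤ n ≤ 11`, the radical ideal `Iₙ = ⋂_{P ∈ Tₙ} m_P` of the triple points of the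
Böröczky arrangement of `n` lines satisfies the containment `Iₙ⁽³⁾ ⊆ Iₙ²`. -/
theorem boroczky_containment_holds (n : ℕ) (h4 : 4 ≤ n) (h11 : n ≤ 11) :
    (⨅ P ∈ tripleSet n, (mP P) ^ 3) ≤ (⨅ P ∈ tripleSet n, mP P) ^ 2 := by
  interval_cases n
  · exact containment_four
  · exact containment_five
  · exact containment_six
  · exact containment_seven
  · exact containment_eight
  · exact containment_nine
  · exact containment_ten
  · exact containment_eleven
end
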